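/- Let d ∈ ℕ, 1 < p ≤ 2 ≤ q ≤ ∞, 1 ≤ θ ≤ 2 and r > 1/p. Then ρ_m(S^r_{p,θ}B)_{L_q} ≲ m^{−(r − 1/p + 1/q)} · (log* m)^{(d−1)(r + 1 − 1/p − 1/θ) + 3(r − 1/p + 1/q)}; moreover, for 1 < p ≤ 2 ≤ q ≤ ∞ and r > 1/p, ρ_m(S^r_p W)_{L_q} ≲ m^{−(r − 1/p + 1/q)} · (log* m)^{(d−1)(r + 1 − 2/p) + 3(r − 1/p + 1/q)}. -/

import Mathlib

open MeasureTheory Real ENNReal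

noncomputable section

namespace Paper

/-- The fundamental domain `[0,1)^d` of the `d`-dimensional torus `𝕋^d`. -/
def cube (d : ℕ) : Set (Fin d → ℝ) := Set.univ.pi fun _ => Set.Ico (0:ℝ) 1

/-- The trigonometric character `x ↦ e^{2π i k·x}`. -/
def expk (d : ℕ) (k : Fin d → ℤ) (x : Fin d → ℝ) : ℂ :=
  Complex.exp (((2 * Real.pi * ∑ i, (k i : ℝ) * x i : ℝ) : ℂ) * Complex.I)

/-- Fourier coefficient `f̂(k) = ∫_{[0,1)^d} f(x) e^{-2π i k·x} dx`. -/
def fCoeff (d : ℕ) (f : (Fin d → ℝ) → ℂ) (k : Fin d → ℤ) : ℂ :=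
  ∫ x in cube d, f x * expk d (-k) x

/-- The `L_q` (quasi-)norm on the torus, `q ∈ (0,∞]`, valued in `ℝ≥0∞`
(for `q = ∞` this is the essential supremum). -/
def LqNorm (d : ℕ) (q : ℝ≥0∞) (f : (Fin d → ℝ) → ℂ) : ℝ≥0∞ :=
  eLpNorm f q (volume.restrict (cube d))

/-- The weight `∏_{i=1}^d (1+|k_i|)`. -/
def wt (d : ℕ) (k : Fin d → ℤ) : ℝ := ∏ i, (1 + |(k i : ℝ)|)

/-- The weighted Wiener (quasi-)norm `‖f‖_{S^r_θ A}`
(with the sup modification for `θ = ∞`); `A_θ` corresponds to `r = 0`,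
the Wiener algebra `A` to `r = 0`, `θ = 1`. -/
def wienerNorm (d : ℕ) (r : ℝ) (θ : ℝ≥0∞) (f : (Fin d → ℝ) → ℂ) : ℝ≥0∞ :=
  if θ = ∞ then ⨆ k : Fin d → ℤ, ENNReal.ofReal (wt d k ^ r) * (‖fCoeff d f k‖₊ : ℝ≥0∞)
  else (∑' k : Fin d → ℤ,
      (ENNReal.ofReal (wt d k ^ r) * (‖fCoeff d f k‖₊ : ℝ≥0∞)) ^ θ.toReal) ^ (1 / θ.toReal)

/-- Trigonometric polynomials with at most `m` terms. -/
def trigPoly (d m : ℕ) : Set ((Fin d → ℝ) → ℂ) :=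
  {s | ∃ (Λ : Finset (Fin d → ℤ)) (a : (Fin d → ℤ) → ℂ),
    Λ.card ≤ m ∧ s = fun x => ∑ k ∈ Λ, a k * expk d k x}

/-- Best `m`-term trigonometric approximation error of `f`, error measured by `X`. -/
def sigmaF (d m : ℕ) (X : ((Fin d → ℝ) → ℂ) → ℝ≥0∞) (f : (Fin d → ℝ) → ℂ) : ℝ≥0∞ :=
  ⨅ s ∈ trigPoly d m, X (f - s)

/-- The unit ball of the space (inside `L₁(𝕋^d)`) with (quasi-)norm `N`. -/
def unitBall (d : ℕ) (N : ((Fin d → ℝ) → ℂ) → ℝ≥0∞) : Set ((Fin d → ℝ) → ℂ) :=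
  {f | IntegrableOn f (cube d) ∧ N f ≤ 1}

/-- Best `m`-term trigonometric width of the unit ball of `N`, error measured by `X`. -/
def sigmaClass (d m : ℕ) (N X : ((Fin d → ℝ) → ℂ) → ℝ≥0∞) : ℝ≥0∞ :=
  ⨆ f ∈ unitBall d N, sigmaF d m X f

/-- `log*(m) = max (log₂ m) 1`. -/
def logStar (m : ℕ) : ℝ := max (Real.logb 2 m) 1

/-- Two-sided asymptotic equivalence `a_m ≍ b_m`. -/
def IsAsympEquiv (a : ℕ → ℝ≥0∞) (b : ℕ → ℝ) : Prop :=
  ∃ c C : ℝ, 0 < c ∧ 0 < C ∧ ∃ m₀ : ℕ, ∀ m : ℕ, m₀ ≤ m →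
    ENNReal.ofReal (c * b m) ≤ a m ∧ a m ≤ ENNReal.ofReal (C * b m)

/-- One-sided asymptotic bound `a_m ≲ b_m`. -/
def IsAsympLe (a : ℕ → ℝ≥0∞) (b : ℕ → ℝ) : Prop :=
  ∃ C : ℝ, 0 < C ∧ ∃ m₀ : ℕ, ∀ m : ℕ, m₀ ≤ m → a m ≤ ENNReal.ofReal (C * b m)

/-- Dyadic block `I_0 = {0}`, `I_n = {k : 2^{n-1} ≤ |k| < 2^n}` for `n ≥ 1`. -/
def blockF (n : ℕ) : Finset ℤ :=
  (Finset.Icc (-(2^n : ℤ)) (2^n)).filter fun k =>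
    (n = 0 ∧ k = 0) ∨ (n ≠ 0 ∧ 2^(n-1) ≤ |k| ∧ |k| < 2^n)

/-- The dyadic block projection `∑_{k ∈ I_j} f̂(k) e^{2π i k·x}`. -/
def blockProj (d : ℕ) (f : (Fin d → ℝ) → ℂ) (j : Fin d → ℕ) : (Fin d → ℝ) → ℂ :=
  fun x => ∑ k ∈ Fintype.piFinset (fun i => blockF (j i)), fCoeff d f k * expk d k x

/-- The mixed-smoothness Besov (quasi-)norm `‖f‖_{S^s_{p,θ}B}`
(with the sup modification for `θ = ∞`). -/
def besovNorm (d : ℕ) (s : ℝ) (p θ : ℝ≥0∞) (f : (Fin d → ℝ) → ℂ) : ℝ≥0∞ :=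
  if θ = ∞ then
    ⨆ j : Fin d → ℕ,
      ENNReal.ofReal ((2:ℝ) ^ (((∑ i, j i : ℕ) : ℝ) * s)) * LqNorm d p (blockProj d f j)
  else
    (∑' j : Fin d → ℕ,
      (ENNReal.ofReal ((2:ℝ) ^ (((∑ i, j i : ℕ) : ℝ) * s)) * LqNorm d p (blockProj d f j))
        ^ θ.toReal) ^ (1 / θ.toReal)

/-- The mixed-smoothness Sobolev norm `‖f‖_{S^s_p W}` (Littlewood–Paley form),
with `S^0_p W := L_p`. -/
def sobolevNorm (d : ℕ) (s : ℝ) (p : ℝ≥0∞) (f : (Fin d → ℝ) → ℂ) : ℝ≥0∞ :=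
  if s = 0 then LqNorm d p f
  else
    (∫⁻ x in cube d,
      ((∑' j : Fin d → ℕ,
        (ENNReal.ofReal ((2:ℝ) ^ (((∑ i, j i : ℕ) : ℝ) * s)) *
          (‖blockProj d f j x‖₊ : ℝ≥0∞)) ^ (2:ℕ)) ^ ((1:ℝ)/2)) ^ p.toReal) ^ (1 / p.toReal)

/-- Trigonometric polynomials with frequencies in `[-M,M]^d`. -/
def boxPoly (d M : ℕ) : Set ((Fin d → ℝ) → ℂ) :=
  {s | ∃ (Λ : Finset (Fin d → ℤ)) (a : (Fin d → ℤ) → ℂ),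
    (∀ k ∈ Λ, ∀ i, |k i| ≤ (M : ℤ)) ∧ s = fun x => ∑ k ∈ Λ, a k * expk d k x}

/-- Error of best approximation by trigonometric polynomials with
frequencies in `[-M,M]^d`, measured in `L_∞`. -/
def EBox (d M : ℕ) (f : (Fin d → ℝ) → ℂ) : ℝ≥0∞ :=
  ⨅ g ∈ boxPoly d M, LqNorm d ∞ (f - g)

/-- The `m`-th (non-linear) sampling width of the class of continuous functions
in the unit ball of `N`, error measured in `L_q`. -/
def samplingWidth (d m : ℕ) (N : ((Fin d → ℝ) → ℂ) → ℝ≥0∞) (q : ℝ≥0∞) : ℝ≥0∞ :=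
  ⨅ (t : Fin m → (Fin d → ℝ)) (_ : ∀ i, t i ∈ cube d)
    (R : (Fin m → ℂ) → ((Fin d → ℝ) → ℂ)),
    ⨆ f ∈ {f : (Fin d → ℝ) → ℂ | Continuous f ∧ N f ≤ 1},
      LqNorm d q (f - R fun i => f (t i))


/-- First moment method, one point at a time: finitely many events can be hit simultaneously. -/
theorem exists_points_weighted {Ω H : Type*} [MeasurableSpace Ω] (μ : Measure Ω)
    [IsProbabilityMeasure μ] (Z : Set Ω) (hZ : μ Z = 0) (s : Finset H) (E : H → Set Ω)
    (hE : ∀ h ∈ s, MeasurableSet (E h)) (Q : H → ℝ) (hQ : ∀ h ∈ s, Q h ≤ μ.real (E h)) (m : ℕ) :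
    ∀ β : H → ℝ, (∀ h ∈ s, 0 ≤ β h) → ∃ t : Fin m → Ω, (∀ i, t i ∉ Z) ∧
      ∑ h ∈ s, β h * ∏ i, (1 - (E h).indicator (fun _ => (1 / 2 : ℝ)) (t i)) ≤
      ∑ h ∈ s, β h * (1 - Q h / 2) ^ m := by
  induction m with
  | zero => intro β _; exact ⟨Fin.elim0, fun i => i.elim0, by simp⟩
  | succ m ih =>
    intro β hβ
    have hQ1 : ∀ h ∈ s, 0 ≤ 1 - Q h / 2 := by
      intro h hh
      have h1 := hQ h hh
      have h2 : μ.real (E h) ≤ 1 := measureReal_le_one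
      linarith
    have hint : ∀ h ∈ s, Integrable ((E h).indicator (fun _ => (1 / 2 : ℝ))) μ := fun h hh =>
      (integrable_const _).indicator (hE h hh)
    have hint' : ∀ h ∈ s, Integrable (fun x => β h * (1 - Q h / 2) ^ m *
        (1 - (E h).indicator (fun _ => (1 / 2 : ℝ)) x)) μ := fun h hh =>
      ((integrable_const _).sub (hint h hh)).const_mul _
    obtain ⟨x, hxZ, hx⟩ := exists_notMem_null_le_integral (μ := μ) (N := Z)
      (f := fun x => ∑ h ∈ s, β h * (1 - Q h / 2) ^ m *
        (1 - (E h).indicator (fun _ => (1 / 2 : ℝ)) x))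
      (integrable_finsetSum _ hint') hZ
    rw [integral_finsetSum _ hint'] at hx
    have hle : ∑ h ∈ s, ∫ a, β h * (1 - Q h / 2) ^ m *
        (1 - (E h).indicator (fun _ => (1 / 2 : ℝ)) a) ∂μ ≤
        ∑ h ∈ s, β h * (1 - Q h / 2) ^ (m + 1) := by
      refine Finset.sum_le_sum fun h hh => ?_
      rw [integral_const_mul, integral_sub (integrable_const _) (hint h hh),
        integral_indicator_const _ (hE h hh), pow_succ, ← mul_assoc]
      refine mul_le_mul_of_nonneg_left ?_ (mul_nonneg (hβ h hh) (pow_nonneg (hQ1 h hh) _))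
      have h1 := hQ h hh
      simp only [integral_const, probReal_univ, smul_eq_mul]
      linarith
    have hind : ∀ h, 0 ≤ 1 - (E h).indicator (fun _ => (1 / 2 : ℝ)) x := by
      intro h
      by_cases hxE : x ∈ E h <;> simp [hxE]; norm_num
    obtain ⟨t, htZ, ht⟩ := ih (fun h => β h * (1 - (E h).indicator (fun _ => (1 / 2 : ℝ)) x))
      fun h hh => mul_nonneg (hβ h hh) (hind h)
    refine ⟨Fin.cons x t, fun i => Fin.cases hxZ htZ i, le_trans (le_of_eq ?_)
      ((ht.trans (le_of_eq ?_)).trans (hx.trans hle))⟩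
    · refine Finset.sum_congr rfl fun h _ => ?_
      simp only [Fin.prod_univ_succ, Fin.cons_zero, Fin.cons_succ]
      ring
    · refine Finset.sum_congr rfl fun h _ => ?_
      ring

open Classical in
/-- Finitely many events of probability at least `Q` can be hit proportionally often. -/
theorem exists_points_hitting {Ω H : Type*} [MeasurableSpace Ω] (μ : Measure Ω)
    [IsProbabilityMeasure μ] (Z : Set Ω) (hZ : μ Z = 0) (s : Finset H) (E : H → Set Ω)
    (hE : ∀ h ∈ s, MeasurableSet (E h)) (Q : H → ℝ)
    (hQ : ∀ h ∈ s, Q h ≤ μ.real (E h)) (m : ℕ) (hsum : ∑ h ∈ s, exp (-(m * Q h / 4)) < 1) :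
    ∃ t : Fin m → Ω, (∀ i, t i ∉ Z) ∧ ∀ h ∈ s,
      m * Q h / 4 < ((Finset.univ.filter fun i => t i ∈ E h).card : ℝ) := by
  obtain ⟨t, htZ, ht⟩ := exists_points_weighted μ Z hZ s E hE Q hQ m
    (fun h => exp (m * Q h / 4)) fun _ _ => (exp_pos _).le
  refine ⟨t, htZ, fun h hh => ?_⟩
  have hprod : ∀ h, ∏ i, (1 - (E h).indicator (fun _ => (1 / 2 : ℝ)) (t i)) =
      (1 / 2) ^ (Finset.univ.filter fun i => t i ∈ E h).card := by
    intro h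
    rw [← Finset.prod_const, Finset.prod_filter]
    refine Finset.prod_congr rfl fun i _ => ?_
    by_cases hi : t i ∈ E h <;> simp [hi]; norm_num
  simp only [hprod] at ht
  have hlt : ∑ h ∈ s, exp (m * Q h / 4) * (1 - Q h / 2) ^ m < 1 := by
    refine lt_of_le_of_lt (Finset.sum_le_sum fun h hh => ?_) hsum
    have h1 : (1 - Q h / 2) ^ m ≤ exp (-(Q h / 2)) ^ m := by
      refine pow_le_pow_left₀ ?_ ?_ _
      · have := hQ h hh
        have h2 : μ.real (E h) ≤ 1 := measureReal_le_one
        linarith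
      · have := add_one_le_exp (-(Q h / 2)); linarith
    calc exp (m * Q h / 4) * (1 - Q h / 2) ^ m
        ≤ exp (m * Q h / 4) * exp (-(Q h / 2)) ^ m := by gcongr
      _ = exp (-(m * Q h / 4)) := by
        rw [← exp_nat_mul, ← exp_add]; congr 1; ring
  set c := (Finset.univ.filter fun i => t i ∈ E h).card
  have hterm : exp (m * Q h / 4) * (1 / 2) ^ c < 1 := by
    refine lt_of_le_of_lt ?_ (lt_of_le_of_lt ht hlt)
    exact Finset.single_le_sum
      (f := fun h => exp (m * Q h / 4) *
        (1 / 2 : ℝ) ^ (Finset.univ.filter fun i => t i ∈ E h).card)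
      (fun h _ => by positivity) hh
  have h2 : exp (-(c : ℝ)) ≤ (1 / 2) ^ c := by
    have : exp (-1) ≤ 1 / 2 := by
      rw [exp_neg, one_div]
      refine inv_anti₀ (by norm_num) ?_
      have := add_one_le_exp (1 : ℝ); linarith
    calc exp (-(c : ℝ)) = exp (-1) ^ c := by rw [← exp_nat_mul]; congr 1; ring
      _ ≤ _ := pow_le_pow_left₀ (exp_pos _).le this _
  have h3 : exp (m * Q h / 4 - c) < 1 := by
    rw [sub_eq_add_neg, exp_add]
    exact lt_of_le_of_lt (by gcongr) hterm
  have := exp_lt_one_iff.1 h3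
  linarith

theorem exp_le_one_add_add_sq {y : ℝ} (hy : |y| ≤ 1) : exp y ≤ 1 + y + y ^ 2 := by
  have := abs_le.1 (abs_exp_sub_one_sub_id_le hy)
  linarith [this.2]

/-- A Hoeffding type bound for empirical means of a finite distribution. -/
theorem empirical_tail_real {B : Type*} [Fintype B] (w : B → ℝ) (hw : ∀ b, 0 ≤ w b)
    (hw1 : ∑ b, w b = 1) (u : B → ℝ) (hu : ∀ b, |u b| ≤ 1) (K : ℕ) (η : ℝ) (hη0 : 0 ≤ η)
    (hη1 : η ≤ 1) :
    ∑ ω : Fin K → B, (∏ i, w (ω i)) *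
      (if K * η < ∑ i, u (ω i) - K * ∑ b, w b * u b then (1 : ℝ) else 0) ≤
      exp (-(K * η ^ 2 / 16)) := by
  set v := ∑ b, w b * u b with hv
  have hv1 : |v| ≤ 1 := by
    calc |v| ≤ ∑ b, |w b * u b| := Finset.abs_sum_le_sum_abs _ _
      _ ≤ ∑ b, w b := Finset.sum_le_sum fun b _ => by
        rw [abs_mul, abs_of_nonneg (hw b)]
        exact mul_le_of_le_one_right (hw b) (hu b)
      _ = 1 := hw1
  have key : ∑ b, w b * exp (η / 8 * (u b - v)) ≤ exp (4 * (η / 8) ^ 2) := by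
    calc ∑ b, w b * exp (η / 8 * (u b - v))
        ≤ ∑ b, w b * (1 + η / 8 * (u b - v) + 4 * (η / 8) ^ 2) := by
          refine Finset.sum_le_sum fun b _ => mul_le_mul_of_nonneg_left ?_ (hw b)
          have h1 := abs_le.1 (hu b)
          have h2 := abs_le.1 hv1
          have h3 : |u b - v| ≤ 2 := abs_le.2 ⟨by linarith, by linarith⟩
          have h4 : |η / 8 * (u b - v)| ≤ 1 := by
            rw [abs_mul, abs_of_nonneg (by positivity)]
            nlinarith [abs_nonneg (u b - v)]
          have h5 := exp_le_one_add_add_sq h4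
          have h6 : (u b - v) ^ 2 ≤ 4 := by nlinarith [sq_abs (u b - v), abs_nonneg (u b - v)]
          nlinarith [mul_le_mul_of_nonneg_left h6 (sq_nonneg (η / 8))]
      _ = ∑ b, ((1 + 4 * (η / 8) ^ 2 - η / 8 * v) * w b + η / 8 * (w b * u b)) :=
          Finset.sum_congr rfl fun b _ => by ring
      _ = 1 + 4 * (η / 8) ^ 2 := by
          rw [Finset.sum_add_distrib, ← Finset.mul_sum, ← Finset.mul_sum, hw1, ← hv]; ring
      _ ≤ _ := by linarith [add_one_le_exp (4 * (η / 8) ^ 2)]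
  calc _ ≤ ∑ ω : Fin K → B, (∏ i, w (ω i) * exp (η / 8 * (u (ω i) - v))) *
        exp (-(K * η ^ 2 / 8)) := by
        refine Finset.sum_le_sum fun ω _ => ?_
        have hexp : ∏ i, exp (η / 8 * (u (ω i) - v)) =
            exp (η / 8 * (∑ i, u (ω i) - K * v)) := by
          rw [← exp_sum, ← Finset.mul_sum, Finset.sum_sub_distrib]; simp
        rw [Finset.prod_mul_distrib, hexp, mul_assoc, ← exp_add]
        refine mul_le_mul_of_nonneg_left ?_ (Finset.prod_nonneg fun i _ => hw _)
        split_ifs with h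
        · rw [one_le_exp_iff]
          nlinarith
        · exact (exp_pos _).le
    _ = (∑ b, w b * exp (η / 8 * (u b - v))) ^ K * exp (-(K * η ^ 2 / 8)) := by
        rw [← Finset.sum_mul, Finset.sum_pow', Fintype.piFinset_univ]
    _ ≤ exp (4 * (η / 8) ^ 2) ^ K * exp (-(K * η ^ 2 / 8)) := by
        gcongr
        exact Finset.sum_nonneg fun b _ => mul_nonneg (hw b) (exp_pos _).le
    _ = exp (-(K * η ^ 2 / 16)) := by
        rw [← exp_nat_mul, ← exp_add]; congr 1; ring

/-- The complex version of `empirical_tail_real`. -/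
theorem empirical_tail {B : Type*} [Fintype B] (w : B → ℝ) (hw : ∀ b, 0 ≤ w b)
    (hw1 : ∑ b, w b = 1) (φ : B → ℂ) (hφ : ∀ b, ‖φ b‖ ≤ 1) (K : ℕ) (hK : 0 < K) (ε : ℝ)
    (hε0 : 0 ≤ ε) (hε1 : ε ≤ 1) :
    ∑ ω : Fin K → B, (∏ i, w (ω i)) *
      (if ε < ‖∑ b, (w b : ℂ) * φ b - (∑ i, φ (ω i)) / K‖ then (1 : ℝ) else 0) ≤
      4 * exp (-(K * ε ^ 2 / 64)) := by
  have hK' : (0 : ℝ) < K := by exact_mod_cast hK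
  have main : ∀ u : B → ℝ, (∀ b, |u b| ≤ 1) → ∑ ω : Fin K → B, (∏ i, w (ω i)) *
      (if K * (ε / 2) < ∑ i, u (ω i) - K * ∑ b, w b * u b then (1 : ℝ) else 0) ≤
      exp (-(K * ε ^ 2 / 64)) := fun u hu => by
    have := empirical_tail_real w hw hw1 u hu K (ε / 2) (by linarith) (by linarith)
    convert this using 2; ring
  have hre := main (fun b => (φ b).re) fun b => (Complex.abs_re_le_norm _).trans (hφ b)
  have hre' := main (fun b => -(φ b).re) fun b => by
    rw [abs_neg]; exact (Complex.abs_re_le_norm _).trans (hφ b)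
  have him := main (fun b => (φ b).im) fun b => (Complex.abs_im_le_norm _).trans (hφ b)
  have him' := main (fun b => -(φ b).im) fun b => by
    rw [abs_neg]; exact (Complex.abs_im_le_norm _).trans (hφ b)
  refine le_trans ?_ ((add_le_add (add_le_add hre hre') (add_le_add him him')).trans
    (le_of_eq (by ring)))
  rw [← Finset.sum_add_distrib, ← Finset.sum_add_distrib, ← Finset.sum_add_distrib]
  refine Finset.sum_le_sum fun ω _ => ?_
  rw [← mul_add, ← mul_add, ← mul_add]
  refine mul_le_mul_of_nonneg_left ?_ (Finset.prod_nonneg fun i _ => hw _)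
  have ite_nonneg : ∀ P : Prop, ∀ [Decidable P], (0 : ℝ) ≤ if P then 1 else 0 := by
    intro P _; split_ifs <;> norm_num
  by_cases hbad : ε < ‖∑ b, (w b : ℂ) * φ b - (∑ i, φ (ω i)) / K‖
  swap
  · rw [if_neg hbad]
    exact add_nonneg (add_nonneg (ite_nonneg _) (ite_nonneg _))
      (add_nonneg (ite_nonneg _) (ite_nonneg _))
  rw [if_pos hbad]
  set z := ∑ b, (w b : ℂ) * φ b - (∑ i, φ (ω i)) / K with hz
  have hzre : K * z.re = K * ∑ b, w b * (φ b).re - ∑ i, (φ (ω i)).re := by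
    have : z.re = ∑ b, w b * (φ b).re - (∑ i, (φ (ω i)).re) / K := by
      rw [hz, Complex.sub_re, Complex.div_natCast_re, Complex.re_sum, Complex.re_sum]
      simp
    rw [this]; field_simp
  have hzim : K * z.im = K * ∑ b, w b * (φ b).im - ∑ i, (φ (ω i)).im := by
    have : z.im = ∑ b, w b * (φ b).im - (∑ i, (φ (ω i)).im) / K := by
      rw [hz, Complex.sub_im, Complex.div_natCast_im, Complex.im_sum, Complex.im_sum]
      simp
    rw [this]; field_simp
  have hcase : ε / 2 < |z.re| ∨ ε / 2 < |z.im| := by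
    by_contra! h
    have := Complex.norm_le_abs_re_add_abs_im z
    linarith [h.1, h.2]
  simp only [mul_neg, Finset.sum_neg_distrib]
  have split : ∀ P Q R S : Prop, ∀ [Decidable P] [Decidable Q] [Decidable R] [Decidable S],
      (P ∨ Q) ∨ (R ∨ S) → (1 : ℝ) ≤ ((if P then 1 else 0) + (if Q then 1 else 0)) +
        ((if R then 1 else 0) + (if S then 1 else 0)) := by
    intro P Q R S _ _ _ _ h
    have := ite_nonneg P; have := ite_nonneg Q; have := ite_nonneg R; have := ite_nonneg S
    rcases h with (h | h) | (h | h) <;> simp only [h, if_true] <;> linarith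
  apply split
  rcases hcase with h | h
  · left
    rcases lt_abs.1 h with h | h
    · right; nlinarith
    · left; nlinarith
  · right
    rcases lt_abs.1 h with h | h
    · right; nlinarith
    · left; nlinarith

theorem exists_large_level {Ω : Type*} [MeasurableSpace Ω] (μ : Measure Ω)
    [IsProbabilityMeasure μ] (g : Ω → ℂ) (hg : Measurable g) (hg1 : ∀ x, ‖g x‖ ≤ 1) (ν : ℕ)
    (hν : 1 ≤ ν) (h : 2 / 4 ^ ν ≤ ∫ x, ‖g x‖ ^ 2 ∂μ) :
    ∃ l ∈ Finset.Icc 1 ν, (4 : ℝ) ^ l / (4 * 4 ^ ν * ν) ≤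
      μ.real {x | (1 / 2 : ℝ) ^ l < ‖g x‖} := by
  have hE : ∀ l : ℕ, MeasurableSet {x | (1 / 2 : ℝ) ^ l < ‖g x‖} := fun l =>
    measurableSet_lt measurable_const hg.norm
  have hpt : ∀ x, ‖g x‖ ^ 2 ≤ (1 / 4) ^ ν + ∑ l ∈ Finset.Icc 1 ν,
      {x | (1 / 2 : ℝ) ^ l < ‖g x‖}.indicator (fun _ => 4 * (1 / 4 : ℝ) ^ l) x := by
    intro x
    have hnn : ∀ l ∈ Finset.Icc 1 ν,
        0 ≤ {x | (1 / 2 : ℝ) ^ l < ‖g x‖}.indicator (fun _ => 4 * (1 / 4 : ℝ) ^ l) x :=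
      fun l _ => Set.indicator_nonneg (fun _ _ => by positivity) _
    have hsq : ∀ l : ℕ, ((1 / 2 : ℝ) ^ l) ^ 2 = (1 / 4) ^ l := fun l => by
      rw [← pow_mul, mul_comm, pow_mul]; norm_num
    by_cases hx : ‖g x‖ ≤ (1 / 2) ^ ν
    · have : ‖g x‖ ^ 2 ≤ (1 / 4) ^ ν := by
        rw [← hsq]; exact pow_le_pow_left₀ (norm_nonneg _) hx 2
      linarith [Finset.sum_nonneg hnn]
    · push Not at hx
      classical
      have hex : ∃ l : ℕ, (1 / 2 : ℝ) ^ l < ‖g x‖ := ⟨ν, hx⟩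
      have hl := Nat.find_spec hex
      set l := Nat.find hex with hldef
      have hlν : l ≤ ν := Nat.find_min' hex hx
      have hl1 : 1 ≤ l := by
        by_contra h0
        have : l = 0 := by omega
        rw [this] at hl
        linarith [hg1 x, pow_zero (1 / 2 : ℝ)]
      have hmem : l ∈ Finset.Icc 1 ν := Finset.mem_Icc.2 ⟨hl1, hlν⟩
      have h1 := Finset.single_le_sum hnn hmem
      rw [Set.indicator_of_mem (show x ∈ {x | (1 / 2 : ℝ) ^ l < ‖g x‖} from hl)] at h1
      have h2 : ‖g x‖ ≤ (1 / 2) ^ (l - 1) := by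
        have := Nat.find_min hex (m := l - 1) (by omega)
        simpa using this
      have h3 : ‖g x‖ ^ 2 ≤ 4 * (1 / 4) ^ l := by
        calc ‖g x‖ ^ 2 ≤ ((1 / 2) ^ (l - 1)) ^ 2 := pow_le_pow_left₀ (norm_nonneg _) h2 2
          _ = (1 / 4) ^ (l - 1) := hsq _
          _ = 4 * (1 / 4) ^ l := by
            obtain ⟨k, hk⟩ : ∃ k, l = k + 1 := ⟨l - 1, by omega⟩
            rw [hk]; simp only [Nat.add_sub_cancel, pow_succ]; ring
      have : (0 : ℝ) ≤ (1 / 4) ^ ν := by positivity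
      linarith
  have hint : ∀ l ∈ Finset.Icc 1 ν, Integrable
      ({x | (1 / 2 : ℝ) ^ l < ‖g x‖}.indicator (fun _ => 4 * (1 / 4 : ℝ) ^ l)) μ :=
    fun l _ => (integrable_const _).indicator (hE l)
  have h1 : ∫ x, ‖g x‖ ^ 2 ∂μ ≤ (1 / 4) ^ ν + ∑ l ∈ Finset.Icc 1 ν,
      μ.real {x | (1 / 2 : ℝ) ^ l < ‖g x‖} * (4 * (1 / 4 : ℝ) ^ l) := by
    refine (integral_mono_of_nonneg (Filter.Eventually.of_forall fun x => by positivity)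
      ((integrable_const _).add (integrable_finsetSum _ hint))
      (Filter.Eventually.of_forall hpt)).trans (le_of_eq ?_)
    simp only [Pi.add_apply]
    rw [integral_add (integrable_const _) (integrable_finsetSum _ hint),
      integral_finsetSum _ hint]
    simp only [integral_const, probReal_univ, one_smul]
    refine congrArg _ (Finset.sum_congr rfl fun l _ => ?_)
    rw [integral_indicator_const _ (hE l), smul_eq_mul]
  by_contra! hcon
  have hν0 : (0 : ℝ) < ν := by exact_mod_cast hν
  have h2 : ∑ l ∈ Finset.Icc 1 ν, μ.real {x | (1 / 2 : ℝ) ^ l < ‖g x‖} * (4 * (1 / 4 : ℝ) ^ l) <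
      ∑ l ∈ Finset.Icc 1 ν, 1 / ((4 : ℝ) ^ ν * ν) := by
    refine Finset.sum_lt_sum_of_nonempty ⟨1, Finset.mem_Icc.2 ⟨le_rfl, hν⟩⟩ fun l hl => ?_
    calc _ < (4 : ℝ) ^ l / (4 * 4 ^ ν * ν) * (4 * (1 / 4 : ℝ) ^ l) :=
          mul_lt_mul_of_pos_right (hcon l hl) (by positivity)
      _ = _ := by rw [one_div_pow]; field_simp
  rw [Finset.sum_const, Nat.card_Icc, nsmul_eq_mul] at h2
  have h3 : ((ν + 1 - 1 : ℕ) : ℝ) * (1 / ((4 : ℝ) ^ ν * ν)) = (1 / 4) ^ ν := by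
    rw [Nat.add_sub_cancel, one_div_pow]; field_simp
  have h4 : (2 : ℝ) / 4 ^ ν = (1 / 4) ^ ν + (1 / 4) ^ ν := by
    rw [one_div_pow]; ring
  linarith

open Classical in
/-- Maurey's empirical approximation, simultaneously for the measure and the sample. -/
theorem exists_empirical_approx {Ω B : Type*} [MeasurableSpace Ω] [Fintype B] (μ : Measure Ω)
    [IsProbabilityMeasure μ] (φ : B → Ω → ℂ) (hφm : ∀ b, Measurable (φ b))
    (hφ : ∀ b x, ‖φ b x‖ ≤ 1) (w : B → ℝ) (hw : ∀ b, 0 ≤ w b) (hw1 : ∑ b, w b = 1)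
    {m : ℕ} (hm : 0 < m) (t : Fin m → Ω) (K : ℕ) (hK : 0 < K) (ε : ℝ) (hε0 : 0 ≤ ε)
    (hε1 : ε ≤ 1) :
    ∃ ω : Fin K → B,
      μ.real {x | ε < ‖∑ b, (w b : ℂ) * φ b x - (∑ i, φ (ω i) x) / K‖} +
      ((Finset.univ.filter fun i => ε < ‖∑ b, (w b : ℂ) * φ b (t i) -
        (∑ j, φ (ω j) (t i)) / K‖).card : ℝ) / m ≤ 8 * exp (-(K * ε ^ 2 / 64)) := by
  set bad : (Fin K → B) → Set Ω := fun ω =>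
    {x | ε < ‖∑ b, (w b : ℂ) * φ b x - (∑ i, φ (ω i) x) / K‖} with hbad
  have hbadm : ∀ ω, MeasurableSet (bad ω) := fun ω =>
    measurableSet_lt measurable_const (((Finset.measurable_sum _ fun b _ =>
      (hφm b).const_mul _).sub ((Finset.measurable_sum _ fun i _ => hφm _).div_const _)).norm)
  have hpt : ∀ x, ∑ ω, (∏ i, w (ω i)) * (bad ω).indicator (fun _ => (1 : ℝ)) x ≤
      4 * exp (-(K * ε ^ 2 / 64)) := fun x =>
    le_of_eq_of_le (Finset.sum_congr rfl fun ω _ => by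
      simp only [Set.indicator, hbad, Set.mem_ofPred_eq])
      (empirical_tail w hw hw1 (fun b => φ b x) (fun b => hφ b x) K hK ε hε0 hε1)
  have hW : ∑ ω : Fin K → B, ∏ i, w (ω i) = 1 := by
    have := Finset.sum_pow' (Finset.univ : Finset B) w K
    rw [hw1, one_pow, Fintype.piFinset_univ] at this
    exact this.symm
  have hWnn : ∀ ω : Fin K → B, 0 ≤ ∏ i, w (ω i) := fun ω => Finset.prod_nonneg fun i _ => hw _
  have hint : ∀ ω, Integrable (fun x => (∏ i, w (ω i)) *
      (bad ω).indicator (fun _ => (1 : ℝ)) x) μ := fun ω =>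
    ((integrable_const _).indicator (hbadm ω)).const_mul _
  have h1 : ∑ ω, (∏ i, w (ω i)) * μ.real (bad ω) ≤ 4 * exp (-(K * ε ^ 2 / 64)) := by
    have := integral_mono (integrable_finsetSum Finset.univ fun ω _ => hint ω)
      (integrable_const (4 * exp (-(K * ε ^ 2 / 64)))) hpt (μ := μ)
    rw [integral_finsetSum _ fun ω _ => hint ω] at this
    simpa [integral_const_mul, integral_indicator_const _ (hbadm _)] using this
  have hm' : (0 : ℝ) < m := by exact_mod_cast hm
  have h2 : ∑ ω, (∏ i, w (ω i)) * (((Finset.univ.filter fun i => t i ∈ bad ω).card : ℝ) / m) ≤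
      4 * exp (-(K * ε ^ 2 / 64)) := by
    have : ∀ ω, ((Finset.univ.filter fun i => t i ∈ bad ω).card : ℝ) =
        ∑ i, (bad ω).indicator (fun _ => (1 : ℝ)) (t i) := fun ω => by
      rw [Finset.card_filter]; push_cast; rfl
    simp_rw [this, ← mul_div_assoc, ← Finset.sum_div, Finset.mul_sum]
    rw [Finset.sum_comm, div_le_iff₀ hm']
    calc _ ≤ ∑ _i : Fin m, 4 * exp (-(K * ε ^ 2 / 64)) := Finset.sum_le_sum fun i _ => hpt (t i)
      _ = _ := by simp [mul_comm]
  by_contra! hcon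
  have h3 : ∑ ω : Fin K → B, (∏ i, w (ω i)) * (8 * exp (-(K * ε ^ 2 / 64))) <
      ∑ ω, (∏ i, w (ω i)) * (μ.real (bad ω) +
        ((Finset.univ.filter fun i => t i ∈ bad ω).card : ℝ) / m) := by
    obtain ⟨ω, -, hω⟩ := Finset.exists_ne_zero_of_sum_ne_zero (by rw [hW]; norm_num)
    exact Finset.sum_lt_sum (fun ω _ => mul_le_mul_of_nonneg_left (hcon ω).le (hWnn ω))
      ⟨ω, Finset.mem_univ _, mul_lt_mul_of_pos_left (hcon ω) ((hWnn ω).lt_of_ne' hω)⟩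
  simp_rw [mul_add] at h3
  rw [Finset.sum_add_distrib, ← Finset.sum_mul, hW] at h3
  linarith

open Classical in
/-- There are few points such that every convex combination of a bounded dictionary that is
not small in `L₂` is not small at one of the points. -/
theorem exists_points_convex {Ω B : Type*} [MeasurableSpace Ω] [Fintype B] (μ : Measure Ω)
    [IsProbabilityMeasure μ] (Z : Set Ω) (hZ : μ Z = 0) (φ : B → Ω → ℂ)
    (hφm : ∀ b, Measurable (φ b)) (hφ : ∀ b x, ‖φ b x‖ ≤ 1) (hB : 3 ≤ Fintype.card B)
    (ν : ℕ) (hν : 1 ≤ ν) (m : ℕ)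
    (hm : 400000 * 4 ^ ν * ν ^ 2 * Real.log (Fintype.card B) ≤ m) :
    ∃ t : Fin m → Ω, (∀ i, t i ∉ Z) ∧ ∀ w : B → ℝ, (∀ b, 0 ≤ w b) → ∑ b, w b = 1 →
      2 / 4 ^ ν ≤ ∫ x, ‖∑ b, (w b : ℂ) * φ b x‖ ^ 2 ∂μ →
      ∃ i, (1 / 2 : ℝ) ^ (ν + 1) ≤ ‖∑ b, (w b : ℂ) * φ b (t i)‖ := by
  set n := Fintype.card B with hn
  have hlog : 1 ≤ Real.log n := by
    rw [Real.le_log_iff_exp_le (by rw [Nat.cast_pos]; omega)]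
    have : (3 : ℝ) ≤ n := by exact_mod_cast hB
    linarith [exp_one_lt_d9]
  have hν' : (1 : ℝ) ≤ ν := by exact_mod_cast hν
  have hm0' : (0 : ℝ) < m := lt_of_lt_of_le (by positivity) hm
  have hm0 : 0 < m := by exact_mod_cast hm0'
  set K : ℕ → ℕ := fun l => 10240 * ν * 4 ^ l with hKdef
  have hKpos : ∀ l, 0 < K l := fun l => by positivity
  set P : ℕ → ℝ := fun l => (4 : ℝ) ^ l / (4 * 4 ^ ν * ν) with hPdef
  have hPpos : ∀ l, 0 < P l := fun l => by positivity
  set h : (Σ l : ℕ, (Fin (K l) → B)) → Ω → ℂ := fun a x => (∑ i, φ (a.2 i) x) / (K a.1 : ℕ)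
    with hhdef
  have hhm : ∀ a, Measurable (h a) := fun a =>
    (Finset.measurable_sum _ fun i _ => hφm _).div_const _
  set E : (Σ l : ℕ, (Fin (K l) → B)) → Set Ω := fun a => {x | 3 / 4 * (1 / 2 : ℝ) ^ a.1 < ‖h a x‖}
  have hE : ∀ a, MeasurableSet (E a) := fun a => measurableSet_lt measurable_const (hhm a).norm
  set s : Finset (Σ l : ℕ, (Fin (K l) → B)) := ((Finset.Icc 1 ν).sigma fun l =>
    (Finset.univ : Finset (Fin (K l) → B))).filter fun a => P a.1 / 2 ≤ μ.real (E a) with hs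
  have hsum : ∑ a ∈ s, exp (-(m * (P a.1 / 2) / 4)) < 1 := by
    calc ∑ a ∈ s, exp (-(m * (P a.1 / 2) / 4))
        ≤ ∑ a ∈ (Finset.Icc 1 ν).sigma fun l => (Finset.univ : Finset (Fin (K l) → B)),
            exp (-(m * (P a.1 / 2) / 4)) :=
          Finset.sum_le_sum_of_subset_of_nonneg (Finset.filter_subset _ _)
            fun _ _ _ => (exp_pos _).le
      _ = ∑ l ∈ Finset.Icc 1 ν, (n : ℝ) ^ K l * exp (-(m * (P l / 2) / 4)) := by
          rw [Finset.sum_sigma]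
          refine Finset.sum_congr rfl fun l _ => ?_
          simp [hn]
      _ ≤ ∑ l ∈ Finset.Icc 1 ν, exp (-ν) := by
          refine Finset.sum_le_sum fun l hl => ?_
          have hn0 : (0 : ℝ) < n := by
            have : (3 : ℝ) ≤ n := by exact_mod_cast hB
            linarith
          rw [show (n : ℝ) ^ K l = exp (K l * Real.log n) by
            rw [exp_nat_mul, Real.exp_log hn0], ← exp_add]
          refine exp_le_exp.2 ?_
          have h4 : (1 : ℝ) ≤ 4 ^ l := one_le_pow₀ (by norm_num)
          have h5 : (4 : ℝ) ^ l * (400000 * 4 ^ ν * ν ^ 2 * Real.log n) / (32 * 4 ^ ν * ν) ≤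
              m * (P l / 2) / 4 := by
            calc _ ≤ (4 : ℝ) ^ l * m / (32 * 4 ^ ν * ν) := by gcongr
              _ = _ := by simp only [hPdef]; field_simp; ring
          have h6 : (4 : ℝ) ^ l * (400000 * 4 ^ ν * ν ^ 2 * Real.log n) / (32 * 4 ^ ν * ν) =
              12500 * (4 ^ l * ν * Real.log n) := by field_simp; ring
          have h7 : (ν : ℝ) ≤ 4 ^ l * ν * Real.log n := by
            calc (ν : ℝ) = 1 * ν * 1 := by ring
              _ ≤ _ := by gcongr
          have h8 : (K l : ℝ) * Real.log n = 10240 * (4 ^ l * ν * Real.log n) := by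
            simp only [hKdef]; push_cast; ring
          rw [h8]
          nlinarith
      _ = ν * exp (-ν) := by simp
      _ < 1 := by
          rw [exp_neg, ← div_eq_mul_inv, div_lt_one (exp_pos _)]
          linarith [add_one_le_exp (ν : ℝ)]
  obtain ⟨t, htZ, ht⟩ := exists_points_hitting μ Z hZ s E (fun a _ => hE a)
    (fun a => P a.1 / 2) (fun a ha => (Finset.mem_filter.1 ha).2) m hsum
  refine ⟨t, htZ, fun w hw hw1 hg2 => ?_⟩
  set g : Ω → ℂ := fun x => ∑ b, (w b : ℂ) * φ b x with hg
  have hgm : Measurable g := Finset.measurable_sum _ fun b _ => (hφm b).const_mul _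
  have hg1 : ∀ x, ‖g x‖ ≤ 1 := fun x => by
    calc ‖g x‖ ≤ ∑ b, ‖(w b : ℂ) * φ b x‖ := norm_sum_le _ _
      _ ≤ ∑ b, w b := Finset.sum_le_sum fun b _ => by
        rw [norm_mul, Complex.norm_real, norm_of_nonneg (hw b)]
        exact mul_le_of_le_one_right (hw b) (hφ b x)
      _ = 1 := hw1
  obtain ⟨l, hl, hPl⟩ := exists_large_level μ g hgm hg1 ν hν hg2
  obtain ⟨hl1, hlν⟩ := Finset.mem_Icc.1 hl
  have hhalf : (1 / 2 : ℝ) ^ l ≤ 1 := pow_le_one₀ (by norm_num) (by norm_num)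
  obtain ⟨ω, hω⟩ := exists_empirical_approx μ φ hφm hφ w hw hw1 hm0 t (K l) (hKpos l)
    (1 / 4 * (1 / 2) ^ l) (by positivity) (by linarith)
  have hexp : 8 * exp (-(K l * (1 / 4 * (1 / 2 : ℝ) ^ l) ^ 2 / 64)) ≤ P l / 16 := by
    have e1 : (K l : ℝ) * (1 / 4 * (1 / 2 : ℝ) ^ l) ^ 2 / 64 = 10 * ν := by
      have : ((1 / 2 : ℝ) ^ l) ^ 2 = 1 / 4 ^ l := by
        rw [← pow_mul, mul_comm, pow_mul, show (1 / 2 : ℝ) ^ 2 = 1 / 4 by norm_num, one_div_pow]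
      rw [mul_pow, this]; simp only [hKdef]; push_cast; field_simp; ring
    rw [e1]
    have e2 : exp (-(10 * ν : ℝ)) ≤ (1 / 1024) ^ ν := by
      have : exp (-10) ≤ 1 / 1024 := by
        rw [exp_neg, one_div]
        refine inv_anti₀ (by norm_num) ?_
        have h2 : (2 : ℝ) ≤ exp 1 := by linarith [add_one_le_exp (1 : ℝ)]
        calc (1024 : ℝ) = 2 ^ 10 := by norm_num
          _ ≤ exp 1 ^ 10 := by gcongr
          _ = exp 10 := by rw [← exp_nat_mul]; norm_num
      calc exp (-(10 * ν : ℝ)) = exp (-10) ^ ν := by rw [← exp_nat_mul]; congr 1; ring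
        _ ≤ _ := pow_le_pow_left₀ (exp_pos _).le this _
    have e3 : (1 / 1024 : ℝ) ^ ν ≤ 1 / 128 * (1 / 8) ^ ν := by
      have : (1 / 1024 : ℝ) ^ ν = (1 / 128) ^ ν * (1 / 8) ^ ν := by
        rw [← mul_pow]; norm_num
      rw [this]
      gcongr
      calc (1 / 128 : ℝ) ^ ν ≤ (1 / 128) ^ 1 :=
            pow_le_pow_of_le_one (by norm_num) (by norm_num) hν
        _ = 1 / 128 := pow_one _
    have e4 : (1 / 8 : ℝ) ^ ν ≤ P l := by
      have h2 : (ν : ℝ) ≤ 2 ^ ν := by exact_mod_cast Nat.lt_two_pow_self.le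
      have h4 : (4 : ℝ) ≤ 4 ^ l := by
        calc (4 : ℝ) = 4 ^ 1 := by norm_num
          _ ≤ 4 ^ l := pow_le_pow_right₀ (by norm_num) hl1
      calc (1 / 8 : ℝ) ^ ν = 4 / (4 * 4 ^ ν * 2 ^ ν) := by
            rw [one_div_pow, show (8 : ℝ) = 4 * 2 by norm_num, mul_pow]; field_simp
        _ ≤ P l := by simp only [hPdef]; gcongr
    linarith
  set a : Σ l : ℕ, (Fin (K l) → B) := ⟨l, ω⟩ with ha
  set bad : Set Ω := {x | 1 / 4 * (1 / 2 : ℝ) ^ l < ‖g x - h a x‖} with hbad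
  have hω' : μ.real bad + ((Finset.univ.filter fun i => t i ∈ bad).card : ℝ) / m ≤ P l / 16 :=
    le_trans hω hexp
  have hμbad : μ.real bad ≤ P l / 16 := by
    have : 0 ≤ ((Finset.univ.filter fun i => t i ∈ bad).card : ℝ) / m := by positivity
    linarith
  have hcbad : ((Finset.univ.filter fun i => t i ∈ bad).card : ℝ) ≤ m * P l / 16 := by
    have h1 : 0 ≤ μ.real bad := measureReal_nonneg
    have : ((Finset.univ.filter fun i => t i ∈ bad).card : ℝ) / m ≤ P l / 16 := by linarith
    rw [div_le_iff₀ hm0'] at this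
    linarith
  have hμE : P l / 2 ≤ μ.real (E a) := by
    have hsub : {x | (1 / 2 : ℝ) ^ l < ‖g x‖} ⊆ E a ∪ bad := by
      intro x hx
      by_contra hcon
      simp only [Set.mem_union, not_or] at hcon
      have c1 : ‖h a x‖ ≤ 3 / 4 * (1 / 2 : ℝ) ^ l := not_lt.1 hcon.1
      have c2 : ‖g x - h a x‖ ≤ 1 / 4 * (1 / 2 : ℝ) ^ l := not_lt.1 hcon.2
      have c3 : (1 / 2 : ℝ) ^ l < ‖g x‖ := hx
      have := norm_le_norm_add_norm_sub' (g x) (h a x)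
      linarith
    have h1 := measureReal_mono (μ := μ) hsub
    have h2 := measureReal_union_le (μ := μ) (E a) bad
    have h3 : P l ≤ _ := hPl
    linarith [hPpos l]
  have has : a ∈ s := by
    rw [hs, Finset.mem_filter]
    exact ⟨Finset.mem_sigma.2 ⟨hl, Finset.mem_univ _⟩, hμE⟩
  have hcE := ht a has
  have hex : ∃ i, t i ∈ E a ∧ t i ∉ bad := by
    by_contra! hcon
    have hsub : (Finset.univ.filter fun i => t i ∈ E a) ⊆ Finset.univ.filter fun i => t i ∈ bad :=
      fun i hi => by
        simp only [Finset.mem_filter, Finset.mem_univ, true_and] at hi ⊢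
        exact hcon i hi
    have : ((Finset.univ.filter fun i => t i ∈ E a).card : ℝ) ≤
        ((Finset.univ.filter fun i => t i ∈ bad).card : ℝ) := by
      exact_mod_cast Finset.card_le_card hsub
    have hp : 0 < m * P l := mul_pos hm0' (hPpos l)
    have hcE' : m * (P l / 2) / 4 < ((Finset.univ.filter fun i => t i ∈ E a).card : ℝ) := hcE
    linarith
  obtain ⟨i, hiE, hib⟩ := hex
  refine ⟨i, ?_⟩
  have c1 : 3 / 4 * (1 / 2 : ℝ) ^ l < ‖h a (t i)‖ := hiE
  have c2 : ‖g (t i) - h a (t i)‖ ≤ 1 / 4 * (1 / 2 : ℝ) ^ l := not_lt.1 hib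
  have c3 := norm_le_norm_add_norm_sub (g (t i)) (h a (t i))
  have c4 : (1 / 2 : ℝ) ^ ν ≤ (1 / 2) ^ l :=
    pow_le_pow_of_le_one (by norm_num) (by norm_num) hlν
  have c5 : ‖h a (t i)‖ ≤ ‖g (t i)‖ + ‖g (t i) - h a (t i)‖ := by
    simpa [add_comm] using c3
  rw [pow_succ]
  change _ ≤ ‖g (t i)‖
  linarith

/-- The four directions `1, -1, i, -i`. -/
def dir4 : Fin 4 → ℂ := ![1, -1, Complex.I, -Complex.I]

/-- Nonnegative coordinates of a complex number along `dir4`. -/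
def coord4 (z : ℂ) : Fin 4 → ℝ := ![max z.re 0, max (-z.re) 0, max z.im 0, max (-z.im) 0]

theorem norm_dir4 (c : Fin 4) : ‖dir4 c‖ = 1 := by
  fin_cases c <;> simp [dir4]

theorem coord4_nonneg (z : ℂ) (c : Fin 4) : 0 ≤ coord4 z c := by
  fin_cases c <;> simp [coord4]

theorem max_sub_max_neg (x : ℝ) : max x 0 - max (-x) 0 = x := by
  rcases le_total 0 x with h | h
  · rw [max_eq_left h, max_eq_right (by linarith)]; ring
  · rw [max_eq_right h, max_eq_left (by linarith)]; ring

theorem max_add_max_neg (x : ℝ) : max x 0 + max (-x) 0 = |x| := by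
  rcases le_total 0 x with h | h
  · rw [max_eq_left h, max_eq_right (by linarith), abs_of_nonneg h]; ring
  · rw [max_eq_right h, max_eq_left (by linarith), abs_of_nonpos h]; ring

theorem sum_coord4_mul_dir4 (z : ℂ) : ∑ c, (coord4 z c : ℂ) * dir4 c = z := by
  have h1 : ((max z.re 0 - max (-z.re) 0 : ℝ) : ℂ) +
      ((max z.im 0 - max (-z.im) 0 : ℝ) : ℂ) * Complex.I = z := by
    rw [max_sub_max_neg, max_sub_max_neg]; exact Complex.re_add_im z
  rw [Fin.sum_univ_four]
  simp only [coord4, dir4, Matrix.cons_val]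
  refine Eq.trans ?_ h1
  push_cast
  ring

theorem sum_coord4 (z : ℂ) : ∑ c, coord4 z c = |z.re| + |z.im| := by
  rw [Fin.sum_univ_four, ← max_add_max_neg, ← max_add_max_neg]
  simp only [coord4, Matrix.cons_val]
  ring

/-- Few points at which every not too spread out element of a finite bounded dictionary is
visible, in terms of the `ℓ₁`-norm of its coefficients. -/
theorem exists_points_l1 {Ω ι : Type*} [MeasurableSpace Ω] (μ : Measure Ω)
    [IsProbabilityMeasure μ] (Z : Set Ω) (hZ : μ Z = 0) (φ : ι → Ω → ℂ)
    (hφm : ∀ k, Measurable (φ k)) (hφ : ∀ k x, ‖φ k x‖ ≤ 1) (Γ : Finset ι) (hΓ : Γ.Nonempty)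
    (ν : ℕ) (hν : 1 ≤ ν) (m : ℕ)
    (hm : 400000 * 4 ^ ν * ν ^ 2 * Real.log (4 * Γ.card) ≤ m) :
    ∃ t : Fin m → Ω, (∀ i, t i ∉ Z) ∧ ∀ a : ι → ℂ,
      8 / 4 ^ ν * (∑ k ∈ Γ, ‖a k‖) ^ 2 ≤ ∫ x, ‖∑ k ∈ Γ, a k * φ k x‖ ^ 2 ∂μ →
      ∃ i, (1 / 2 : ℝ) ^ (ν + 1) * ∑ k ∈ Γ, ‖a k‖ ≤ ‖∑ k ∈ Γ, a k * φ k (t i)‖ := by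
  have hcard : Fintype.card (Γ × Fin 4) = 4 * Γ.card := by simp [mul_comm]
  have hΓ1 : 1 ≤ Γ.card := hΓ.card_pos
  have hm0 : 0 < m := by
    have h1 : 0 < Real.log (4 * Γ.card) := Real.log_pos (by
      have : (1 : ℝ) ≤ Γ.card := by exact_mod_cast hΓ1
      linarith)
    have h2 : (0 : ℝ) < ν := by exact_mod_cast hν
    have h3 : (0 : ℝ) < m := lt_of_lt_of_le (by positivity) hm
    exact_mod_cast h3
  obtain ⟨t, htZ, ht⟩ := exists_points_convex μ Z hZ (fun (b : Γ × Fin 4) x => dir4 b.2 * φ b.1 x)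
    (fun b => (hφm _).const_mul _) (fun b x => by rw [norm_mul, norm_dir4, one_mul]; exact hφ _ _)
    (by omega) ν hν m (by rw [hcard]; push_cast; exact hm)
  refine ⟨t, htZ, fun a ha => ?_⟩
  set A := ∑ k ∈ Γ, ‖a k‖ with hA
  set W := ∑ k ∈ Γ, (|(a k).re| + |(a k).im|) with hW
  have hA0 : 0 ≤ A := Finset.sum_nonneg fun _ _ => norm_nonneg _
  have hAW : A ≤ W := Finset.sum_le_sum fun k _ => Complex.norm_le_abs_re_add_abs_im _
  have hWA : W ≤ 2 * A := by
    rw [hA, Finset.mul_sum]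
    refine Finset.sum_le_sum fun k _ => ?_
    linarith [Complex.abs_re_le_norm (a k), Complex.abs_im_le_norm (a k)]
  rcases hA0.eq_or_lt with h0 | hApos
  · refine ⟨⟨0, hm0⟩, ?_⟩
    rw [← h0, mul_zero]; exact norm_nonneg _
  have hWpos : 0 < W := lt_of_lt_of_le hApos hAW
  have hrep : ∀ x, ∑ b : Γ × Fin 4, ((coord4 (a b.1) b.2 / W : ℝ) : ℂ) * (dir4 b.2 * φ b.1 x) =
      (∑ k ∈ Γ, a k * φ k x) / W := fun x => by
    rw [Fintype.sum_prod_type, Finset.sum_div,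
      ← Finset.sum_coe_sort Γ (fun k => a k * φ k x / W)]
    refine Finset.sum_congr rfl fun k _ => ?_
    calc ∑ c, ((coord4 (a k) c / W : ℝ) : ℂ) * (dir4 c * φ k x)
        = (∑ c, (coord4 (a k) c : ℂ) * dir4 c) * (φ k x / W) := by
          rw [Finset.sum_mul]
          refine Finset.sum_congr rfl fun c _ => ?_
          push_cast; ring
      _ = a k * φ k x / W := by rw [sum_coord4_mul_dir4, mul_div_assoc]
  obtain ⟨i, hi⟩ := ht (fun b => coord4 (a b.1) b.2 / W)
    (fun b => div_nonneg (coord4_nonneg _ _) hWpos.le) (by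
      rw [Fintype.sum_prod_type]
      simp_rw [← Finset.sum_div, sum_coord4]
      rw [Finset.sum_coe_sort Γ fun k => |(a k).re| + |(a k).im|]
      exact div_self hWpos.ne') (by
      simp_rw [hrep, norm_div, Complex.norm_real, norm_of_nonneg hWpos.le, div_pow]
      rw [integral_div, le_div_iff₀ (by positivity)]
      refine le_trans ?_ ha
      have : W ^ 2 ≤ 4 * A ^ 2 := by nlinarith
      calc 2 / 4 ^ ν * W ^ 2 ≤ 2 / 4 ^ ν * (4 * A ^ 2) := by gcongr
        _ = 8 / 4 ^ ν * A ^ 2 := by ring)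
  refine ⟨i, ?_⟩
  rw [hrep, norm_div, Complex.norm_real, norm_of_nonneg hWpos.le, le_div_iff₀ hWpos] at hi
  refine le_trans ?_ hi
  gcongr

/-- Bounded orthonormal systems. -/
structure IsBddONS {Ω ι : Type*} [MeasurableSpace Ω] [DecidableEq ι] (μ : Measure Ω)
    (φ : ι → Ω → ℂ) : Prop where
  meas : ∀ k, Measurable (φ k)
  bdd : ∀ k x, ‖φ k x‖ ≤ 1
  orth : ∀ k l, ∫ x, φ k x * (starRingEnd ℂ) (φ l x) ∂μ = if k = l then 1 else 0

section ONS

variable {Ω ι : Type*} [MeasurableSpace Ω] [DecidableEq ι] {μ : Measure Ω} {φ : ι → Ω → ℂ}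

theorem norm_sum_mul_le (h : IsBddONS μ φ) (S : Finset ι) (c : ι → ℂ) (x : Ω) :
    ‖∑ k ∈ S, c k * φ k x‖ ≤ ∑ k ∈ S, ‖c k‖ :=
  (norm_sum_le _ _).trans (Finset.sum_le_sum fun k _ => by
    rw [norm_mul]; exact mul_le_of_le_one_right (norm_nonneg _) (h.bdd k x))

theorem measurable_sum_mul (h : IsBddONS μ φ) (S : Finset ι) (c : ι → ℂ) :
    Measurable fun x => ∑ k ∈ S, c k * φ k x :=
  Finset.measurable_sum _ fun k _ => (h.meas k).const_mul _

variable [IsProbabilityMeasure μ]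

theorem integrable_of_bdd {E : Type*} [NormedAddCommGroup E] [MeasurableSpace E] [BorelSpace E]
    [SecondCountableTopology E] {g : Ω → E} (hg : Measurable g) {M : ℝ} (hM : ∀ x, ‖g x‖ ≤ M) :
    Integrable g μ :=
  Integrable.of_bound hg.aestronglyMeasurable M (Filter.Eventually.of_forall hM)

theorem integrable_mul_conj (h : IsBddONS μ φ) {g : Ω → ℂ} (hg : Measurable g) {M : ℝ}
    (hM : ∀ x, ‖g x‖ ≤ M) (k : ι) :
    Integrable (fun x => g x * (starRingEnd ℂ) (φ k x)) μ := by
  refine integrable_of_bdd (hg.mul (Complex.continuous_conj.measurable.comp (h.meas k)))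
    (M := M) fun x => ?_
  rw [norm_mul, RCLike.norm_conj]
  exact (mul_le_of_le_one_right (norm_nonneg _) (h.bdd k x)).trans (hM x)

theorem integral_mul_conj_sum (h : IsBddONS μ φ) {g : Ω → ℂ} (hg : Measurable g) {M : ℝ}
    (hM : ∀ x, ‖g x‖ ≤ M) (S : Finset ι) (c : ι → ℂ) :
    ∫ x, g x * (starRingEnd ℂ) (∑ k ∈ S, c k * φ k x) ∂μ =
      ∑ k ∈ S, (starRingEnd ℂ) (c k) * ∫ x, g x * (starRingEnd ℂ) (φ k x) ∂μ := by
  simp_rw [map_sum, map_mul, Finset.mul_sum]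
  rw [integral_finsetSum]
  · refine Finset.sum_congr rfl fun k _ => ?_
    rw [← integral_const_mul]
    congr 1; ext x; ring
  · intro k _
    refine ((integrable_mul_conj h hg hM k).const_mul ((starRingEnd ℂ) (c k))).congr
      (Filter.Eventually.of_forall fun x => ?_)
    simp only; ring

theorem integral_sum_mul_conj (h : IsBddONS μ φ) (S : Finset ι) (c : ι → ℂ) {l : ι}
    (hl : l ∈ S) :
    ∫ x, (∑ k ∈ S, c k * φ k x) * (starRingEnd ℂ) (φ l x) ∂μ = c l := by
  simp_rw [Finset.sum_mul, mul_assoc]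
  rw [integral_finsetSum]
  · simp_rw [integral_const_mul, h.orth]
    simp [hl]
  · exact fun k _ => (integrable_mul_conj h (h.meas k) (h.bdd k) l).const_mul _

theorem parseval_finset (h : IsBddONS μ φ) (S : Finset ι) (c : ι → ℂ) :
    ∫ x, ‖∑ k ∈ S, c k * φ k x‖ ^ 2 ∂μ = ∑ k ∈ S, ‖c k‖ ^ 2 := by
  have h1 := integral_mul_conj_sum h (measurable_sum_mul h S c) (norm_sum_mul_le h S c) S c
  have h2 : ∀ z : ℂ, z * (starRingEnd ℂ) z = ((‖z‖ ^ 2 : ℝ) : ℂ) := fun z => by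
    rw [Complex.mul_conj, Complex.normSq_eq_norm_sq]
  simp_rw [h2, integral_complex_ofReal] at h1
  have h3 : ∑ k ∈ S, (starRingEnd ℂ) (c k) * ∫ x, (∑ k ∈ S, c k * φ k x) *
      (starRingEnd ℂ) (φ k x) ∂μ = ((∑ k ∈ S, ‖c k‖ ^ 2 : ℝ) : ℂ) := by
    rw [Complex.ofReal_sum]
    refine Finset.sum_congr rfl fun k hk => ?_
    rw [integral_sum_mul_conj h S c hk, mul_comm, h2]
  rw [h3] at h1
  exact_mod_cast h1

/-- Bessel's inequality. -/
theorem bessel_finset (h : IsBddONS μ φ) {g : Ω → ℂ} (hg : Measurable g) {M : ℝ}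
    (hM : ∀ x, ‖g x‖ ≤ M) (S : Finset ι) :
    ∑ k ∈ S, ‖∫ x, g x * (starRingEnd ℂ) (φ k x) ∂μ‖ ^ 2 ≤ ∫ x, ‖g x‖ ^ 2 ∂μ := by
  set b : ι → ℂ := fun k => ∫ x, g x * (starRingEnd ℂ) (φ k x) ∂μ with hb
  set P : Ω → ℂ := fun x => ∑ k ∈ S, b k * φ k x with hP
  have hPm : Measurable P := measurable_sum_mul h S b
  have hPb := norm_sum_mul_le h S b
  have h1 : ∫ x, g x * (starRingEnd ℂ) (P x) ∂μ = ((∑ k ∈ S, ‖b k‖ ^ 2 : ℝ) : ℂ) := by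
    rw [hP, integral_mul_conj_sum h hg hM, Complex.ofReal_sum]
    refine Finset.sum_congr rfl fun k _ => ?_
    rw [mul_comm, Complex.mul_conj, Complex.normSq_eq_norm_sq]
  have hgi : Integrable (fun x => ‖g x‖ ^ 2) μ := by
    refine integrable_of_bdd (hg.norm.pow_const 2) (M := M ^ 2) fun x => ?_
    rw [norm_pow, norm_norm]; exact pow_le_pow_left₀ (norm_nonneg _) (hM x) 2
  have hPi : Integrable (fun x => ‖P x‖ ^ 2) μ := by
    refine integrable_of_bdd (hPm.norm.pow_const 2) (M := (∑ k ∈ S, ‖b k‖) ^ 2) fun x => ?_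
    rw [norm_pow, norm_norm]; exact pow_le_pow_left₀ (norm_nonneg _) (hPb x) 2
  have hgPi : Integrable (fun x => g x * (starRingEnd ℂ) (P x)) μ := by
    refine integrable_of_bdd (hg.mul (Complex.continuous_conj.measurable.comp hPm))
      (M := M * ∑ k ∈ S, ‖b k‖) fun x => ?_
    rw [norm_mul, RCLike.norm_conj]
    exact mul_le_mul (hM x) (hPb x) (norm_nonneg _) ((norm_nonneg _).trans (hM x))
  have h2 : ∫ x, (g x * (starRingEnd ℂ) (P x)).re ∂μ = ∑ k ∈ S, ‖b k‖ ^ 2 := by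
    have := integral_re (𝕜 := ℂ) hgPi
    simp only [RCLike.re_eq_complex_re] at this
    rw [this, h1, Complex.ofReal_re]
  have h3 : ∀ x, 2 * (g x * (starRingEnd ℂ) (P x)).re ≤ ‖g x‖ ^ 2 + ‖P x‖ ^ 2 := fun x => by
    have := Complex.normSq_sub (g x) (P x)
    have h0 := Complex.normSq_nonneg (g x - P x)
    rw [Complex.normSq_eq_norm_sq (g x), Complex.normSq_eq_norm_sq (P x)] at this
    linarith
  have hre : Integrable (fun x => (g x * (starRingEnd ℂ) (P x)).re) μ := hgPi.re
  have h4 := integral_mono (hre.const_mul 2) (hgi.add hPi) h3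
  simp only [Pi.add_apply] at h4
  rw [integral_const_mul, h2, integral_add hgi hPi, parseval_finset h] at h4
  linarith

/-- A Nikol'skii type inequality between the Wiener norm and the `L_p`-norm. -/
theorem wiener_rpow_le (h : IsBddONS μ φ) {p : ℝ} (hp1 : 1 ≤ p) (hp2 : p ≤ 2) (S : Finset ι)
    (c : ι → ℂ) :
    (∑ k ∈ S, ‖c k‖) ^ p ≤ S.card * ∫ x, ‖∑ k ∈ S, c k * φ k x‖ ^ p ∂μ := by
  set A := ∑ k ∈ S, ‖c k‖ with hA
  set g : Ω → ℂ := fun x => ∑ k ∈ S, c k * φ k x with hg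
  have hgm : Measurable g := measurable_sum_mul h S c
  have hgb : ∀ x, ‖g x‖ ≤ A := norm_sum_mul_le h S c
  have hA0 : 0 ≤ A := Finset.sum_nonneg fun _ _ => norm_nonneg _
  have hnn : 0 ≤ ∫ x, ‖g x‖ ^ p ∂μ := integral_nonneg fun x => by positivity
  rcases hA0.eq_or_lt with h0 | hpos
  · rw [← h0, zero_rpow (by linarith)]; positivity
  have hint : ∫ x, ‖g x‖ ^ 2 ∂μ ≤ A ^ (2 - p) * ∫ x, ‖g x‖ ^ p ∂μ := by
    rw [← integral_const_mul]
    refine integral_mono_of_nonneg (Filter.Eventually.of_forall fun x => by positivity)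
      (Integrable.const_mul ?_ _) (Filter.Eventually.of_forall fun x => ?_)
    · refine integrable_of_bdd (hgm.norm.pow_const p) (M := A ^ p) fun x => ?_
      rw [norm_of_nonneg (by positivity)]
      exact rpow_le_rpow (norm_nonneg _) (hgb x) (by linarith)
    · simp only
      calc ‖g x‖ ^ 2 = ‖g x‖ ^ (2 - p) * ‖g x‖ ^ p := by
            rw [← rpow_add_of_nonneg (norm_nonneg _) (by linarith) (by linarith)]
            norm_num
        _ ≤ A ^ (2 - p) * ‖g x‖ ^ p := by
            exact mul_le_mul_of_nonneg_right
              (rpow_le_rpow (norm_nonneg _) (hgb x) (by linarith)) (by positivity)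
  have hcs : A ^ 2 ≤ S.card * ∑ k ∈ S, ‖c k‖ ^ 2 := sq_sum_le_card_mul_sum_sq
  rw [← parseval_finset h] at hcs
  have h5 : A ^ 2 = A ^ (2 - p) * A ^ p := by
    rw [← rpow_add hpos]; norm_num
  have hApos : 0 < A ^ (2 - p) := rpow_pos_of_pos hpos _
  refine le_of_mul_le_mul_left ?_ hApos
  calc A ^ (2 - p) * A ^ p ≤ S.card * ∫ x, ‖g x‖ ^ 2 ∂μ := by rw [← h5]; exact hcs
    _ ≤ S.card * (A ^ (2 - p) * ∫ x, ‖g x‖ ^ p ∂μ) := by gcongr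
    _ = _ := by ring

end ONS

/-- Lebesgue measure on the fundamental domain of the torus. -/
def tm (d : ℕ) : Measure (Fin d → ℝ) := volume.restrict (cube d)

theorem tm_eq_pi (d : ℕ) : tm d = Measure.pi fun _ => volume.restrict (Set.Ico (0:ℝ) 1) :=
  Measure.restrict_pi_pi _ _

instance : IsProbabilityMeasure (volume.restrict (Set.Ico (0:ℝ) 1)) := ⟨by simp⟩

instance (d : ℕ) : IsProbabilityMeasure (tm d) := by
  rw [tm_eq_pi]; infer_instance

theorem measurableSet_cube (d : ℕ) : MeasurableSet (cube d) :=
  MeasurableSet.univ_pi fun _ => measurableSet_Ico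

theorem tm_compl_cube (d : ℕ) : tm d (cube d)ᶜ = 0 := by
  rw [tm, Measure.restrict_apply (measurableSet_cube d).compl]; simp

theorem continuous_expk (d : ℕ) (k : Fin d → ℤ) : Continuous (expk d k) := by
  unfold expk; fun_prop

theorem norm_expk (d : ℕ) (k : Fin d → ℤ) (x : Fin d → ℝ) : ‖expk d k x‖ = 1 :=
  Complex.norm_exp_ofReal_mul_I _

theorem conj_expk (d : ℕ) (k : Fin d → ℤ) (x : Fin d → ℝ) :
    (starRingEnd ℂ) (expk d k x) = expk d (-k) x := by
  unfold expk
  rw [← Complex.exp_conj, map_mul, Complex.conj_ofReal, Complex.conj_I]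
  simp

theorem expk_add (d : ℕ) (k l : Fin d → ℤ) (x : Fin d → ℝ) :
    expk d (k + l) x = expk d k x * expk d l x := by
  unfold expk
  rw [← Complex.exp_add, ← add_mul, ← Complex.ofReal_add, ← mul_add, ← Finset.sum_add_distrib]
  simp [add_mul]

/-- The one-dimensional character `x ↦ e^{2π i n x}`. -/
def exp1 (n : ℤ) (x : ℝ) : ℂ := Complex.exp (((2 * Real.pi * (n * x) : ℝ) : ℂ) * Complex.I)

theorem expk_eq_prod (d : ℕ) (k : Fin d → ℤ) (x : Fin d → ℝ) :
    expk d k x = ∏ i, exp1 (k i) (x i) := by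
  unfold expk exp1
  rw [← Complex.exp_sum, ← Finset.sum_mul, ← Complex.ofReal_sum, ← Finset.mul_sum]

theorem continuous_exp1 (n : ℤ) : Continuous (exp1 n) := by
  unfold exp1; fun_prop

theorem norm_exp1 (n : ℤ) (x : ℝ) : ‖exp1 n x‖ = 1 := Complex.norm_exp_ofReal_mul_I _

theorem exp1_zero (x : ℝ) : exp1 0 x = 1 := by simp [exp1]

theorem exp1_mul_conj (n l : ℤ) (x : ℝ) :
    exp1 n x * (starRingEnd ℂ) (exp1 l x) = exp1 (n - l) x := by
  unfold exp1
  rw [← Complex.exp_conj, map_mul, Complex.conj_ofReal, Complex.conj_I, ← Complex.exp_add]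
  congr 1
  push_cast
  ring

theorem integral_exp1 (n : ℤ) : ∫ x in Set.Ico (0:ℝ) 1, exp1 n x = if n = 0 then 1 else 0 := by
  split_ifs with h
  · subst h; simp [exp1_zero]
  have hc : (2 * Real.pi * n * Complex.I : ℂ) ≠ 0 := by
    simp [h, Real.pi_ne_zero, Complex.I_ne_zero]
  have h1 : ∀ x : ℝ, exp1 n x = Complex.exp (2 * Real.pi * n * Complex.I * x) := fun x => by
    unfold exp1; congr 1; push_cast; ring
  rw [integral_Ico_eq_integral_Ioc, ← intervalIntegral.integral_of_le zero_le_one]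
  simp_rw [h1]
  rw [integral_exp_mul_complex hc]
  have : Complex.exp (2 * Real.pi * n * Complex.I * (1:ℝ)) = 1 := by
    rw [Complex.exp_eq_one_iff]; exact ⟨n, by push_cast; ring⟩
  rw [this]; simp

theorem isBddONS_exp1 : IsBddONS (volume.restrict (Set.Ico (0:ℝ) 1)) exp1 where
  meas n := (continuous_exp1 n).measurable
  bdd n x := (norm_exp1 n x).le
  orth n l := by
    simp_rw [exp1_mul_conj, integral_exp1, sub_eq_zero]

theorem integral_expk (d : ℕ) (k : Fin d → ℤ) :
    ∫ x, expk d k x ∂tm d = if k = 0 then 1 else 0 := by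
  simp_rw [expk_eq_prod, tm_eq_pi]
  rw [integral_fintype_prod_eq_prod (fun i => exp1 (k i))]
  simp_rw [integral_exp1]
  split_ifs with h
  · subst h; simp
  · obtain ⟨i, hi⟩ := Function.ne_iff.mp h
    exact Finset.prod_eq_zero (Finset.mem_univ i) (if_neg hi)

theorem isBddONS_expk (d : ℕ) : IsBddONS (tm d) (expk d) where
  meas k := (continuous_expk d k).measurable
  bdd k x := (norm_expk d k x).le
  orth k l := by
    simp_rw [conj_expk, ← expk_add, integral_expk, ← sub_eq_add_neg, sub_eq_zero]

theorem expk_eq_mFourier (d : ℕ) (k : Fin d → ℤ) (x : Fin d → ℝ) :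
    UnitAddTorus.mFourier k (fun i => (x i : UnitAddCircle)) = expk d k x := by
  rw [expk_eq_prod]
  change ∏ i, fourier (k i) (x i : UnitAddCircle) = _
  refine Finset.prod_congr rfl fun i _ => ?_
  rw [fourier_coe_apply]
  unfold exp1; congr 1; push_cast; ring

theorem cube_ae_eq (d : ℕ) :
    ({x : Fin d → ℝ | ∀ i, x i ∈ Set.Ioc ((0 : Fin d → ℝ) i) ((0 : Fin d → ℝ) i + 1)} :
      Set (Fin d → ℝ)) =ᵐ[volume] cube d := by
  have h1 : ({x : Fin d → ℝ | ∀ i, x i ∈ Set.Ioc ((0 : Fin d → ℝ) i) ((0 : Fin d → ℝ) i + 1)} :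
      Set (Fin d → ℝ)) = Set.univ.pi fun i => Set.Ioc ((0 : Fin d → ℝ) i) ((1 : Fin d → ℝ) i) := by
    ext x; simp
  rw [h1]
  exact (Measure.univ_pi_Ioc_ae_eq_Icc (μ := fun _ : Fin d => (volume : Measure ℝ))).trans
    (Measure.univ_pi_Ico_ae_eq_Icc (μ := fun _ : Fin d => (volume : Measure ℝ))
      (f := (0 : Fin d → ℝ)) (g := (1 : Fin d → ℝ))).symm

theorem cube_subset_Icc (d : ℕ) : cube d ⊆ Set.Icc 0 1 := fun _ hx =>
  ⟨fun i => (hx i trivial).1, fun i => (hx i trivial).2.le⟩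

theorem exists_bound_Icc {d : ℕ} {h : (Fin d → ℝ) → ℂ} (hc : Continuous h) :
    ∃ M, ∀ x ∈ Set.Icc (0 : Fin d → ℝ) 1, ‖h x‖ ≤ M :=
  isCompact_Icc.exists_bound_of_continuousOn hc.continuousOn

theorem cube_subset_closure (d : ℕ) : cube d ⊆ closure (interior (cube d)) := by
  rw [cube, interior_pi_set Set.finite_univ, closure_pi_set]
  simp only [interior_Ico, closure_Ioo (zero_ne_one : (0:ℝ) ≠ 1)]
  exact Set.pi_mono fun _ _ => Set.Ico_subset_Icc_self

/-- Uniqueness of Fourier coefficients of continuous functions on the closed cube. -/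
theorem eq_zero_of_fCoeff_eq_zero {d : ℕ} {h : (Fin d → ℝ) → ℂ} (hc : Continuous h)
    (h0 : ∀ k, fCoeff d h k = 0) : ∀ x ∈ cube d, h x = 0 := by
  let _ : MeasureSpace UnitAddCircle := ⟨AddCircle.haarAddCircle⟩
  have : IsProbabilityMeasure (volume : Measure UnitAddCircle) :=
    inferInstanceAs (IsProbabilityMeasure AddCircle.haarAddCircle)
  obtain ⟨M, hM⟩ := exists_bound_Icc hc
  set H : UnitAddTorus (Fin d) → ℂ := fun x =>
    h (UnitAddTorus.measurableEquivPiIoc (0 : Fin d → ℝ) x).1 with hH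
  have hHm : Measurable H :=
    hc.measurable.comp (measurable_subtype_coe.comp (MeasurableEquiv.measurable _))
  have hHb : ∀ x, ‖H x‖ ≤ M := fun x => hM _
    ⟨fun i => ((UnitAddTorus.measurableEquivPiIoc (0 : Fin d → ℝ) x).2 i).1.le,
      fun i => by simpa using ((UnitAddTorus.measurableEquivPiIoc (0 : Fin d → ℝ) x).2 i).2⟩
  have hHx : ∀ x ∈ {x : Fin d → ℝ | ∀ i, x i ∈
      Set.Ioc ((0 : Fin d → ℝ) i) ((0 : Fin d → ℝ) i + 1)},
      H (fun i => (x i : UnitAddCircle)) = h x := fun x hx => by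
    have := (UnitAddTorus.measurableEquivPiIoc (0 : Fin d → ℝ)).apply_symm_apply ⟨x, hx⟩
    rw [UnitAddTorus.coe_symm_measurableEquivPiIoc_apply] at this
    simp only [hH, this]
  have hms : MeasurableSet {x : Fin d → ℝ | ∀ i, x i ∈
      Set.Ioc ((0 : Fin d → ℝ) i) ((0 : Fin d → ℝ) i + 1)} :=
    MeasurableSet.univ_pi' fun _ => measurableSet_Ioc
  have hHL : MemLp H 2 volume := MemLp.of_bound hHm.aestronglyMeasurable M
    (Filter.Eventually.of_forall hHb)
  have hcoef : ∀ k, UnitAddTorus.mFourierCoeff (hHL.toLp H) k = 0 := fun k => by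
    have e1 : UnitAddTorus.mFourierCoeff (hHL.toLp H) k = UnitAddTorus.mFourierCoeff H k :=
      integral_congr_ae (by filter_upwards [hHL.coeFn_toLp] with x hx; rw [hx])
    rw [e1, UnitAddTorus.mFourierCoeff_eq_integral H k 0]
    rw [← h0 k, fCoeff, ← setIntegral_congr_set (cube_ae_eq d)]
    refine setIntegral_congr_fun hms fun x hx => ?_
    rw [hHx x hx, expk_eq_mFourier, smul_eq_mul, mul_comm]
  have hz : hHL.toLp H = 0 := by
    have := UnitAddTorus.hasSum_mFourier_series_L2 (hHL.toLp H)
    simp only [hcoef, zero_smul] at this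
    exact this.unique hasSum_zero
  have hae : H =ᵐ[volume] 0 := by
    have h1 := hHL.coeFn_toLp
    rw [hz] at h1
    exact h1.symm.trans (Lp.coeFn_zero _ _ _)
  have hl : ∫⁻ x, ‖H x‖ₑ = 0 := by
    rw [lintegral_eq_zero_iff hHm.enorm]
    filter_upwards [hae] with x hx
    simp [hx]
  rw [UnitAddTorus.lintegral_preimage _ 0] at hl
  have hl2 : ∫⁻ x in cube d, ‖h x‖ₑ = 0 := by
    rw [← hl, ← setLIntegral_congr (cube_ae_eq d)]
    exact setLIntegral_congr_fun hms fun x hx => by rw [hHx x hx]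
  rw [lintegral_eq_zero_iff hc.measurable.enorm] at hl2
  have h3 : h =ᵐ[volume.restrict (cube d)] 0 := by
    filter_upwards [hl2] with x hx
    simpa using hx
  exact fun x hx => Measure.eqOn_of_ae_eq h3 hc.continuousOn continuousOn_const
    (cube_subset_closure d) hx

theorem integrable_mul_expk {d : ℕ} {h : (Fin d → ℝ) → ℂ} (hc : Continuous h) (k : Fin d → ℤ) :
    Integrable (fun x => h x * expk d k x) (volume.restrict (cube d)) := by
  have : IntegrableOn (fun x => h x * expk d k x) (Set.Icc 0 1) :=
    (hc.mul (continuous_expk d k)).continuousOn.integrableOn_compact isCompact_Icc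
  exact this.mono_set (cube_subset_Icc d)

theorem fCoeff_sub {d : ℕ} {f g : (Fin d → ℝ) → ℂ} (hf : Continuous f) (hg : Continuous g)
    (k : Fin d → ℤ) : fCoeff d (f - g) k = fCoeff d f k - fCoeff d g k := by
  simp only [fCoeff, Pi.sub_apply, sub_mul]
  exact integral_sub (integrable_mul_expk hf _) (integrable_mul_expk hg _)

/-- Pointwise convergence of absolutely convergent Fourier series. -/
theorem hasSum_fCoeff {d : ℕ} {f : (Fin d → ℝ) → ℂ} (hf : Continuous f)
    (hs : Summable fun k => ‖fCoeff d f k‖) {x : Fin d → ℝ} (hx : x ∈ cube d) :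
    HasSum (fun k => fCoeff d f k * expk d k x) (f x) := by
  have hn : ∀ k x, ‖fCoeff d f k * expk d k x‖ = ‖fCoeff d f k‖ := fun k x => by
    rw [norm_mul, norm_expk, mul_one]
  have hsx : ∀ x, Summable fun k => fCoeff d f k * expk d k x := fun x =>
    Summable.of_norm (by simpa only [hn] using hs)
  set S : (Fin d → ℝ) → ℂ := fun x => ∑' k, fCoeff d f k * expk d k x with hS
  have hSc : Continuous S := continuous_tsum (fun k => continuous_const.mul (continuous_expk d k))
    hs fun k x => (hn k x).le
  have hSf : ∀ l, fCoeff d S l = fCoeff d f l := fun l => by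
    have h1 : ∀ x, S x * expk d (-l) x = ∑' k, fCoeff d f k * (expk d k x * expk d (-l) x) :=
      fun x => by rw [hS, ← tsum_mul_right]; simp only [mul_assoc]
    have h2 : HasSum (fun k => ∫ x in cube d, fCoeff d f k * (expk d k x * expk d (-l) x))
        (∫ x in cube d, ∑' k, fCoeff d f k * (expk d k x * expk d (-l) x)) := by
      refine hasSum_integral_of_summable_integral_norm (fun k => ?_) ?_
      · exact (integrable_mul_expk (continuous_expk d k) (-l)).const_mul _
      · have : ∀ k, ∫ x in cube d, ‖fCoeff d f k * (expk d k x * expk d (-l) x)‖ =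
            ‖fCoeff d f k‖ := fun k => by
          simp_rw [norm_mul, norm_expk, mul_one]
          change ∫ x, _ ∂tm d = _
          simp
        simpa only [this] using hs
    have h3 : ∀ k, ∫ x in cube d, fCoeff d f k * (expk d k x * expk d (-l) x) =
        if k = l then fCoeff d f k else 0 := fun k => by
      rw [integral_const_mul]
      have := (isBddONS_expk d).orth k l
      simp_rw [conj_expk] at this
      change _ * ∫ x, _ ∂tm d = _
      rw [this]; split_ifs <;> simp
    simp_rw [h3] at h2
    rw [fCoeff]
    simp_rw [h1]
    rw [h2.unique (hasSum_single l fun k hk => if_neg hk), if_pos rfl]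
  have := eq_zero_of_fCoeff_eq_zero (hf.sub hSc) (fun k => by
    rw [fCoeff_sub hf hSc, hSf, sub_self]) x hx
  rw [Pi.sub_apply, sub_eq_zero] at this
  rw [this]
  exact (hsx x).hasSum

/-- The index of the dyadic block containing the frequency `k`. -/
def bl {d : ℕ} (k : Fin d → ℤ) : Fin d → ℕ := fun i => (k i).natAbs.size

/-- The level `‖j‖₁` of the dyadic block containing `k`. -/
def lev {d : ℕ} (k : Fin d → ℤ) : ℕ := ∑ i, bl k i

/-- The dyadic block `I_j`. -/
def blk (d : ℕ) (j : Fin d → ℕ) : Finset (Fin d → ℤ) := Fintype.piFinset fun i => blockF (j i)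

/-- The frequencies of level `l`. -/
def layer (d l : ℕ) : Finset (Fin d → ℤ) :=
  (Finset.piAntidiag (Finset.univ : Finset (Fin d)) l).biUnion (blk d)

/-- The dyadic hyperbolic cross of level `n`. -/
def cross (d n : ℕ) : Finset (Fin d → ℤ) := (Finset.range (n + 1)).biUnion (layer d)

theorem mem_blockF {n : ℕ} {k : ℤ} : k ∈ blockF n ↔ k.natAbs.size = n := by
  have habs : |k| = (k.natAbs : ℤ) := Int.abs_eq_natAbs k
  rw [blockF, Finset.mem_filter, Finset.mem_Icc, habs]
  constructor
  · rintro ⟨-, ⟨rfl, rfl⟩ | ⟨hn, h1, h2⟩⟩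
    · simp
    · have h1' : 2 ^ (n - 1) ≤ k.natAbs := by exact_mod_cast h1
      have h2' : k.natAbs < 2 ^ n := by exact_mod_cast h2
      have := Nat.lt_size.2 h1'
      have := Nat.size_le.2 h2'
      omega
  · intro h
    have h2 : k.natAbs < 2 ^ n := Nat.size_le.1 h.le
    have h2' : (k.natAbs : ℤ) < 2 ^ n := by exact_mod_cast h2
    refine ⟨by constructor <;> omega, ?_⟩
    rcases Nat.eq_zero_or_pos n with rfl | hn
    · left; refine ⟨rfl, ?_⟩; simpa using h2
    · right
      refine ⟨hn.ne', ?_, h2'⟩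
      have : 2 ^ (n - 1) ≤ k.natAbs := Nat.lt_size.1 (by omega)
      exact_mod_cast this

theorem mem_blk {d : ℕ} {j : Fin d → ℕ} {k : Fin d → ℤ} : k ∈ blk d j ↔ bl k = j := by
  simp [blk, Fintype.mem_piFinset, mem_blockF, funext_iff, bl]

theorem mem_layer {d l : ℕ} {k : Fin d → ℤ} : k ∈ layer d l ↔ lev k = l := by
  simp [layer, mem_blk, lev]

theorem mem_cross {d n : ℕ} {k : Fin d → ℤ} : k ∈ cross d n ↔ lev k ≤ n := by
  simp [cross, mem_layer]

theorem card_blockF_le (n : ℕ) : (blockF n).card ≤ 2 ^ n := by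
  rcases Nat.eq_zero_or_pos n with rfl | hn
  · have : blockF 0 ⊆ {0} := fun k hk => by
      rw [mem_blockF] at hk
      rw [Nat.size_eq_zero, Int.natAbs_eq_zero] at hk
      simpa using hk
    exact (Finset.card_le_card this).trans (by simp)
  · have h1 : blockF n ⊆ Finset.Ioc (-(2 ^ n : ℤ)) (-(2 ^ (n - 1) : ℤ)) ∪
        Finset.Ico (2 ^ (n - 1) : ℤ) (2 ^ n) := fun k hk => by
      rw [blockF, Finset.mem_filter] at hk
      rw [Finset.mem_union, Finset.mem_Ioc, Finset.mem_Ico]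
      rcases hk.2 with h | ⟨-, h, h'⟩
      · omega
      · rcases abs_cases k with ⟨e, _⟩ | ⟨e, _⟩ <;> rw [e] at h h' <;> omega
    refine (Finset.card_le_card h1).trans ((Finset.card_union_le _ _).trans ?_)
    rw [Int.card_Ioc, Int.card_Ico]
    obtain ⟨n, rfl⟩ : ∃ n', n = n' + 1 := ⟨n - 1, by omega⟩
    have h2 : (2 : ℤ) ^ (n + 1) = 2 * 2 ^ n := by ring
    have h3 : (2 : ℕ) ^ (n + 1) = 2 * 2 ^ n := by ring
    have h4 : ((2 ^ n : ℕ) : ℤ) = 2 ^ n := by push_cast; rfl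
    simp only [Nat.add_sub_cancel]
    rw [h2, h3]
    omega

theorem card_blk_le {d : ℕ} (j : Fin d → ℕ) : (blk d j).card ≤ 2 ^ ∑ i, j i := by
  rw [blk, Fintype.card_piFinset, ← Finset.prod_pow_eq_pow_sum]
  exact Finset.prod_le_prod' fun i _ => card_blockF_le _

theorem card_piAntidiag_le (d l : ℕ) (hd : 1 ≤ d) :
    (Finset.piAntidiag (Finset.univ : Finset (Fin d)) l).card ≤ (l + 1) ^ (d - 1) := by
  obtain ⟨d, rfl⟩ : ∃ d', d = d' + 1 := ⟨d - 1, by omega⟩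
  have h1 : ((Fintype.piFinset fun _ : Fin d => Finset.range (l + 1))).card =
      (l + 1) ^ (d + 1 - 1) := by simp
  rw [← h1]
  refine Finset.card_le_card_of_injOn (fun j => Fin.tail j) (fun j hj => ?_) ?_
  · simp only [Finset.mem_coe, Finset.mem_piAntidiag] at hj
    simp only [Finset.mem_coe, Fintype.mem_piFinset, Finset.mem_range]
    intro i
    have : j i.succ ≤ ∑ i, j i :=
      Finset.single_le_sum (f := j) (fun _ _ => Nat.zero_le _) (Finset.mem_univ i.succ)
    rw [hj.1] at this
    exact Nat.lt_succ_of_le this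
  · intro j hj j' hj' h
    simp only [Finset.mem_coe, Finset.mem_piAntidiag] at hj hj'
    have e1 := hj.1.trans hj'.1.symm
    rw [Fin.sum_univ_succ, Fin.sum_univ_succ] at e1
    have h' : ∀ i : Fin d, j i.succ = j' i.succ := fun i => congrFun h i
    simp only [h', Nat.add_right_cancel_iff] at e1
    funext i
    exact Fin.cases e1 h' i

theorem card_layer_le (d l : ℕ) (hd : 1 ≤ d) :
    (layer d l).card ≤ (l + 1) ^ (d - 1) * 2 ^ l := by
  refine Finset.card_biUnion_le.trans ?_
  refine (Finset.sum_le_card_nsmul _ _ (2 ^ l) fun j hj => ?_).trans ?_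
  · rw [Finset.mem_piAntidiag] at hj
    exact (card_blk_le j).trans (by rw [hj.1])
  · rw [smul_eq_mul]
    exact Nat.mul_le_mul_right _ (card_piAntidiag_le d l hd)

theorem card_cross_le (d n : ℕ) (hd : 1 ≤ d) :
    (cross d n).card ≤ (n + 1) ^ (d - 1) * 2 ^ (n + 1) := by
  refine Finset.card_biUnion_le.trans ?_
  calc ∑ l ∈ Finset.range (n + 1), (layer d l).card
      ≤ ∑ l ∈ Finset.range (n + 1), (n + 1) ^ (d - 1) * 2 ^ l := by
        refine Finset.sum_le_sum fun l hl => (card_layer_le d l hd).trans ?_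
        rw [Finset.mem_range] at hl
        exact Nat.mul_le_mul_right _ (Nat.pow_le_pow_left (by omega) _)
    _ = (n + 1) ^ (d - 1) * ∑ l ∈ Finset.range (n + 1), 2 ^ l := by rw [Finset.mul_sum]
    _ ≤ _ := by
        rw [Nat.geomSum_eq le_rfl]
        exact Nat.mul_le_mul_left _ (by simp)

theorem zero_mem_cross (d n : ℕ) : (0 : Fin d → ℤ) ∈ cross d n := by
  rw [mem_cross]; simp [lev, bl]

theorem summable_two_rpow_mul_rpow {β : ℝ} (hβ : 0 < β) (γ : ℝ) :
    Summable fun u : ℕ => (2:ℝ) ^ (-(u:ℝ) * β) * ((u:ℝ) + 1) ^ γ := by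
  obtain ⟨N, hN⟩ := exists_nat_ge γ
  have h2 : (2:ℝ) ^ (-β) < 1 := rpow_lt_one_of_one_lt_of_neg (by norm_num) (by linarith)
  have h0 : 0 < (2:ℝ) ^ (-β) := by positivity
  have h3 := summable_pow_mul_geometric_of_norm_lt_one N (r := (2:ℝ) ^ (-β))
    (by rwa [norm_of_nonneg h0.le])
  have h4 := (summable_nat_add_iff 1).2 h3
  refine Summable.of_nonneg_of_le (fun u => by positivity) (fun u => ?_)
    (h4.mul_left ((2:ℝ) ^ β))
  have e1 : (2:ℝ) ^ (-(u:ℝ) * β) = (2:ℝ) ^ β * ((2:ℝ) ^ (-β)) ^ (u + 1) := by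
    rw [← Real.rpow_natCast, ← Real.rpow_mul (by norm_num), ← Real.rpow_add (by norm_num)]
    congr 1; push_cast; ring
  have e2 : ((u:ℝ) + 1) ^ γ ≤ ((u + 1 : ℕ) : ℝ) ^ N := by
    rw [← Real.rpow_natCast]
    push_cast
    exact rpow_le_rpow_of_exponent_le (by linarith [u.cast_nonneg (α := ℝ)]) hN
  rw [e1]
  calc _ ≤ (2:ℝ) ^ β * ((2:ℝ) ^ (-β)) ^ (u + 1) * ((u + 1 : ℕ) : ℝ) ^ N := by gcongr
    _ = _ := by ring

/-- The constant in the tail estimate `sum_le_tail`. -/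
def tailConst (β γ : ℝ) : ℝ := ∑' u : ℕ, (2:ℝ) ^ (-(u:ℝ) * β) * ((u:ℝ) + 1) ^ γ

theorem tailConst_pos {β : ℝ} (hβ : 0 < β) (γ : ℝ) : 0 < tailConst β γ :=
  (summable_two_rpow_mul_rpow hβ γ).tsum_pos (fun u => by positivity) 0 (by norm_num)

/-- Decay of the layers controls the tail of the series. -/
theorem sum_le_tail {d : ℕ} {β γ D : ℝ} (hβ : 0 < β) (hγ : 0 ≤ γ) (hD : 0 ≤ D)
    {a : (Fin d → ℤ) → ℝ} (ha : ∀ k, 0 ≤ a k)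
    (hl : ∀ l : ℕ, ∑ k ∈ layer d l, a k ≤ D * ((2:ℝ) ^ (-(l:ℝ) * β) * ((l:ℝ) + 1) ^ γ))
    (n : ℕ) (F : Finset (Fin d → ℤ)) (hF : ∀ k ∈ F, n ≤ lev k) :
    ∑ k ∈ F, a k ≤ D * tailConst β γ * ((2:ℝ) ^ (-(n:ℝ) * β) * ((n:ℝ) + 1) ^ γ) := by
  set N := F.sup lev + 1 with hN
  have h1 : F ⊆ (Finset.range N).biUnion fun u => layer d (n + u) := fun k hk => by
    rw [Finset.mem_biUnion]
    have h2 : lev k ≤ F.sup lev := Finset.le_sup (f := lev) hk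
    exact ⟨lev k - n, Finset.mem_range.2 (by omega), mem_layer.2 (by have := hF k hk; omega)⟩
  calc ∑ k ∈ F, a k
      ≤ ∑ k ∈ (Finset.range N).biUnion fun u => layer d (n + u), a k :=
        Finset.sum_le_sum_of_subset_of_nonneg h1 fun k _ _ => ha k
    _ = ∑ u ∈ Finset.range N, ∑ k ∈ layer d (n + u), a k := by
        refine Finset.sum_biUnion fun u _ v _ huv => ?_
        refine Finset.disjoint_left.2 fun k hk hk' => huv ?_
        rw [mem_layer] at hk hk'
        omega
    _ ≤ ∑ u ∈ Finset.range N, D * ((2:ℝ) ^ (-(n:ℝ) * β) * ((n:ℝ) + 1) ^ γ) *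
          ((2:ℝ) ^ (-(u:ℝ) * β) * ((u:ℝ) + 1) ^ γ) := by
        refine Finset.sum_le_sum fun u _ => (hl (n + u)).trans ?_
        have e1 : (2:ℝ) ^ (-((n + u : ℕ):ℝ) * β) = (2:ℝ) ^ (-(n:ℝ) * β) * (2:ℝ) ^ (-(u:ℝ) * β) := by
          rw [← Real.rpow_add (by norm_num)]; congr 1; push_cast; ring
        have e2 : (((n + u : ℕ):ℝ) + 1) ^ γ ≤ ((n:ℝ) + 1) ^ γ * ((u:ℝ) + 1) ^ γ := by
          rw [← mul_rpow (by positivity) (by positivity)]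
          refine rpow_le_rpow (by positivity) ?_ hγ
          push_cast
          nlinarith [n.cast_nonneg (α := ℝ), u.cast_nonneg (α := ℝ),
            mul_nonneg (n.cast_nonneg (α := ℝ)) (u.cast_nonneg (α := ℝ))]
        rw [e1, mul_assoc D]
        refine mul_le_mul_of_nonneg_left ?_ hD
        calc _ ≤ (2:ℝ) ^ (-(n:ℝ) * β) * (2:ℝ) ^ (-(u:ℝ) * β) *
              (((n:ℝ) + 1) ^ γ * ((u:ℝ) + 1) ^ γ) := by gcongr
          _ = _ := by ring
    _ = D * ((2:ℝ) ^ (-(n:ℝ) * β) * ((n:ℝ) + 1) ^ γ) * ∑ u ∈ Finset.range N,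
          ((2:ℝ) ^ (-(u:ℝ) * β) * ((u:ℝ) + 1) ^ γ) := by rw [Finset.mul_sum]
    _ ≤ D * ((2:ℝ) ^ (-(n:ℝ) * β) * ((n:ℝ) + 1) ^ γ) * tailConst β γ := by
        refine mul_le_mul_of_nonneg_left ?_ (by positivity)
        exact (summable_two_rpow_mul_rpow hβ γ).sum_le_tsum _ fun u _ => by positivity
    _ = _ := by ring

theorem summable_of_layer {d : ℕ} {β γ D : ℝ} (hβ : 0 < β) (hγ : 0 ≤ γ) (hD : 0 ≤ D)
    {a : (Fin d → ℤ) → ℝ} (ha : ∀ k, 0 ≤ a k)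
    (hl : ∀ l : ℕ, ∑ k ∈ layer d l, a k ≤ D * ((2:ℝ) ^ (-(l:ℝ) * β) * ((l:ℝ) + 1) ^ γ)) :
    Summable a :=
  summable_of_sum_le ha fun F => sum_le_tail hβ hγ hD ha hl 0 F fun _ _ => Nat.zero_le _

/-- Sup-norm error of the hyperbolic cross partial sums. -/
theorem norm_sub_sum_cross_le {d : ℕ} {f : (Fin d → ℝ) → ℂ} (hf : Continuous f) {T : ℝ} {n : ℕ}
    (hs : Summable fun k => ‖fCoeff d f k‖)
    (hT : ∀ F : Finset (Fin d → ℤ), (∀ k ∈ F, n ≤ lev k) → ∑ k ∈ F, ‖fCoeff d f k‖ ≤ T)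
    {x : Fin d → ℝ} (hx : x ∈ cube d) :
    ‖f x - ∑ k ∈ cross d n, fCoeff d f k * expk d k x‖ ≤ T := by
  have h1 := (hasSum_fCoeff hf hs hx).sub_const (∑ k ∈ cross d n, fCoeff d f k * expk d k x)
  refine le_of_tendsto h1.norm ?_
  filter_upwards [Filter.eventually_ge_atTop (cross d n)] with F hF
  rw [← Finset.sum_sdiff hF, add_sub_cancel_right]
  refine (norm_sum_le _ _).trans ?_
  simp_rw [norm_mul, norm_expk, mul_one]
  refine hT _ fun k hk => ?_
  rw [Finset.mem_sdiff, mem_cross] at hk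
  omega

theorem sum_layer (d l : ℕ) (a : (Fin d → ℤ) → ℝ) :
    ∑ k ∈ layer d l, a k =
      ∑ j ∈ Finset.piAntidiag (Finset.univ : Finset (Fin d)) l, ∑ k ∈ blk d j, a k := by
  refine Finset.sum_biUnion fun j _ j' _ hjj => ?_
  refine Finset.disjoint_left.2 fun k hk hk' => hjj ?_
  rw [mem_blk] at hk hk'
  rw [← hk, hk']

theorem blockProj_eq (d : ℕ) (f : (Fin d → ℝ) → ℂ) (j : Fin d → ℕ) (x : Fin d → ℝ) :
    blockProj d f j x = ∑ k ∈ blk d j, fCoeff d f k * expk d k x := rfl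

theorem LqNorm_blockProj (d : ℕ) (f : (Fin d → ℝ) → ℂ) (j : Fin d → ℕ) {p : ℝ≥0∞} (hp1 : 1 < p)
    (hp2 : p ≤ 2) :
    LqNorm d p (blockProj d f j) =
      ENNReal.ofReal ((∫ x, ‖blockProj d f j x‖ ^ p.toReal ∂tm d) ^ (1 / p.toReal)) := by
  have hm : MemLp (blockProj d f j) p (tm d) :=
    MemLp.of_bound (measurable_sum_mul (isBddONS_expk d) (blk d j) _).aestronglyMeasurable _
      (Filter.Eventually.of_forall (norm_sum_mul_le (isBddONS_expk d) (blk d j) (fCoeff d f)))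
  rw [LqNorm, ← tm, hm.eLpNorm_eq_integral_rpow_norm (by positivity)
    (ne_top_of_le_ne_top (by norm_num) hp2), one_div]

theorem toReal_mem_Icc {p : ℝ≥0∞} (hp1 : 1 ≤ p) (hp2 : p ≤ 2) :
    1 ≤ p.toReal ∧ p.toReal ≤ 2 := by
  have hp : p ≠ ∞ := ne_top_of_le_ne_top (by norm_num) hp2
  constructor
  · have := (ENNReal.toReal_le_toReal (by norm_num) hp).2 hp1
    simpa using this
  · have := (ENNReal.toReal_le_toReal hp (by norm_num)).2 hp2
    simpa using this

/-- The Nikol'skii inequality for a dyadic block. -/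
theorem sum_blk_le (d : ℕ) (f : (Fin d → ℝ) → ℂ) (j : Fin d → ℕ) {p : ℝ≥0∞} (hp1 : 1 < p)
    (hp2 : p ≤ 2) :
    ENNReal.ofReal (∑ k ∈ blk d j, ‖fCoeff d f k‖) ≤
      ENNReal.ofReal ((2:ℝ) ^ (((∑ i, j i : ℕ) : ℝ) * (1 / p.toReal))) *
        LqNorm d p (blockProj d f j) := by
  obtain ⟨h1, h2⟩ := toReal_mem_Icc hp1.le hp2
  rw [LqNorm_blockProj d f j hp1 hp2, ← ENNReal.ofReal_mul (by positivity)]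
  refine ENNReal.ofReal_le_ofReal ?_
  have h3 := wiener_rpow_le (isBddONS_expk d) h1 h2 (blk d j) (fCoeff d f)
  have hI : 0 ≤ ∫ x, ‖blockProj d f j x‖ ^ p.toReal ∂tm d :=
    integral_nonneg fun x => by positivity
  have h4 : (∑ k ∈ blk d j, ‖fCoeff d f k‖) ^ p.toReal ≤
      (2:ℝ) ^ ((∑ i, j i : ℕ) : ℝ) * ∫ x, ‖blockProj d f j x‖ ^ p.toReal ∂tm d := by
    refine h3.trans (mul_le_mul_of_nonneg_right ?_ hI)
    rw [Real.rpow_natCast]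
    exact_mod_cast card_blk_le j
  have h5 := rpow_le_rpow (by positivity) h4 (by positivity : 0 ≤ 1 / p.toReal)
  rw [← Real.rpow_mul (Finset.sum_nonneg fun _ _ => norm_nonneg _), mul_one_div_cancel (by linarith),
    Real.rpow_one, Real.mul_rpow (by positivity) hI, ← Real.rpow_mul (by norm_num)] at h5
  exact h5

/-- Decay of the Wiener norm of the layers for functions in the Besov unit ball. -/
theorem besov_layer {d : ℕ} (hd : 1 ≤ d) {f : (Fin d → ℝ) → ℂ} {p θ : ℝ≥0∞} (hp1 : 1 < p)
    (hp2 : p ≤ 2) (hθ1 : 1 ≤ θ) (hθ2 : θ ≤ 2) {r : ℝ} (hN : besovNorm d r p θ f ≤ 1) (l : ℕ) :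
    ∑ k ∈ layer d l, ‖fCoeff d f k‖ ≤
      1 * ((2:ℝ) ^ (-(l:ℝ) * (r - 1 / p.toReal)) *
        ((l:ℝ) + 1) ^ (((d:ℝ) - 1) * (1 - 1 / θ.toReal))) := by
  obtain ⟨ht1, ht2⟩ := toReal_mem_Icc hθ1 hθ2
  have hθ : θ ≠ ∞ := ne_top_of_le_ne_top (by norm_num) hθ2
  rw [besovNorm, if_neg hθ] at hN
  set t := θ.toReal with ht
  set X : (Fin d → ℕ) → ℝ≥0∞ := fun j =>
    ENNReal.ofReal ((2:ℝ) ^ (((∑ i, j i : ℕ) : ℝ) * r)) * LqNorm d p (blockProj d f j) with hX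
  set J := Finset.piAntidiag (Finset.univ : Finset (Fin d)) l with hJ
  have hN' : ∑' j, X j ^ t ≤ 1 := by
    have h1 := ENNReal.rpow_le_rpow hN (by linarith : 0 ≤ t)
    rwa [← ENNReal.rpow_mul, one_div_mul_cancel (by linarith), ENNReal.rpow_one,
      ENNReal.one_rpow] at h1
  have hJ1 : ∑ j ∈ J, X j ^ t ≤ 1 := (ENNReal.sum_le_tsum J).trans hN'
  have hsum : ∑ j ∈ J, X j ≤ (J.card : ℝ≥0∞) ^ (1 - 1 / t) := by
    have h1 := ENNReal.rpow_sum_le_const_mul_sum_rpow J X ht1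
    have h2 := h1.trans (mul_le_mul_right hJ1 _)
    rw [mul_one] at h2
    have h3 := ENNReal.rpow_le_rpow h2 (by positivity : 0 ≤ 1 / t)
    rw [← ENNReal.rpow_mul, ← ENNReal.rpow_mul, mul_one_div_cancel (by linarith),
      ENNReal.rpow_one] at h3
    refine h3.trans (le_of_eq ?_)
    congr 1; field_simp
  have hcard : (J.card : ℝ≥0∞) ^ (1 - 1 / t) ≤
      ENNReal.ofReal (((l:ℝ) + 1) ^ (((d:ℝ) - 1) * (1 - 1 / t))) := by
    have h0 : 0 ≤ 1 - 1 / t := by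
      rw [sub_nonneg, div_le_one (by linarith)]; exact ht1
    have h1 : (J.card : ℝ) ≤ ((l:ℝ) + 1) ^ ((d:ℝ) - 1) := by
      have : (J.card : ℝ) ≤ (((l + 1) ^ (d - 1) : ℕ) : ℝ) := by
        exact_mod_cast card_piAntidiag_le d l hd
      refine this.trans (le_of_eq ?_)
      rw [← Nat.cast_pred hd, Real.rpow_natCast]; push_cast; rfl
    rw [Real.rpow_mul (by positivity), ← ENNReal.ofReal_rpow_of_nonneg (by positivity) h0,
      ← ENNReal.ofReal_natCast]
    exact ENNReal.rpow_le_rpow (ENNReal.ofReal_le_ofReal h1) h0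
  have hblock : ∀ j ∈ J, ENNReal.ofReal (∑ k ∈ blk d j, ‖fCoeff d f k‖) ≤
      ENNReal.ofReal ((2:ℝ) ^ (-(l:ℝ) * (r - 1 / p.toReal))) * X j := fun j hj => by
    refine (sum_blk_le d f j hp1 hp2).trans (le_of_eq ?_)
    rw [hJ, Finset.mem_piAntidiag] at hj
    rw [hX]
    simp only [hj.1]
    rw [← mul_assoc, ← ENNReal.ofReal_mul (by positivity), ← Real.rpow_add (by norm_num)]
    congr 3; ring
  rw [one_mul, ← ENNReal.ofReal_le_ofReal_iff (by positivity), sum_layer,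
    ENNReal.ofReal_sum_of_nonneg (fun _ _ => Finset.sum_nonneg fun _ _ => norm_nonneg _),
    ENNReal.ofReal_mul (by positivity)]
  calc _ ≤ ∑ j ∈ J, ENNReal.ofReal ((2:ℝ) ^ (-(l:ℝ) * (r - 1 / p.toReal))) * X j :=
        Finset.sum_le_sum hblock
    _ = ENNReal.ofReal ((2:ℝ) ^ (-(l:ℝ) * (r - 1 / p.toReal))) * ∑ j ∈ J, X j := by
        rw [Finset.mul_sum]
    _ ≤ _ := mul_le_mul_right (hsum.trans hcard) _

/-- The truncation kernel of the Marcinkiewicz interpolation argument. -/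
def truncKer (K lam t : ℝ) : ℝ := if t ≤ lam then t ^ 2 / lam ^ 2 else K * t / lam

theorem measurable_truncKer (K : ℝ) : Measurable fun z : ℝ × ℝ => truncKer K z.1 z.2 := by
  unfold truncKer
  exact Measurable.ite (measurableSet_le measurable_snd measurable_fst)
    ((measurable_snd.pow_const 2).div (measurable_fst.pow_const 2))
    ((measurable_snd.const_mul K).div measurable_fst)

theorem truncKer_nonneg {K lam t : ℝ} (hK : 0 ≤ K) (hlam : 0 ≤ lam) (ht : 0 ≤ t) :
    0 ≤ truncKer K lam t := by
  unfold truncKer; split_ifs <;> positivity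

section Paley

variable {Ω ι : Type*} [MeasurableSpace Ω] [DecidableEq ι] {μ : Measure Ω}
  [IsProbabilityMeasure μ] {φ : ι → Ω → ℂ}

/-- Weak type estimate for the weighted coefficients. -/
theorem weak_type (h : IsBddONS μ φ) {u : ι → ℝ} (hu0 : ∀ k, 0 < u k) {K : ℝ}
    (hu : ∀ y, 0 < y → ∀ S : Finset ι, ∑ k ∈ S, (if y < u k then (u k ^ 2)⁻¹ else 0) ≤ K / y)
    (S : Finset ι) (c : ι → ℂ) {lam : ℝ} (hlam : 0 < lam) :
    ∑ k ∈ S, (if lam < u k * ‖c k‖ / 2 then (u k ^ 2)⁻¹ else 0) ≤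
      ∫ x, truncKer K lam ‖∑ k ∈ S, c k * φ k x‖ ∂μ := by
  set F : Ω → ℂ := fun x => ∑ k ∈ S, c k * φ k x with hF
  have hFm : Measurable F := measurable_sum_mul h S c
  set M := ∑ k ∈ S, ‖c k‖ with hM
  have hFb : ∀ x, ‖F x‖ ≤ M := norm_sum_mul_le h S c
  have hM0 : 0 ≤ M := Finset.sum_nonneg fun _ _ => norm_nonneg _
  have hs : MeasurableSet {x | ‖F x‖ ≤ lam} := measurableSet_le hFm.norm measurable_const
  set G : Ω → ℂ := fun x => if ‖F x‖ ≤ lam then F x else 0 with hG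
  set H : Ω → ℂ := fun x => if ‖F x‖ ≤ lam then 0 else F x with hH
  have hGm : Measurable G := Measurable.ite hs hFm measurable_const
  have hHm : Measurable H := Measurable.ite hs measurable_const hFm
  have hGb : ∀ x, ‖G x‖ ≤ M := fun x => by
    simp only [hG]; split_ifs; exacts [hFb x, by simpa using hM0]
  have hHb : ∀ x, ‖H x‖ ≤ M := fun x => by
    simp only [hH]; split_ifs; exacts [by simpa using hM0, hFb x]
  have hGi : Integrable (fun x => ‖G x‖ ^ 2) μ := by
    refine integrable_of_bdd (hGm.norm.pow_const 2) (M := M ^ 2) fun x => ?_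
    rw [norm_pow, norm_norm]; exact pow_le_pow_left₀ (norm_nonneg _) (hGb x) 2
  have hHi : Integrable (fun x => ‖H x‖) μ :=
    integrable_of_bdd hHm.norm (M := M) fun x => by rw [norm_norm]; exact hHb x
  set N := ∫ x, ‖H x‖ ∂μ with hN
  have hN0 : 0 ≤ N := integral_nonneg fun x => norm_nonneg _
  have hint : ∫ x, truncKer K lam ‖F x‖ ∂μ = (∫ x, ‖G x‖ ^ 2 ∂μ) / lam ^ 2 + K * N / lam := by
    have : ∀ x, truncKer K lam ‖F x‖ = ‖G x‖ ^ 2 / lam ^ 2 + K * ‖H x‖ / lam := fun x => by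
      simp only [truncKer, hG, hH]; split_ifs <;> simp
    simp_rw [this]
    rw [integral_add (hGi.div_const _) ((hHi.const_mul K).div_const _), integral_div, integral_div,
      integral_const_mul]
  have hcoef : ∀ k ∈ S, c k = (∫ x, G x * (starRingEnd ℂ) (φ k x) ∂μ) +
      ∫ x, H x * (starRingEnd ℂ) (φ k x) ∂μ := fun k hk => by
    rw [← integral_add (integrable_mul_conj h hGm hGb k) (integrable_mul_conj h hHm hHb k),
      ← integral_sum_mul_conj h S c hk]
    congr 1; ext x
    simp only [hG, hH]; split_ifs <;> simp [hF]
  have hH1 : ∀ k, ‖∫ x, H x * (starRingEnd ℂ) (φ k x) ∂μ‖ ≤ N := fun k => by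
    refine (norm_integral_le_integral_norm _).trans ?_
    refine integral_mono_of_nonneg (Filter.Eventually.of_forall fun x => norm_nonneg _) hHi
      (Filter.Eventually.of_forall fun x => ?_)
    simp only
    rw [norm_mul, RCLike.norm_conj]
    exact mul_le_of_le_one_right (norm_nonneg _) (h.bdd k x)
  have hpt : ∀ k ∈ S, (if lam < u k * ‖c k‖ / 2 then (u k ^ 2)⁻¹ else 0) ≤
      ‖∫ x, G x * (starRingEnd ℂ) (φ k x) ∂μ‖ ^ 2 / lam ^ 2 +
        (if lam < u k * N then (u k ^ 2)⁻¹ else 0) := fun k hk => by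
    set b := ‖∫ x, G x * (starRingEnd ℂ) (φ k x) ∂μ‖ with hb
    have hb0 : 0 ≤ b := norm_nonneg _
    have huk := hu0 k
    have h2 : (0:ℝ) ≤ (if lam < u k * N then (u k ^ 2)⁻¹ else 0) := by
      split_ifs <;> positivity
    by_cases h1 : lam < u k * ‖c k‖ / 2
    · rw [if_pos h1]
      by_cases h3 : lam < u k * N
      · rw [if_pos h3]; exact le_add_of_nonneg_left (by positivity)
      · have h4 : ‖c k‖ ≤ b + N := by
          rw [hcoef k hk]; exact (norm_add_le _ _).trans (add_le_add le_rfl (hH1 k))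
        have h5 : lam ≤ u k * b := by
          have := mul_le_mul_of_nonneg_left h4 huk.le
          rw [not_lt] at h3
          linarith
        refine le_add_of_le_of_nonneg ?_ h2
        rw [inv_eq_one_div, div_le_div_iff₀ (by positivity) (by positivity), one_mul, mul_comm,
          ← mul_pow]
        exact pow_le_pow_left₀ hlam.le h5 2
    · rw [if_neg h1]; positivity
  refine (Finset.sum_le_sum hpt).trans ?_
  rw [Finset.sum_add_distrib, hint, ← Finset.sum_div]
  refine add_le_add (div_le_div_of_nonneg_right (bessel_finset h hGm hGb S) (by positivity)) ?_
  rcases hN0.eq_or_lt with h0 | hpos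
  · rw [← h0]; simp [not_lt.2 hlam.le]
  · have := hu (lam / N) (by positivity) S
    simp_rw [div_lt_iff₀ hpos] at this
    refine this.trans (le_of_eq ?_)
    field_simp

theorem lintegral_Ioo_rpow {p a : ℝ} (hp : 1 < p) (ha : 0 ≤ a) :
    ∫⁻ lam in Set.Ioo 0 a, ENNReal.ofReal (p * lam ^ (p - 1)) = ENNReal.ofReal (a ^ p) := by
  have hint : IntervalIntegrable (fun x : ℝ => p * x ^ (p - 1)) volume 0 a :=
    (intervalIntegral.intervalIntegrable_rpow' (by linarith)).const_mul p
  rw [← ofReal_integral_eq_lintegral_ofReal]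
  · rw [← integral_Ioc_eq_integral_Ioo, ← intervalIntegral.integral_of_le ha,
      intervalIntegral.integral_const_mul, integral_rpow (Or.inl (by linarith)),
      sub_add_cancel, zero_rpow (by linarith), sub_zero, mul_div_cancel₀ _ (by linarith)]
  · exact ((intervalIntegrable_iff_integrableOn_Ioc_of_le ha).1 hint).mono_set
      Set.Ioo_subset_Ioc_self
  · filter_upwards [ae_restrict_mem measurableSet_Ioo] with x hx
    have := hx.1
    simp only [Pi.zero_apply]
    positivity

theorem lintegral_truncKer_le {p K t : ℝ} (hp1 : 1 < p) (hp2 : p < 2) (hK : 0 ≤ K) (ht : 0 ≤ t) :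
    ∫⁻ lam in Set.Ioi 0, ENNReal.ofReal (p * lam ^ (p - 1)) * ENNReal.ofReal (truncKer K lam t) ≤
      ENNReal.ofReal ((p / (2 - p) + K * p / (p - 1)) * t ^ p) := by
  rcases ht.eq_or_lt with rfl | ht0
  · rw [setLIntegral_congr_fun (g := fun _ => 0) measurableSet_Ioi]
    · simp
    · intro x hx
      simp [truncKer, (Set.mem_Ioi.1 hx).le]
  have hsplit : Set.Ioi (0:ℝ) = Set.Ioo 0 t ∪ Set.Ici t := by
    ext x; simp only [Set.mem_Ioi, Set.mem_union, Set.mem_Ioo, Set.mem_Ici]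
    constructor
    · intro hx; rcases lt_or_ge x t with h | h
      exacts [Or.inl ⟨hx, h⟩, Or.inr h]
    · rintro (h | h)
      exacts [h.1, lt_of_lt_of_le ht0 h]
  have h1 : ∫⁻ lam in Set.Ioo 0 t,
      ENNReal.ofReal (p * lam ^ (p - 1)) * ENNReal.ofReal (truncKer K lam t) =
      ENNReal.ofReal (K * p / (p - 1) * t ^ p) := by
    have hint : IntervalIntegrable (fun x : ℝ => K * p * t * x ^ (p - 2)) volume 0 t :=
      (intervalIntegral.intervalIntegrable_rpow' (by linarith)).const_mul _
    rw [setLIntegral_congr_fun (g := fun x => ENNReal.ofReal (K * p * t * x ^ (p - 2)))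
      measurableSet_Ioo, ← ofReal_integral_eq_lintegral_ofReal]
    · rw [← integral_Ioc_eq_integral_Ioo, ← intervalIntegral.integral_of_le ht,
        intervalIntegral.integral_const_mul, integral_rpow (Or.inl (by linarith)),
        zero_rpow (by linarith), sub_zero]
      congr 1
      have : t ^ p = t * t ^ (p - 2 + 1) := by
        rw [mul_comm, ← Real.rpow_add_one ht0.ne']; congr 1; ring
      have hp' : p - 2 + 1 = p - 1 := by ring
      rw [this, hp']; ring
    · exact ((intervalIntegrable_iff_integrableOn_Ioc_of_le ht).1 hint).mono_set
        Set.Ioo_subset_Ioc_self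
    · filter_upwards [ae_restrict_mem measurableSet_Ioo] with x hx
      have := hx.1
      simp only [Pi.zero_apply]
      positivity
    · intro x hx
      have hx0 := hx.1
      simp only
      rw [← ENNReal.ofReal_mul (by positivity), truncKer, if_neg (not_le.2 hx.2)]
      congr 1
      have : x ^ (p - 1) = x * x ^ (p - 2) := by
        rw [mul_comm, ← Real.rpow_add_one hx0.ne']; congr 1; ring
      rw [this]; field_simp
  have h2 : ∫⁻ lam in Set.Ici t,
      ENNReal.ofReal (p * lam ^ (p - 1)) * ENNReal.ofReal (truncKer K lam t) =
      ENNReal.ofReal (p / (2 - p) * t ^ p) := by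
    rw [setLIntegral_congr Ioi_ae_eq_Ici.symm,
      setLIntegral_congr_fun (g := fun x => ENNReal.ofReal (p * t ^ 2 * x ^ (p - 3)))
      measurableSet_Ioi, ← ofReal_integral_eq_lintegral_ofReal]
    · rw [integral_const_mul, integral_Ioi_rpow_of_lt (by linarith) ht0]
      congr 1
      have : t ^ p = t ^ 2 * t ^ (p - 3 + 1) := by
        rw [← Real.rpow_natCast, ← Real.rpow_add ht0]; congr 1; push_cast; ring
      have hp' : p - 3 + 1 = -(2 - p) := by ring
      rw [this, hp', neg_div_neg_eq]; ring
    · exact (integrableOn_Ioi_rpow_of_lt (by linarith) ht0).const_mul _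
    · filter_upwards [ae_restrict_mem measurableSet_Ioi] with x hx
      have : 0 < x := ht0.trans hx
      simp only [Pi.zero_apply]
      positivity
    · intro x hx
      have hx0 : 0 < x := ht0.trans hx
      simp only
      rw [← ENNReal.ofReal_mul (by positivity), truncKer, if_pos (Set.mem_Ioi.1 hx).le]
      congr 1
      have : x ^ (p - 1) = x ^ 2 * x ^ (p - 3) := by
        rw [← Real.rpow_natCast, ← Real.rpow_add hx0]; congr 1; push_cast; ring
      rw [this]; field_simp
  rw [hsplit]
  refine (lintegral_union_le _ _ _).trans ?_
  rw [h1, h2, ← ENNReal.ofReal_add, ← add_mul, add_comm]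
  · have : 0 < p - 1 := by linarith
    positivity
  · have : 0 < 2 - p := by linarith
    positivity

/-- Paley's inequality for bounded orthonormal systems. -/
theorem paley (h : IsBddONS μ φ) {u : ι → ℝ} (hu0 : ∀ k, 0 < u k) {K : ℝ} (hK : 0 ≤ K)
    (hu : ∀ y, 0 < y → ∀ S : Finset ι, ∑ k ∈ S, (if y < u k then (u k ^ 2)⁻¹ else 0) ≤ K / y)
    {p : ℝ} (hp1 : 1 < p) (hp2 : p < 2) (S : Finset ι) (c : ι → ℂ) :
    ∑ k ∈ S, u k ^ (p - 2) * ‖c k‖ ^ p ≤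
      2 ^ p * (p / (2 - p) + K * p / (p - 1)) * ∫ x, ‖∑ k ∈ S, c k * φ k x‖ ^ p ∂μ := by
  set F : Ω → ℂ := fun x => ∑ k ∈ S, c k * φ k x with hF
  have hFm : Measurable F := measurable_sum_mul h S c
  set M := ∑ k ∈ S, ‖c k‖ with hM
  have hFb : ∀ x, ‖F x‖ ≤ M := norm_sum_mul_le h S c
  set C := p / (2 - p) + K * p / (p - 1) with hC
  have hC0 : 0 ≤ C := by
    have h1 : 0 < p - 1 := by linarith
    have h2 : 0 < 2 - p := by linarith
    positivity
  have hFp : Integrable (fun x => ‖F x‖ ^ p) μ := by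
    refine integrable_of_bdd (hFm.norm.pow_const p) (M := M ^ p) fun x => ?_
    rw [norm_of_nonneg (by positivity)]
    exact rpow_le_rpow (norm_nonneg _) (hFb x) (by linarith)
  have hkermeas : Measurable fun z : ℝ × Ω => ENNReal.ofReal (p * z.1 ^ (p - 1)) *
      ENNReal.ofReal (truncKer K z.1 ‖F z.2‖) := by
    refine Measurable.mul (ENNReal.measurable_ofReal.comp ?_) (ENNReal.measurable_ofReal.comp ?_)
    · exact (measurable_fst.pow_const (p - 1)).const_mul p
    · exact (measurable_truncKer K).comp
        (measurable_fst.prodMk (hFm.norm.comp measurable_snd))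
  have key : ∑ k ∈ S, ENNReal.ofReal ((u k ^ 2)⁻¹ * (u k * ‖c k‖ / 2) ^ p) ≤
      ENNReal.ofReal (C * ∫ x, ‖F x‖ ^ p ∂μ) := by
    calc ∑ k ∈ S, ENNReal.ofReal ((u k ^ 2)⁻¹ * (u k * ‖c k‖ / 2) ^ p)
        = ∑ k ∈ S, ∫⁻ lam in Set.Ioi 0, ENNReal.ofReal (p * lam ^ (p - 1)) *
            ENNReal.ofReal (if lam < u k * ‖c k‖ / 2 then (u k ^ 2)⁻¹ else 0) := by
          refine Finset.sum_congr rfl fun k _ => ?_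
          have huk := hu0 k
          rw [ENNReal.ofReal_mul (by positivity), ← lintegral_Ioo_rpow hp1 (by positivity),
            ← lintegral_const_mul' _ _ (by simp), ← lintegral_indicator measurableSet_Ioo,
            ← lintegral_indicator measurableSet_Ioi]
          congr 1; ext lam
          by_cases h1 : 0 < lam
          · by_cases h2 : lam < u k * ‖c k‖ / 2
            · rw [Set.indicator_of_mem (show lam ∈ Set.Ioo _ _ from ⟨h1, h2⟩),
                Set.indicator_of_mem (show lam ∈ Set.Ioi _ from h1), if_pos h2, mul_comm]
            · rw [Set.indicator_of_notMem (fun hh => h2 hh.2),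
                Set.indicator_of_mem (show lam ∈ Set.Ioi _ from h1), if_neg h2]
              simp
          · rw [Set.indicator_of_notMem (fun hh => h1 hh.1),
              Set.indicator_of_notMem (show lam ∉ Set.Ioi _ from h1)]
      _ = ∫⁻ lam in Set.Ioi 0, ENNReal.ofReal (p * lam ^ (p - 1)) *
            ENNReal.ofReal (∑ k ∈ S, if lam < u k * ‖c k‖ / 2 then (u k ^ 2)⁻¹ else 0) := by
          rw [← lintegral_finsetSum']
          · refine lintegral_congr fun lam => ?_
            rw [ENNReal.ofReal_sum_of_nonneg, Finset.mul_sum]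
            intro k _; split_ifs <;> positivity
          · intro k _
            refine Measurable.aemeasurable ?_
            refine Measurable.mul (ENNReal.measurable_ofReal.comp
              ((measurable_id.pow_const (p - 1)).const_mul p)) (ENNReal.measurable_ofReal.comp ?_)
            exact Measurable.ite (measurableSet_lt measurable_id measurable_const)
              measurable_const measurable_const
      _ ≤ ∫⁻ lam in Set.Ioi 0, ∫⁻ x, ENNReal.ofReal (p * lam ^ (p - 1)) *
            ENNReal.ofReal (truncKer K lam ‖F x‖) ∂μ := by
          refine setLIntegral_mono' measurableSet_Ioi fun lam hlam => ?_
          rw [lintegral_const_mul' _ _ (by simp)]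
          gcongr
          rw [← ofReal_integral_eq_lintegral_ofReal]
          · exact ENNReal.ofReal_le_ofReal (weak_type h hu0 hu S c hlam)
          · have hl : (0:ℝ) < lam := hlam
            refine integrable_of_bdd ((measurable_truncKer K).comp
              (measurable_const.prodMk hFm.norm)) (M := M ^ 2 / lam ^ 2 + K * M / lam) fun x => ?_
            have hM0 : 0 ≤ M := (norm_nonneg _).trans (hFb x)
            rw [norm_of_nonneg (truncKer_nonneg hK hl.le (norm_nonneg _))]
            have e1 : ‖F x‖ ^ 2 / lam ^ 2 ≤ M ^ 2 / lam ^ 2 := by gcongr; exact hFb x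
            have e2 : K * ‖F x‖ / lam ≤ K * M / lam := by gcongr; exact hFb x
            have e3 : 0 ≤ M ^ 2 / lam ^ 2 := by positivity
            have e4 : 0 ≤ K * M / lam := by positivity
            unfold truncKer
            split_ifs <;> linarith
          · exact Filter.Eventually.of_forall fun x =>
              truncKer_nonneg hK (le_of_lt hlam) (norm_nonneg _)
      _ = ∫⁻ x, ∫⁻ lam in Set.Ioi 0, ENNReal.ofReal (p * lam ^ (p - 1)) *
            ENNReal.ofReal (truncKer K lam ‖F x‖) ∂volume ∂μ :=
          lintegral_lintegral_swap hkermeas.aemeasurable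
      _ ≤ ∫⁻ x, ENNReal.ofReal (C * ‖F x‖ ^ p) ∂μ :=
          lintegral_mono fun x => lintegral_truncKer_le hp1 hp2 hK (norm_nonneg _)
      _ = ENNReal.ofReal (C * ∫ x, ‖F x‖ ^ p ∂μ) := by
          rw [← integral_const_mul, ofReal_integral_eq_lintegral_ofReal (hFp.const_mul C)]
          exact Filter.Eventually.of_forall fun x => mul_nonneg hC0 (by positivity)
  rw [← ENNReal.ofReal_sum_of_nonneg, ENNReal.ofReal_le_ofReal_iff] at key
  · have e : ∀ k, u k ^ (p - 2) * ‖c k‖ ^ p =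
        2 ^ p * ((u k ^ 2)⁻¹ * (u k * ‖c k‖ / 2) ^ p) := fun k => by
      have huk := hu0 k
      rw [Real.div_rpow (by positivity) (by norm_num), Real.mul_rpow huk.le (norm_nonneg _),
        Real.rpow_sub huk, Real.rpow_two]
      field_simp
    simp_rw [e]
    rw [← Finset.mul_sum, mul_assoc]
    gcongr
  · exact mul_nonneg hC0 (integral_nonneg fun x => by positivity)
  · intro k _
    have huk := hu0 k
    positivity

end Paley

/-- A weighted `ℓ_p`-bound for the coefficients of polynomials in the system `φ` by the `L_p`-norm. -/
def HasCoeffBound {Ω ι : Type*} [MeasurableSpace Ω] (μ : Measure Ω) (φ : ι → Ω → ℂ) (w : ι → ℝ)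
    (p C : ℝ) : Prop :=
  ∀ (S : Finset ι) (c : ι → ℂ),
    ∑ k ∈ S, w k * ‖c k‖ ^ p ≤ C * ∫ x, ‖∑ k ∈ S, c k * φ k x‖ ^ p ∂μ

theorem sum_ite_lt_two_pow_le {y : ℝ} (hy : 0 < y) (N : ℕ) :
    ∑ n ∈ Finset.range N, (if y < (2:ℝ) ^ n then ((2:ℝ) ^ n)⁻¹ else 0) ≤
      2 / y - min (2 * ((2:ℝ) ^ N)⁻¹) (2 / y) := by
  induction N with
  | zero => simp
  | succ N ih =>
    rw [Finset.sum_range_succ]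
    have h2 : (0:ℝ) < 2 ^ N := by positivity
    have h3 : 2 * ((2:ℝ) ^ (N + 1))⁻¹ = ((2:ℝ) ^ N)⁻¹ := by
      rw [pow_succ]; field_simp
    rw [h3]
    have hi : 0 < ((2:ℝ) ^ N)⁻¹ := by positivity
    split_ifs with h
    · have h4 : ((2:ℝ) ^ N)⁻¹ < y⁻¹ := inv_strictAnti₀ hy h
      have h5 : (2:ℝ) / y = 2 * y⁻¹ := div_eq_mul_inv _ _
      rw [min_eq_left (by linarith)] at ih
      have := min_le_left (((2:ℝ) ^ N)⁻¹) (2 / y)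
      linarith
    · have : min (((2:ℝ) ^ N)⁻¹) (2 / y) ≤ min (2 * ((2:ℝ) ^ N)⁻¹) (2 / y) :=
        min_le_min_right _ (by linarith)
      linarith

theorem sum_dyadic_weight_le {y : ℝ} (hy : 0 < y) (S : Finset ℤ) :
    ∑ k ∈ S, (if y < (2:ℝ) ^ k.natAbs.size then (((2:ℝ) ^ k.natAbs.size) ^ 2)⁻¹ else 0) ≤ 2 / y := by
  obtain ⟨N, hN⟩ : ∃ N, ∀ k ∈ S, k.natAbs.size < N :=
    ⟨(S.sup fun k => k.natAbs.size) + 1, fun k hk =>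
      Nat.lt_succ_of_le (Finset.le_sup (f := fun k : ℤ => k.natAbs.size) hk)⟩
  calc ∑ k ∈ S, (if y < (2:ℝ) ^ k.natAbs.size then (((2:ℝ) ^ k.natAbs.size) ^ 2)⁻¹ else 0)
      ≤ ∑ k ∈ (Finset.range N).biUnion blockF,
        (if y < (2:ℝ) ^ k.natAbs.size then (((2:ℝ) ^ k.natAbs.size) ^ 2)⁻¹ else 0) := by
        refine Finset.sum_le_sum_of_subset_of_nonneg (fun k hk => ?_) fun k _ _ => ?_
        · exact Finset.mem_biUnion.2 ⟨_, Finset.mem_range.2 (hN k hk), mem_blockF.2 rfl⟩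
        · split_ifs <;> positivity
    _ = ∑ n ∈ Finset.range N, ∑ k ∈ blockF n,
        (if y < (2:ℝ) ^ k.natAbs.size then (((2:ℝ) ^ k.natAbs.size) ^ 2)⁻¹ else 0) := by
        refine Finset.sum_biUnion fun n _ n' _ hne => Finset.disjoint_left.2 fun k hk hk' => hne ?_
        rw [← mem_blockF.1 hk, mem_blockF.1 hk']
    _ ≤ ∑ n ∈ Finset.range N, (if y < (2:ℝ) ^ n then ((2:ℝ) ^ n)⁻¹ else 0) := by
        refine Finset.sum_le_sum fun n _ => ?_
        rw [Finset.sum_congr rfl fun k hk => by rw [mem_blockF.1 hk], Finset.sum_const, nsmul_eq_mul]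
        split_ifs
        · have : ((blockF n).card : ℝ) ≤ 2 ^ n := by exact_mod_cast card_blockF_le n
          calc ((blockF n).card : ℝ) * (((2:ℝ) ^ n) ^ 2)⁻¹ ≤ 2 ^ n * (((2:ℝ) ^ n) ^ 2)⁻¹ := by gcongr
            _ = _ := by field_simp
        · simp
    _ ≤ 2 / y := (sum_ite_lt_two_pow_le hy N).trans (by
        have : 0 ≤ min (2 * ((2:ℝ) ^ N)⁻¹) (2 / y) := by positivity
        linarith)

/-- The one-dimensional Hardy–Littlewood inequality in dyadic form. -/
theorem hasCoeffBound_exp1 {p : ℝ} (hp1 : 1 < p) (hp2 : p ≤ 2) :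
    ∃ C : ℝ, 0 ≤ C ∧ HasCoeffBound (volume.restrict (Set.Ico (0:ℝ) 1)) exp1
      (fun k => (2:ℝ) ^ ((p - 2) * (k.natAbs.size : ℝ))) p C := by
  rcases hp2.lt_or_eq with hp2 | rfl
  · have h2p : 0 < 2 - p := by linarith
    have hp0 : 0 < p - 1 := by linarith
    refine ⟨2 ^ p * (p / (2 - p) + 2 * p / (p - 1)), by positivity, fun S c => ?_⟩
    have := paley isBddONS_exp1 (u := fun k => (2:ℝ) ^ k.natAbs.size) (K := 2)
      (fun k => by positivity) (by norm_num) (fun y hy S => sum_dyadic_weight_le hy S) hp1 hp2 S c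
    refine le_trans (le_of_eq (Finset.sum_congr rfl fun k _ => ?_)) this
    simp only [← Real.rpow_natCast 2, ← Real.rpow_mul (zero_le_two (α := ℝ)), mul_comm (p - 2)]
  · refine ⟨1, by norm_num, fun S c => ?_⟩
    simp only [sub_self, zero_mul, Real.rpow_zero, one_mul, Real.rpow_two]
    rw [parseval_finset isBddONS_exp1]

theorem sum_eq_sum_cons {d : ℕ} {E : Type*} [AddCommMonoid E] (S : Finset (Fin (d + 1) → ℤ))
    (F : (Fin (d + 1) → ℤ) → E) (hF : ∀ k, k ∉ S → F k = 0) :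
    ∑ k ∈ S, F k = ∑ a ∈ S.image (fun k => k 0), ∑ b ∈ S.image Fin.tail, F (Fin.cons a b) := by
  rw [← Finset.sum_product']
  refine (Finset.sum_subset (s₁ := S.image fun k => (k 0, Fin.tail k)) ?_ ?_).symm.trans ?_ |>.symm
  · intro x hx
    obtain ⟨k, hk, rfl⟩ := Finset.mem_image.1 hx
    exact Finset.mem_product.2 ⟨Finset.mem_image_of_mem (fun k : Fin (d + 1) → ℤ => k 0) hk,
      Finset.mem_image_of_mem Fin.tail hk⟩
  · intro x _ hx
    refine hF _ fun hS => hx (Finset.mem_image.2 ⟨_, hS, by simp⟩)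
  · rw [Finset.sum_image]
    · simp [Fin.cons_self_tail]
    · intro k _ l _ hkl
      simp only [Prod.mk.injEq] at hkl
      rw [← Fin.cons_self_tail k, ← Fin.cons_self_tail l, hkl.1, hkl.2]

theorem expk_cons (d : ℕ) (a : ℤ) (b : Fin d → ℤ) (x : ℝ) (y : Fin d → ℝ) :
    expk (d + 1) (Fin.cons a b) (Fin.cons x y) = exp1 a x * expk d b y := by
  simp [expk_eq_prod, Fin.prod_univ_succ]

theorem integral_tm_succ (d : ℕ) {g : (Fin (d + 1) → ℝ) → ℝ} (hg : Measurable g) {M : ℝ}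
    (hM : ∀ x, ‖g x‖ ≤ M) :
    ∫ z, g z ∂tm (d + 1) =
      ∫ y, ∫ x, g (Fin.cons x y) ∂volume.restrict (Set.Ico (0:ℝ) 1) ∂tm d := by
  have hmp := measurePreserving_piFinSuccAbove (n := d) (α := fun _ => ℝ)
    (fun _ => volume.restrict (Set.Ico (0:ℝ) 1)) 0
  have hc : Measurable fun z : ℝ × (Fin d → ℝ) => g (Fin.cons z.1 z.2) :=
    hg.comp (measurable_pi_iff.2 fun i => by
      refine Fin.cases ?_ (fun i => ?_) i
      · simpa using measurable_fst
      · simpa [Function.comp_def] using (measurable_pi_apply i).comp (measurable_snd (α := ℝ)))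
  have h1 := hmp.integral_comp (MeasurableEquiv.measurableEmbedding _)
    (fun z : ℝ × (Fin d → ℝ) => g (Fin.cons z.1 z.2))
  rw [← tm_eq_pi, ← tm_eq_pi] at h1
  rw [← integral_prod_symm (fun z : ℝ × (Fin d → ℝ) => g (Fin.cons z.1 z.2))
    (integrable_of_bdd hc (fun z => hM _)), ← h1]
  refine integral_congr_ae (Filter.Eventually.of_forall fun z => ?_)
  simp only [MeasurableEquiv.piFinSuccAbove_apply, Fin.insertNthEquiv_zero, Fin.consEquiv_symm_apply]
  rw [Fin.cons_self_tail]

theorem HasCoeffBound.expk_succ {d : ℕ} {w : ℤ → ℝ} {W : (Fin d → ℤ) → ℝ} {p C₁ C : ℝ}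
    (hp : 0 < p) (hw : ∀ a, 0 ≤ w a) (hC : 0 ≤ C)
    (h₁ : HasCoeffBound (volume.restrict (Set.Ico (0:ℝ) 1)) exp1 w p C₁)
    (h : HasCoeffBound (tm d) (expk d) W p C) :
    HasCoeffBound (tm (d + 1)) (expk (d + 1)) (fun k => w (k 0) * W (Fin.tail k)) p (C * C₁) := by
  intro S c
  set c' : (Fin (d + 1) → ℤ) → ℂ := fun k => if k ∈ S then c k else 0 with hc'
  set A := S.image fun k => k 0
  set B := S.image Fin.tail
  set G : ℤ → (Fin d → ℝ) → ℂ := fun a y => ∑ b ∈ B, c' (Fin.cons a b) * expk d b y with hG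
  have hGm : ∀ a, Measurable (G a) := fun a => measurable_sum_mul (isBddONS_expk d) _ _
  have hGb : ∀ a y, ‖G a y‖ ≤ ∑ b ∈ B, ‖c' (Fin.cons a b)‖ := fun a y =>
    norm_sum_mul_le (isBddONS_expk d) _ (fun b => c' (Fin.cons a b)) y
  have hGi : ∀ a, Integrable (fun y => ‖G a y‖ ^ p) (tm d) := fun a =>
    integrable_of_bdd ((hGm a).norm.pow_const p) fun y => by
      rw [norm_of_nonneg (by positivity)]
      exact rpow_le_rpow (norm_nonneg _) (hGb a y) hp.le
  have hsum : ∀ x y, ∑ k ∈ S, c k * expk (d + 1) k (Fin.cons x y) = ∑ a ∈ A, G a y * exp1 a x := by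
    intro x y
    rw [Finset.sum_congr rfl (g := fun k => c' k * expk (d + 1) k (Fin.cons x y))
      fun k hk => by simp [hc', hk], sum_eq_sum_cons S _ fun k hk => by simp [hc', hk]]
    refine Finset.sum_congr rfl fun a _ => ?_
    rw [hG, Finset.sum_mul]
    refine Finset.sum_congr rfl fun b _ => ?_
    rw [expk_cons]; ring
  have hFm := measurable_sum_mul (isBddONS_expk (d + 1)) S c
  have hFb := norm_sum_mul_le (isBddONS_expk (d + 1)) S c
  have hM : ∀ z, ‖‖∑ k ∈ S, c k * expk (d + 1) k z‖ ^ p‖ ≤ (∑ k ∈ S, ‖c k‖) ^ p := fun z => by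
    rw [norm_of_nonneg (by positivity)]
    exact rpow_le_rpow (norm_nonneg _) (hFb z) hp.le
  rw [integral_tm_succ d (hFm.norm.pow_const p) hM]
  simp_rw [hsum]
  have hint : Integrable (fun y => ∫ x, ‖∑ a ∈ A, G a y * exp1 a x‖ ^ p
      ∂volume.restrict (Set.Ico (0:ℝ) 1)) (tm d) := by
    refine integrable_of_bdd (M := (∑ k ∈ S, ‖c k‖) ^ p) ?_ fun y => ?_
    · refine (StronglyMeasurable.integral_prod_right (f := fun y x => ‖∑ a ∈ A, G a y * exp1 a x‖ ^ p)
        (Measurable.stronglyMeasurable ?_)).measurable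
      refine (Finset.measurable_sum _ fun a _ => ?_).norm.pow_const p
      exact ((hGm a).comp measurable_fst).mul ((continuous_exp1 a).measurable.comp measurable_snd)
    · refine (norm_integral_le_of_norm_le_const (Filter.Eventually.of_forall fun x => ?_)).trans_eq
        (by simp; rfl)
      rw [← hsum]; exact hM _
  calc ∑ k ∈ S, w (k 0) * W (Fin.tail k) * ‖c k‖ ^ p
      = ∑ k ∈ S, w (k 0) * W (Fin.tail k) * ‖c' k‖ ^ p :=
        Finset.sum_congr rfl fun k hk => by simp [hc', hk]
    _ = ∑ a ∈ A, ∑ b ∈ B, w a * W b * ‖c' (Fin.cons a b)‖ ^ p := by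
        rw [sum_eq_sum_cons S _ fun k hk => by simp [hc', hk, hp.ne']]
        simp
        rfl
    _ = ∑ a ∈ A, w a * ∑ b ∈ B, W b * ‖c' (Fin.cons a b)‖ ^ p := by
        simp_rw [Finset.mul_sum, mul_assoc]
    _ ≤ ∑ a ∈ A, w a * (C * ∫ y, ‖G a y‖ ^ p ∂tm d) :=
        Finset.sum_le_sum fun a _ =>
          mul_le_mul_of_nonneg_left (h B fun b => c' (Fin.cons a b)) (hw a)
    _ = C * ∫ y, ∑ a ∈ A, w a * ‖G a y‖ ^ p ∂tm d := by
        rw [integral_finsetSum _ fun a _ => (hGi a).const_mul _, Finset.mul_sum]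
        refine Finset.sum_congr rfl fun a _ => ?_
        rw [integral_const_mul]; ring
    _ ≤ C * ∫ y, C₁ * ∫ x, ‖∑ a ∈ A, G a y * exp1 a x‖ ^ p
          ∂volume.restrict (Set.Ico (0:ℝ) 1) ∂tm d := by
        refine mul_le_mul_of_nonneg_left (integral_mono
          (integrable_finsetSum _ fun a _ => (hGi a).const_mul _) (hint.const_mul _)
          fun y => ?_) hC
        exact h₁ A fun a => G a y
    _ = _ := by rw [integral_const_mul]; ring

/-- The Hardy–Littlewood inequality for multivariate trigonometric polynomials. -/
theorem hasCoeffBound_expk (d : ℕ) {p : ℝ} (hp1 : 1 < p) (hp2 : p ≤ 2) :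
    ∃ C : ℝ, 0 ≤ C ∧ HasCoeffBound (tm d) (expk d)
      (fun k => (2:ℝ) ^ ((p - 2) * (lev k : ℝ))) p C := by
  induction d with
  | zero =>
    refine ⟨1, by norm_num, fun S c => ?_⟩
    have h0 : ∀ (k : Fin 0 → ℤ) (x : Fin 0 → ℝ), expk 0 k x = 1 := by simp [expk]
    have h1 : ∀ k : Fin 0 → ℤ, lev k = 0 := by simp [lev]
    simp only [h0, h1, Nat.cast_zero, mul_zero, Real.rpow_zero, one_mul, mul_one, integral_const,
      probReal_univ, smul_eq_mul]
    rcases S.eq_empty_or_nonempty with rfl | ⟨k, hk⟩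
    · simp only [Finset.sum_empty, norm_zero]; positivity
    · have : S = {k} := by
        ext l; simp [Subsingleton.elim l k, hk]
      simp [this]
  | succ d ih =>
    obtain ⟨C, hC, h⟩ := ih
    obtain ⟨C₁, hC₁, h₁⟩ := hasCoeffBound_exp1 hp1 hp2
    refine ⟨C * C₁, by positivity, ?_⟩
    convert h₁.expk_succ (by linarith) (fun a => by positivity) hC h using 2 with k
    rw [← Real.rpow_add (by norm_num), ← mul_add, lev, Fin.sum_univ_succ]
    simp [lev, bl, Fin.tail]

theorem integral_rpow_norm_le {Ω : Type*} [MeasurableSpace Ω] {μ : Measure Ω}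
    [IsProbabilityMeasure μ] {F : Ω → ℂ} (hF : Measurable F) {M : ℝ} (hM : ∀ x, ‖F x‖ ≤ M) {p : ℝ}
    (hp0 : 0 < p) (hp2 : p ≤ 2) :
    ∫ x, ‖F x‖ ^ p ∂μ ≤ (∫ x, ‖F x‖ ^ 2 ∂μ) ^ (p / 2) := by
  have h2 : ∀ x, (‖F x‖ ^ 2) ^ (p / 2) = ‖F x‖ ^ p := fun x => by
    rw [← Real.rpow_two, ← Real.rpow_mul (norm_nonneg _)]; congr 1; ring
  have hb : ∀ s : ℝ, 0 < s → ∀ x, ‖‖F x‖ ^ s‖ ≤ M ^ s := fun s hs x => by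
    rw [norm_of_nonneg (by positivity)]
    exact rpow_le_rpow (norm_nonneg _) (hM x) hs.le
  have hi : Integrable (fun x => ‖F x‖ ^ 2) μ := by
    simp_rw [← Real.rpow_two]
    exact integrable_of_bdd (hF.norm.pow_const _) (hb 2 (by norm_num))
  have hi2 : Integrable (fun x => ‖F x‖ ^ p) μ :=
    integrable_of_bdd (hF.norm.pow_const _) (hb p hp0)
  have := (Real.concaveOn_rpow (p := p / 2) (by linarith) (by linarith)).le_map_integral (μ := μ)
    (f := fun x => ‖F x‖ ^ 2)
    (fun x _ => (Real.continuousAt_rpow_const x _ (Or.inr (by linarith))).continuousWithinAt)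
    isClosed_Ici (Filter.Eventually.of_forall fun x => by simp) hi
    (by simpa only [Function.comp_def, h2] using hi2)
  simpa only [h2] using this

theorem isBddONS_comp {Ω ι κ : Type*} [MeasurableSpace Ω] [DecidableEq ι] [DecidableEq κ]
    {μ : Measure Ω} {φ : ι → Ω → ℂ} (h : IsBddONS μ φ) {e : κ → ι} (he : Function.Injective e) :
    IsBddONS μ fun k => φ (e k) where
  meas k := h.meas _
  bdd k := h.bdd _
  orth k l := by rw [h.orth]; simp only [he.eq_iff]

/-- The weighted `ℓ_p`-norm of the coefficients in a layer is controlled by the square function. -/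
theorem sum_layer_rpow_le {d l : ℕ} {p C : ℝ} (hp0 : 0 < p) (hp2 : p ≤ 2) (hC : 0 ≤ C)
    (h : HasCoeffBound (tm d) (expk d) (fun k => (2:ℝ) ^ ((p - 2) * (lev k : ℝ))) p C)
    (f : (Fin d → ℝ) → ℂ) :
    (2:ℝ) ^ ((p - 2) * (l:ℝ)) * ∑ k ∈ layer d l, ‖fCoeff d f k‖ ^ p ≤
      C * ∫ x, (∑ j ∈ Finset.piAntidiag (Finset.univ : Finset (Fin d)) l,
        ‖blockProj d f j x‖ ^ 2) ^ (p / 2) ∂tm d := by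
  set J := Finset.piAntidiag (Finset.univ : Finset (Fin d)) l with hJ
  set ψ : (Fin d → ℕ) → (Fin d → ℝ) → ℂ := fun j => expk d fun i => (j i : ℤ) with hψ
  have hψo : IsBddONS (tm d) ψ := isBddONS_comp (isBddONS_expk d)
    (e := fun (j : Fin d → ℕ) i => (j i : ℤ)) fun j j' hjj => by
      funext i; have := congrFun hjj i; beta_reduce at this; exact_mod_cast this
  have hbm : ∀ j, Measurable (blockProj d f j) := fun j =>
    measurable_sum_mul (isBddONS_expk d) (blk d j) _
  have hbb : ∀ j x, ‖blockProj d f j x‖ ≤ ∑ k ∈ blk d j, ‖fCoeff d f k‖ := fun j x =>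
    norm_sum_mul_le (isBddONS_expk d) (blk d j) (fCoeff d f) x
  set H : (Fin d → ℝ) → (Fin d → ℝ) → ℂ := fun y x => ∑ j ∈ J, blockProj d f j x * ψ j y with hH
  have hHm : Measurable (Function.uncurry H) := Finset.measurable_sum _ fun j _ =>
    ((hbm j).comp measurable_snd).mul ((hψo.meas j).comp measurable_fst)
  set M := ∑ j ∈ J, ∑ k ∈ blk d j, ‖fCoeff d f k‖ with hM
  have hHb : ∀ y x, ‖H y x‖ ≤ M := fun y x =>
    (norm_sum_mul_le hψo J (fun j => blockProj d f j x) y).trans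
      (Finset.sum_le_sum fun j _ => hbb j x)
  have hHrep : ∀ y x, H y x =
      ∑ k ∈ layer d l, (fCoeff d f k * ψ (bl k) y) * expk d k x := fun y x => by
    rw [layer, Finset.sum_biUnion]
    · refine Finset.sum_congr rfl fun j _ => ?_
      rw [blockProj_eq, Finset.sum_mul]
      refine Finset.sum_congr rfl fun k hk => ?_
      rw [mem_blk.1 hk]; ring
    · refine fun j _ j' _ hjj => Finset.disjoint_left.2 fun k hk hk' => hjj ?_
      rw [← mem_blk.1 hk, ← mem_blk.1 hk']
  have hrb : ∀ y x, ‖‖H y x‖ ^ p‖ ≤ M ^ p := fun y x => by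
    rw [norm_of_nonneg (by positivity)]
    exact rpow_le_rpow (norm_nonneg _) (hHb y x) hp0.le
  have hpt : ∀ y, (2:ℝ) ^ ((p - 2) * (l:ℝ)) * ∑ k ∈ layer d l, ‖fCoeff d f k‖ ^ p ≤
      C * ∫ x, ‖H y x‖ ^ p ∂tm d := fun y => by
    simp_rw [hHrep]
    refine le_trans (le_of_eq ?_) (h (layer d l) fun k => fCoeff d f k * ψ (bl k) y)
    rw [Finset.mul_sum]
    refine Finset.sum_congr rfl fun k hk => ?_
    beta_reduce
    rw [mem_layer.1 hk, norm_mul, norm_expk, mul_one]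
  have hprodi : Integrable (Function.uncurry fun y x => ‖H y x‖ ^ p) ((tm d).prod (tm d)) :=
    integrable_of_bdd (hHm.norm.pow_const p) fun z => hrb z.1 z.2
  have hgm : Measurable fun x => ∑ j ∈ J, ‖blockProj d f j x‖ ^ 2 :=
    Finset.measurable_sum _ fun j _ => (hbm j).norm.pow_const 2
  have hgi : Integrable (fun x => (∑ j ∈ J, ‖blockProj d f j x‖ ^ 2) ^ (p / 2)) (tm d) := by
    refine integrable_of_bdd (M := (∑ j ∈ J, (∑ k ∈ blk d j, ‖fCoeff d f k‖) ^ 2) ^ (p / 2))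
      (hgm.pow_const _) fun x => ?_
    rw [norm_of_nonneg (by positivity)]
    exact rpow_le_rpow (by positivity)
      (Finset.sum_le_sum fun j _ => pow_le_pow_left₀ (norm_nonneg _) (hbb j x) 2)
      (by positivity)
  calc (2:ℝ) ^ ((p - 2) * (l:ℝ)) * ∑ k ∈ layer d l, ‖fCoeff d f k‖ ^ p
      = ∫ _, (2:ℝ) ^ ((p - 2) * (l:ℝ)) * ∑ k ∈ layer d l, ‖fCoeff d f k‖ ^ p ∂tm d := by simp
    _ ≤ ∫ y, C * ∫ x, ‖H y x‖ ^ p ∂tm d ∂tm d :=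
        integral_mono (integrable_const _) (hprodi.integral_prod_left.const_mul _) hpt
    _ = C * ∫ x, ∫ y, ‖H y x‖ ^ p ∂tm d ∂tm d := by
        rw [integral_const_mul, integral_integral_swap hprodi]
    _ ≤ _ := by
        refine mul_le_mul_of_nonneg_left (integral_mono hprodi.integral_prod_right ?_ fun x => ?_) hC
        · exact hgi
        · refine (integral_rpow_norm_le (F := fun y => H y x)
            (measurable_sum_mul hψo J fun j => blockProj d f j x) (fun y => hHb y x) hp0 hp2).trans_eq ?_
          rw [hH, parseval_finset hψo J fun j => blockProj d f j x]

/-- Decay of the Wiener norm of the layers for functions in the Sobolev unit ball. -/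
theorem sobolev_layer {d : ℕ} (hd : 1 ≤ d) {p : ℝ≥0∞} (hp1 : 1 < p) (hp2 : p ≤ 2) {r : ℝ}
    (hr : 0 < r) :
    ∃ D : ℝ, 0 ≤ D ∧ ∀ f : (Fin d → ℝ) → ℂ, sobolevNorm d r p f ≤ 1 → ∀ l : ℕ,
      ∑ k ∈ layer d l, ‖fCoeff d f k‖ ≤ D * ((2:ℝ) ^ (-(l:ℝ) * (r - 1 / p.toReal)) *
        ((l:ℝ) + 1) ^ (((d:ℝ) - 1) * (1 - 1 / p.toReal))) := by
  obtain ⟨-, ht2⟩ := toReal_mem_Icc hp1.le hp2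
  have hpt : p ≠ ∞ := ne_top_of_le_ne_top (by norm_num) hp2
  have ht1 : 1 < p.toReal := by
    rw [← ENNReal.toReal_one]; exact (ENNReal.toReal_lt_toReal (by simp) hpt).2 hp1
  set t := p.toReal with ht
  have ht0 : 0 < t := by linarith
  obtain ⟨C, hC, h⟩ := hasCoeffBound_expk d ht1 ht2
  refine ⟨C ^ (1 / t), by positivity, fun f hN l => ?_⟩
  set J := Finset.piAntidiag (Finset.univ : Finset (Fin d)) l with hJ
  set g : (Fin d → ℝ) → ℝ := fun x => ∑ j ∈ J, ‖blockProj d f j x‖ ^ 2 with hg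
  have hg0 : ∀ x, 0 ≤ g x := fun x => by positivity
  have hbm : ∀ j, Measurable (blockProj d f j) := fun j =>
    measurable_sum_mul (isBddONS_expk d) (blk d j) _
  have hbb : ∀ j x, ‖blockProj d f j x‖ ≤ ∑ k ∈ blk d j, ‖fCoeff d f k‖ := fun j x =>
    norm_sum_mul_le (isBddONS_expk d) (blk d j) (fCoeff d f) x
  have hgm : Measurable g := Finset.measurable_sum _ fun j _ => (hbm j).norm.pow_const 2
  rw [sobolevNorm, if_neg hr.ne', ← ht] at hN
  have hI : ∫ x, g x ^ (t / 2) ∂tm d ≤ (2:ℝ) ^ (-((l:ℝ) * r * t)) := by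
    have h1 := ENNReal.rpow_le_rpow hN ht0.le
    rw [← ENNReal.rpow_mul, one_div_mul_cancel ht0.ne', ENNReal.rpow_one, ENNReal.one_rpow] at h1
    have h2 : ∀ x, ENNReal.ofReal ((2:ℝ) ^ ((l:ℝ) * r * t) * g x ^ (t / 2)) ≤
        ((∑' j : Fin d → ℕ, (ENNReal.ofReal ((2:ℝ) ^ (((∑ i, j i : ℕ) : ℝ) * r)) *
          (‖blockProj d f j x‖₊ : ℝ≥0∞)) ^ (2:ℕ)) ^ ((1:ℝ)/2)) ^ t := fun x => by
      rw [← ENNReal.rpow_mul]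
      refine le_trans (le_of_eq ?_) (ENNReal.rpow_le_rpow (ENNReal.sum_le_tsum J) (by positivity))
      have h3 : ∑ j ∈ J, (ENNReal.ofReal ((2:ℝ) ^ (((∑ i, j i : ℕ) : ℝ) * r)) *
          (‖blockProj d f j x‖₊ : ℝ≥0∞)) ^ (2:ℕ) =
          ENNReal.ofReal (((2:ℝ) ^ ((l:ℝ) * r)) ^ 2 * g x) := by
        rw [hg, Finset.mul_sum, ENNReal.ofReal_sum_of_nonneg fun j _ => by positivity]
        refine Finset.sum_congr rfl fun j hj => ?_
        rw [hJ, Finset.mem_piAntidiag] at hj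
        rw [hj.1, ← enorm_eq_nnnorm, ← ofReal_norm, ← ENNReal.ofReal_mul (by positivity),
          ← ENNReal.ofReal_pow (by positivity), mul_pow]
      rw [h3, ENNReal.ofReal_rpow_of_nonneg (by have := hg0 x; positivity) (by positivity)]
      congr 1
      rw [Real.mul_rpow (by positivity) (hg0 x), ← Real.rpow_two, ← Real.rpow_mul (by positivity),
        ← Real.rpow_mul (by norm_num)]
      congr 2 <;> ring
    have hgi : Integrable (fun x => (2:ℝ) ^ ((l:ℝ) * r * t) * g x ^ (t / 2)) (tm d) := by
      refine (integrable_of_bdd (M := (∑ j ∈ J, (∑ k ∈ blk d j, ‖fCoeff d f k‖) ^ 2) ^ (t / 2))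
        (hgm.pow_const _) fun x => ?_).const_mul _
      rw [norm_of_nonneg (by have := hg0 x; positivity)]
      exact rpow_le_rpow (hg0 x)
        (Finset.sum_le_sum fun j _ => pow_le_pow_left₀ (norm_nonneg _) (hbb j x) 2) (by positivity)
    have h4 : ENNReal.ofReal (∫ x, (2:ℝ) ^ ((l:ℝ) * r * t) * g x ^ (t / 2) ∂tm d) ≤ 1 := by
      rw [ofReal_integral_eq_lintegral_ofReal hgi (Filter.Eventually.of_forall fun x => by
        have := hg0 x; positivity)]
      exact (lintegral_mono h2).trans h1
    rw [← ENNReal.ofReal_one, ENNReal.ofReal_le_ofReal_iff (by norm_num), integral_const_mul] at h4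
    rw [Real.rpow_neg (by norm_num), ← one_div, le_div_iff₀' (by positivity)]
    exact h4
  have h1 := (sum_layer_rpow_le ht0 ht2 hC h f (l := l)).trans (mul_le_mul_of_nonneg_left hI hC)
  have h2 : ∑ k ∈ layer d l, ‖fCoeff d f k‖ ^ t ≤
      C * (2:ℝ) ^ ((2 - t) * l - (l:ℝ) * r * t) := by
    rw [← le_div_iff₀' (by positivity)] at h1
    refine h1.trans (le_of_eq ?_)
    rw [mul_div_assoc, ← Real.rpow_sub (by norm_num)]
    congr 2; ring
  have hd1 : 0 ≤ (d:ℝ) - 1 := by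
    have : (1:ℝ) ≤ d := by exact_mod_cast hd
    linarith
  have hcard : ((layer d l).card : ℝ) ≤ ((l:ℝ) + 1) ^ ((d:ℝ) - 1) * 2 ^ (l:ℝ) := by
    have : ((layer d l).card : ℝ) ≤ (((l + 1) ^ (d - 1) * 2 ^ l : ℕ) : ℝ) := by
      exact_mod_cast card_layer_le d l hd
    refine this.trans (le_of_eq ?_)
    rw [← Nat.cast_pred hd, Real.rpow_natCast, Real.rpow_natCast]; push_cast; rfl
  have h3 := Real.rpow_sum_le_const_mul_sum_rpow_of_nonneg (s := layer d l)
    (f := fun k => ‖fCoeff d f k‖) ht1.le fun _ _ => norm_nonneg _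
  have h4 : (∑ k ∈ layer d l, ‖fCoeff d f k‖) ^ t ≤
      (((l:ℝ) + 1) ^ ((d:ℝ) - 1) * 2 ^ (l:ℝ)) ^ (t - 1) *
        (C * (2:ℝ) ^ ((2 - t) * l - (l:ℝ) * r * t)) := by
    refine h3.trans (mul_le_mul (rpow_le_rpow (by positivity) hcard (by linarith)) h2
      (Finset.sum_nonneg fun _ _ => by positivity) (by positivity))
  have h5 := rpow_le_rpow (Real.rpow_nonneg (Finset.sum_nonneg fun _ _ => norm_nonneg _) _) h4
    (by positivity : 0 ≤ 1 / t)
  rw [← Real.rpow_mul (Finset.sum_nonneg fun _ _ => norm_nonneg _), mul_one_div_cancel ht0.ne',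
    Real.rpow_one] at h5
  refine h5.trans (le_of_eq ?_)
  rw [Real.mul_rpow (by positivity) (by positivity), Real.mul_rpow (by positivity) (by positivity),
    Real.mul_rpow (by positivity) (by positivity), Real.mul_rpow (by positivity) (by positivity),
    ← Real.rpow_mul (by positivity), ← Real.rpow_mul (by positivity),
    ← Real.rpow_mul (by positivity), ← Real.rpow_mul (by positivity),
    ← Real.rpow_mul (by positivity)]
  have e1 : ((d:ℝ) - 1) * (t - 1) * (1 / t) = ((d:ℝ) - 1) * (1 - 1 / t) := by field_simp
  have e2 : -(l:ℝ) * (r - 1 / t) =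
      (l:ℝ) * (t - 1) * (1 / t) + ((2 - t) * l - (l:ℝ) * r * t) * (1 / t) := by
    field_simp; ring
  rw [e2, Real.rpow_add (by norm_num), ← e1]
  simp only [mul_assoc]
  ring

/-- The layers of the Fourier coefficients of `f` decay with main rate `β` and logarithmic
exponent `γ`. -/
def LayerDecay (d : ℕ) (β γ D : ℝ) (f : (Fin d → ℝ) → ℂ) : Prop :=
  ∀ l : ℕ, ∑ k ∈ layer d l, ‖fCoeff d f k‖ ≤ D * ((2:ℝ) ^ (-(l:ℝ) * β) * ((l:ℝ) + 1) ^ γ)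

/-- The tail bound for the coefficients of functions with decaying layers. -/
def tailBound (β γ D : ℝ) (n : ℕ) : ℝ :=
  D * tailConst β γ * ((2:ℝ) ^ (-(n:ℝ) * β) * ((n:ℝ) + 1) ^ γ)

theorem tailBound_nonneg {β γ D : ℝ} (hβ : 0 < β) (hD : 0 ≤ D) (n : ℕ) :
    0 ≤ tailBound β γ D n := by
  have := tailConst_pos hβ γ
  unfold tailBound; positivity

/-- If the `ℓ_2`-norm of the coefficients is small compared to their `ℓ_1`-norm, then the
`ℓ_1`-norm is controlled by the tail outside of a small hyperbolic cross. -/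
theorem sum_norm_le_of_sq_le {d n₀ ν : ℕ} (Γ : Finset (Fin d → ℤ)) (c : (Fin d → ℤ) → ℂ) {T : ℝ}
    (hcard : (cross d n₀).card * 32 ≤ 4 ^ ν)
    (hT : ∀ F : Finset (Fin d → ℤ), (∀ k ∈ F, n₀ ≤ lev k) → ∑ k ∈ F, ‖c k‖ ≤ T)
    (hsq : ∑ k ∈ Γ, ‖c k‖ ^ 2 ≤ 8 / 4 ^ ν * (∑ k ∈ Γ, ‖c k‖) ^ 2) :
    ∑ k ∈ Γ, ‖c k‖ ≤ 2 * T := by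
  set A := ∑ k ∈ Γ, ‖c k‖ with hA
  have hA0 : 0 ≤ A := Finset.sum_nonneg fun _ _ => norm_nonneg _
  set Γ₀ := Γ.filter fun k => lev k ≤ n₀ with hΓ₀
  set A₀ := ∑ k ∈ Γ₀, ‖c k‖ with hA₀
  have hsub : Γ₀ ⊆ cross d n₀ := fun k hk => mem_cross.2 (Finset.mem_filter.1 hk).2
  have hsplit : A₀ + ∑ k ∈ Γ.filter (fun k => ¬ lev k ≤ n₀), ‖c k‖ = A :=
    Finset.sum_filter_add_sum_filter_not _ _ _
  have htail := hT (Γ.filter fun k => ¬ lev k ≤ n₀) fun k hk => by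
    have := (Finset.mem_filter.1 hk).2; omega
  have h1 : A₀ ^ 2 ≤ (Γ₀.card : ℝ) * ∑ k ∈ Γ₀, ‖c k‖ ^ 2 := sq_sum_le_card_mul_sum_sq
  have h2 : ∑ k ∈ Γ₀, ‖c k‖ ^ 2 ≤ ∑ k ∈ Γ, ‖c k‖ ^ 2 :=
    Finset.sum_le_sum_of_subset_of_nonneg (Finset.filter_subset _ _) fun _ _ _ => by positivity
  have h3 : (Γ₀.card : ℝ) * 32 ≤ 4 ^ ν := by
    have : Γ₀.card * 32 ≤ 4 ^ ν := (Nat.mul_le_mul_right _ (Finset.card_le_card hsub)).trans hcard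
    exact_mod_cast this
  have h4 : A₀ ^ 2 ≤ (A / 2) ^ 2 := by
    calc A₀ ^ 2 ≤ (Γ₀.card : ℝ) * (8 / 4 ^ ν * A ^ 2) :=
          h1.trans (mul_le_mul_of_nonneg_left (h2.trans hsq) (by positivity))
      _ = ((Γ₀.card : ℝ) * 32) * (A ^ 2 / (4 * 4 ^ ν)) := by field_simp; ring
      _ ≤ 4 ^ ν * (A ^ 2 / (4 * 4 ^ ν)) := by gcongr
      _ = (A / 2) ^ 2 := by field_simp; norm_num
  have h5 : A₀ ≤ A / 2 := le_of_sq_le_sq h4 (by positivity)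
  linarith

/-- Points for which the samples determine functions with decaying layers up to a small error. -/
theorem exists_sampling_points {d : ℕ} {β γ D : ℝ} (hβ : 0 < β) (hγ : 0 ≤ γ)
    (hD : 0 ≤ D) {m ν n₀ n₁ : ℕ} (hν : 1 ≤ ν)
    (hcard : (cross d n₀).card * 32 ≤ 4 ^ ν)
    (hm : 400000 * 4 ^ ν * ν ^ 2 * Real.log (4 * (cross d n₁).card) ≤ m)
    (hT : 4 * 4 ^ ν * tailBound β γ D n₁ ≤ tailBound β γ D n₀) :
    ∃ t : Fin m → Fin d → ℝ, (∀ i, t i ∈ cube d) ∧ ∀ f f' : (Fin d → ℝ) → ℂ,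
      Continuous f → Continuous f' → LayerDecay d β γ D f → LayerDecay d β γ D f' →
      (∀ i, f (t i) = f' (t i)) →
      (∀ x ∈ cube d, ‖(f - f') x‖ ≤ 17 * tailBound β γ D n₀) ∧
      ∫ x in cube d, ‖(f - f') x‖ ^ 2 ≤ (17 * tailBound β γ D n₀) ^ 2 / 4 ^ ν := by
  have hons := isBddONS_expk d
  obtain ⟨t, ht, hpts⟩ := exists_points_l1 (tm d) (cube d)ᶜ (tm_compl_cube d) (expk d) hons.meas
    hons.bdd (cross d n₁) ⟨0, zero_mem_cross d n₁⟩ ν hν m hm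
  have htc : ∀ i, t i ∈ cube d := fun i => Set.notMem_compl_iff.1 (ht i)
  refine ⟨t, htc, fun f f' hf hf' hlf hlf' hsamp => ?_⟩
  set T₀ := tailBound β γ D n₀ with hT₀
  set T₁ := tailBound β γ D n₁ with hT₁
  have hT₀0 : 0 ≤ T₀ := tailBound_nonneg hβ hD n₀
  have hT₁0 : 0 ≤ T₁ := tailBound_nonneg hβ hD n₁
  set g := f - f' with hg
  set c : (Fin d → ℤ) → ℂ := fun k => fCoeff d f k - fCoeff d f' k with hc
  set Γ := cross d n₁ with hΓ
  set A := ∑ k ∈ Γ, ‖c k‖ with hA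
  have hA0 : 0 ≤ A := Finset.sum_nonneg fun _ _ => norm_nonneg _
  set P : (Fin d → ℝ) → ℂ := fun x => ∑ k ∈ Γ, c k * expk d k x with hP
  have hPA : ∀ x, ‖P x‖ ≤ A := norm_sum_mul_le hons Γ c
  have hsum : ∀ (h : (Fin d → ℝ) → ℂ), LayerDecay d β γ D h → ∀ n (F : Finset (Fin d → ℤ)),
      (∀ k ∈ F, n ≤ lev k) → ∑ k ∈ F, ‖fCoeff d h k‖ ≤ tailBound β γ D n := fun h hh n F hF =>
    sum_le_tail hβ hγ hD (fun _ => norm_nonneg _) hh n F hF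
  have happ : ∀ x ∈ cube d, ‖g x - P x‖ ≤ 2 * T₁ := fun x hx => by
    have h1 := norm_sub_sum_cross_le hf (summable_of_layer hβ hγ hD (fun _ => norm_nonneg _) hlf)
      (hsum f hlf n₁) hx
    have h2 := norm_sub_sum_cross_le hf' (summable_of_layer hβ hγ hD (fun _ => norm_nonneg _) hlf')
      (hsum f' hlf' n₁) hx
    have h3 : g x - P x = (f x - ∑ k ∈ Γ, fCoeff d f k * expk d k x) -
        (f' x - ∑ k ∈ Γ, fCoeff d f' k * expk d k x) := by
      simp only [hg, hP, hc, Pi.sub_apply, sub_mul, Finset.sum_sub_distrib]; ring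
    rw [h3]
    exact (norm_sub_le _ _).trans (by linarith)
  have hctail : ∀ F : Finset (Fin d → ℤ), (∀ k ∈ F, n₀ ≤ lev k) → ∑ k ∈ F, ‖c k‖ ≤ 2 * T₀ :=
    fun F hF => by
      refine (Finset.sum_le_sum fun k _ => norm_sub_le _ _).trans ?_
      rw [Finset.sum_add_distrib]
      linarith [hsum f hlf n₀ F hF, hsum f' hlf' n₀ F hF]
  have hpars : ∫ x, ‖P x‖ ^ 2 ∂tm d = ∑ k ∈ Γ, ‖c k‖ ^ 2 := parseval_finset hons Γ c
  have h4 : (1:ℝ) ≤ 4 ^ ν := one_le_pow₀ (by norm_num)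
  have h24 : (4:ℝ) ^ ν = 2 ^ ν * 2 ^ ν := by rw [← mul_pow]; norm_num
  have h2ν : (1:ℝ) ≤ 2 ^ ν := one_le_pow₀ (by norm_num)
  have hT₁T₀ : T₁ ≤ T₀ / (4 * 4 ^ ν) := by rw [le_div_iff₀ (by positivity)]; linarith
  have key : A ≤ 4 * T₀ ∧ ∑ k ∈ Γ, ‖c k‖ ^ 2 ≤ 128 * T₀ ^ 2 / 4 ^ ν := by
    by_cases hcase : 8 / 4 ^ ν * A ^ 2 ≤ ∑ k ∈ Γ, ‖c k‖ ^ 2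
    · obtain ⟨i, hi⟩ := hpts c (by rw [← hpars] at hcase; exact hcase)
      have h5 : ‖P (t i)‖ ≤ 2 * T₁ := by
        have := happ (t i) (htc i)
        rwa [hg, Pi.sub_apply, hsamp i, sub_self, zero_sub, norm_neg] at this
      have h6 : A ≤ T₀ / 2 ^ ν := by
        have h7 : (1 / 2 : ℝ) ^ (ν + 1) * A ≤ 2 * (T₀ / (4 * 4 ^ ν)) :=
          hi.trans (h5.trans (by linarith))
        rw [one_div, inv_pow, inv_mul_le_iff₀ (by positivity)] at h7
        refine h7.trans (le_of_eq ?_)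
        rw [h24, pow_succ]; field_simp; ring
      have h8 : T₀ / 2 ^ ν ≤ T₀ := div_le_self hT₀0 h2ν
      refine ⟨by linarith, ?_⟩
      calc ∑ k ∈ Γ, ‖c k‖ ^ 2 ≤ A ^ 2 := by
            rw [sq A, hA, Finset.sum_mul]
            refine Finset.sum_le_sum fun k hk => ?_
            rw [sq]
            exact mul_le_mul_of_nonneg_left
              (Finset.single_le_sum (f := fun k => ‖c k‖) (fun _ _ => norm_nonneg _) hk)
              (norm_nonneg _)
        _ ≤ (T₀ / 2 ^ ν) ^ 2 := by gcongr
        _ = T₀ ^ 2 / 4 ^ ν := by rw [h24, div_pow, sq (2 ^ ν : ℝ)]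
        _ ≤ _ := by gcongr; nlinarith [sq_nonneg T₀]
    · have h5 := sum_norm_le_of_sq_le Γ c hcard hctail (not_le.1 hcase).le
      have h6 : A ≤ 4 * T₀ := by linarith
      refine ⟨h6, (not_le.1 hcase).le.trans ?_⟩
      calc 8 / 4 ^ ν * A ^ 2 ≤ 8 / 4 ^ ν * (4 * T₀) ^ 2 := by gcongr
        _ = _ := by ring
  have hT₁' : T₁ ≤ T₀ / 4 := hT₁T₀.trans (by gcongr; linarith)
  have hgP : ∀ x ∈ cube d, ‖g x‖ ≤ ‖P x‖ + 2 * T₁ := fun x hx => by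
    have h5 := happ x hx
    have h6 := norm_add_le (P x) (g x - P x)
    rw [add_sub_cancel] at h6
    linarith
  refine ⟨fun x hx => (hgP x hx).trans (by linarith [hPA x, key.1]), ?_⟩
  have hPm : Measurable P := measurable_sum_mul hons Γ c
  have hi0 : Integrable (fun x => 2 * ‖P x‖ ^ 2) (tm d) := by
    refine (integrable_of_bdd (M := A ^ 2) (hPm.norm.pow_const 2) fun x => ?_).const_mul _
    rw [norm_of_nonneg (by positivity)]
    exact pow_le_pow_left₀ (norm_nonneg _) (hPA x) 2
  have hi1 : Integrable (fun x => 2 * ‖P x‖ ^ 2 + 8 * T₁ ^ 2) (tm d) :=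
    hi0.add (integrable_const _)
  calc ∫ x in cube d, ‖g x‖ ^ 2 ≤ ∫ x, (2 * ‖P x‖ ^ 2 + 8 * T₁ ^ 2) ∂tm d := by
        refine integral_mono_of_nonneg (Filter.Eventually.of_forall fun x => by positivity) hi1 ?_
        rw [Filter.EventuallyLE, ae_restrict_iff' (measurableSet_cube d)]
        refine Filter.Eventually.of_forall fun x hx => ?_
        have h5 := pow_le_pow_left₀ (norm_nonneg _) (hgP x hx) 2
        nlinarith [sq_nonneg (‖P x‖ - 2 * T₁)]
    _ = 2 * ∑ k ∈ Γ, ‖c k‖ ^ 2 + 8 * T₁ ^ 2 := by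
        rw [integral_add hi0 (integrable_const _), integral_const_mul, hpars]
        simp
    _ ≤ 2 * (128 * T₀ ^ 2 / 4 ^ ν) + 8 * (T₀ / (4 * 4 ^ ν)) ^ 2 := by
        gcongr; exact key.2
    _ = (256 + 1 / (2 * 4 ^ ν)) * T₀ ^ 2 / 4 ^ ν := by field_simp; ring
    _ ≤ 289 * T₀ ^ 2 / 4 ^ ν := by
        gcongr
        have : 1 / (2 * (4:ℝ) ^ ν) ≤ 1 := by
          rw [div_le_one (by positivity)]; linarith
        linarith
    _ = _ := by ring

/-- Interpolation of the `L_q`-norm between `L_2` and the sup-norm. -/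
theorem LqNorm_le_of_bound {d : ℕ} {q : ℝ≥0∞} (hq : 2 ≤ q) {g : (Fin d → ℝ) → ℂ}
    (hg : Continuous g) {B W : ℝ} (hB : 0 ≤ B) (hW : 0 < W) (hsup : ∀ x ∈ cube d, ‖g x‖ ≤ B)
    (hL2 : ∫ x in cube d, ‖g x‖ ^ 2 ≤ B ^ 2 / W) :
    LqNorm d q g ≤ ENNReal.ofReal (B * W⁻¹ ^ (1 / q.toReal)) := by
  have hae : ∀ᵐ x ∂volume.restrict (cube d), ‖g x‖ ≤ B := by
    rw [ae_restrict_iff' (measurableSet_cube d)]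
    exact Filter.Eventually.of_forall hsup
  rcases eq_or_ne q ∞ with rfl | hqt
  · rw [ENNReal.toReal_top, _root_.div_zero, Real.rpow_zero, mul_one, LqNorm, eLpNorm_exponent_top]
    exact eLpNormEssSup_le_of_ae_bound hae
  · have hq2 : 2 ≤ q.toReal := by
      have := (ENNReal.toReal_le_toReal (by norm_num) hqt).2 hq
      simpa using this
    have hq0 : q ≠ 0 := fun h => by simp [h] at hq
    set s := q.toReal with hs
    have hi2 : Integrable (fun x => ‖g x‖ ^ 2) (volume.restrict (cube d)) := by
      have := (hg.norm.pow 2).continuousOn.integrableOn_compact (μ := volume)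
        (isCompact_Icc (a := (0 : Fin d → ℝ)) (b := 1))
      exact this.mono_set (cube_subset_Icc d)
    have hm : MemLp g q (volume.restrict (cube d)) := by
      have : IsProbabilityMeasure (volume.restrict (cube d)) :=
        inferInstanceAs (IsProbabilityMeasure (tm d))
      exact MemLp.of_bound hg.aestronglyMeasurable B hae
    rw [LqNorm, hm.eLpNorm_eq_integral_rpow_norm hq0 hqt, ← hs]
    refine ENNReal.ofReal_le_ofReal ?_
    have h1 : ∫ x in cube d, ‖g x‖ ^ s ≤ B ^ (s - 2) * (B ^ 2 / W) := by
      calc ∫ x in cube d, ‖g x‖ ^ s ≤ ∫ x in cube d, B ^ (s - 2) * ‖g x‖ ^ 2 := by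
            refine integral_mono_of_nonneg (Filter.Eventually.of_forall fun x => by positivity)
              (hi2.const_mul _) ?_
            filter_upwards [hae] with x hx
            rcases eq_or_lt_of_le (norm_nonneg (g x)) with h0 | h0
            · rw [← h0, Real.zero_rpow (by linarith)]; positivity
            · have e : ‖g x‖ ^ s = ‖g x‖ ^ (s - 2) * ‖g x‖ ^ 2 := by
                rw [← Real.rpow_two, ← Real.rpow_add h0]; congr 1; ring
              rw [e]
              gcongr
        _ ≤ _ := by
            rw [integral_const_mul]; gcongr
    have h2 : B ^ (s - 2) * (B ^ 2 / W) = B ^ s * W⁻¹ := by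
      rcases hB.eq_or_lt with h0 | h0
      · rw [← h0, Real.zero_rpow (by linarith : s ≠ 0)]; simp
      · rw [← Real.rpow_two, div_eq_mul_inv, ← mul_assoc, ← Real.rpow_add h0]; congr 2; ring
    have h3 := rpow_le_rpow (integral_nonneg fun x => by positivity) (h1.trans_eq h2)
      (by positivity : 0 ≤ s⁻¹)
    rw [Real.mul_rpow (by positivity) (by positivity), ← Real.rpow_mul hB,
      mul_inv_cancel₀ (by linarith), Real.rpow_one] at h3
    rwa [one_div]

open Classical in
theorem samplingWidth_le_of_points {d m : ℕ} {N : ((Fin d → ℝ) → ℂ) → ℝ≥0∞} {q B : ℝ≥0∞}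
    (t : Fin m → Fin d → ℝ) (ht : ∀ i, t i ∈ cube d)
    (h : ∀ f f' : (Fin d → ℝ) → ℂ, Continuous f → N f ≤ 1 → Continuous f' → N f' ≤ 1 →
      (∀ i, f (t i) = f' (t i)) → LqNorm d q (f - f') ≤ B) :
    samplingWidth d m N q ≤ B := by
  set R : (Fin m → ℂ) → ((Fin d → ℝ) → ℂ) := fun y =>
    if hy : ∃ f : (Fin d → ℝ) → ℂ, (Continuous f ∧ N f ≤ 1) ∧ ∀ i, f (t i) = y i
    then hy.choose else 0 with hR
  refine iInf_le_of_le t (iInf_le_of_le ht (iInf_le_of_le R (iSup₂_le fun f hf => ?_)))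
  have hy : ∃ f' : (Fin d → ℝ) → ℂ, (Continuous f' ∧ N f' ≤ 1) ∧ ∀ i, f' (t i) = f (t i) :=
    ⟨f, hf, fun _ => rfl⟩
  have e : (R fun i => f (t i)) = hy.choose := dif_pos hy
  rw [e]
  exact h f _ hf.1 hf.2 hy.choose_spec.1.1 hy.choose_spec.1.2 fun i => (hy.choose_spec.2 i).symm

theorem succ_sq_le_four_mul_two_pow (s : ℕ) : (s + 1) ^ 2 ≤ 4 * 2 ^ s := by
  induction s using Nat.strong_induction_on with
  | _ s ih =>
    match s with
    | 0 => norm_num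
    | 1 => norm_num
    | 2 => norm_num
    | s + 3 =>
      have h := ih (s + 2) (by omega)
      rw [show 2 ^ (s + 3) = 2 * 2 ^ (s + 2) by rw [pow_succ 2 (s + 2)]; ring]
      linarith [show (s + 3 + 1) ^ 2 ≤ 2 * (s + 2 + 1) ^ 2 by nlinarith [Nat.zero_le s]]

theorem mul_log_succ_le {c n : ℕ} (hn : n ≠ 0) (h : 4 * c ^ 2 ≤ n) :
    c * (Nat.log 2 n + 1) ≤ n := by
  have h1 := succ_sq_le_four_mul_two_pow (Nat.log 2 n)
  have h2 := Nat.pow_log_le_self 2 hn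
  rcases le_total (Nat.log 2 n + 1) (4 * c) with h3 | h3
  · nlinarith
  · nlinarith

/-- Choice of the truncation levels in terms of the number of sampling points. -/
theorem exists_levels {d : ℕ} (hd : 1 ≤ d) {β γ : ℝ} (hβ : 0 < β) (hγ : 0 ≤ γ) :
    ∃ Q : ℝ, 0 < Q ∧ ∃ m₀ : ℕ, 1 ≤ m₀ ∧ ∀ m : ℕ, m₀ ≤ m → ∃ ν n₀ n₁ : ℕ, 1 ≤ ν ∧
      (cross d n₀).card * 32 ≤ 4 ^ ν ∧
      400000 * 4 ^ ν * (ν:ℝ) ^ 2 * Real.log (4 * (cross d n₁).card) ≤ m ∧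
      4 * (4:ℝ) ^ ν * ((2:ℝ) ^ (-(n₁:ℝ) * β) * ((n₁:ℝ) + 1) ^ γ) ≤
        (2:ℝ) ^ (-(n₀:ℝ) * β) * ((n₀:ℝ) + 1) ^ γ ∧
      ((4:ℝ) ^ ν)⁻¹ ≤ Q * ((m:ℝ)⁻¹ * logStar m ^ 3) ∧
      ((2:ℝ) ^ n₀)⁻¹ ≤ Q * ((m:ℝ)⁻¹ * logStar m ^ (d + 2)) ∧
      (n₀:ℝ) + 1 ≤ Q * logStar m := by
  obtain ⟨b, hb⟩ := exists_nat_ge ((β + 2) / β)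
  rw [div_le_iff₀ hβ] at hb
  obtain ⟨κ, hκ⟩ : ∃ κ, 400000 * (b * d + 3) ≤ 2 ^ κ := ⟨_, Nat.lt_two_pow_self.le⟩
  set a := κ + 3 with ha
  set c := d + a + 12 with hc
  have hev : ∀ᶠ l : ℕ in Filter.atTop,
      (2:ℝ) ^ (-(l:ℝ) * 1) * ((l:ℝ) + 1) ^ γ < 1 / (4 * ((b:ℝ) + 1) ^ γ) :=
    (summable_two_rpow_mul_rpow one_pos γ).tendsto_atTop_zero.eventually_lt_const (by positivity)
  obtain ⟨l₀, hl₀⟩ := Filter.eventually_atTop.1 hev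
  refine ⟨2 ^ (a + d + 7), by positivity, 2 ^ (l₀ + 4 * c ^ 2 + 1), Nat.one_le_two_pow,
    fun m hm => ?_⟩
  have hm0 : m ≠ 0 := by
    have := Nat.one_le_two_pow (n := l₀ + 4 * c ^ 2 + 1); omega
  set l := Nat.log 2 m with hl
  have hll : l₀ + 4 * c ^ 2 + 1 ≤ l := Nat.le_log_of_pow_le (by norm_num) hm
  have hlm : 2 ^ l ≤ m := Nat.pow_log_le_self 2 hm0
  have hml : m < 2 ^ (l + 1) := Nat.lt_pow_succ_log_self (by norm_num) m
  have hl0 : l ≠ 0 := by omega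
  set s := Nat.log 2 l with hs
  have hsl : 2 ^ s ≤ l := Nat.pow_log_le_self 2 hl0
  have hls : l + 1 ≤ 2 ^ (s + 1) := Nat.lt_pow_succ_log_self (by norm_num) l
  have hcs : c * (s + 1) ≤ l := mul_log_succ_le hl0 (by omega)
  set e := 6 + (s + 1) * (d - 1) with he
  have hbig : 3 * s + a + 3 + e ≤ l := by
    refine le_trans ?_ hcs
    obtain ⟨d', rfl⟩ := Nat.exists_eq_add_of_le' hd
    simp only [hc, he, Nat.add_sub_cancel]
    nlinarith [Nat.zero_le (a * s), Nat.zero_le s]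
  obtain ⟨ν, hν1, hν2⟩ : ∃ ν, 2 * ν + 3 * s + a ≤ l ∧ l ≤ 2 * ν + 3 * s + a + 1 :=
    ⟨(l - 3 * s - a) / 2, by omega, by omega⟩
  obtain ⟨n₀, hn₀⟩ : ∃ n₀, 2 * ν = n₀ + e := ⟨2 * ν - e, by omega⟩
  have h4ν : (4:ℕ) ^ ν = 2 ^ (2 * ν) := by rw [pow_mul]; norm_num
  have h4νR : (4:ℝ) ^ ν = 2 ^ (2 * ν) := by rw [pow_mul]; norm_num
  have hmR : (0:ℝ) < m := by exact_mod_cast Nat.pos_of_ne_zero hm0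
  have hlL : (l:ℝ) ≤ logStar m := by
    refine le_trans ?_ (le_max_left _ _)
    rw [Real.le_logb_iff_rpow_le (by norm_num) hmR, Real.rpow_natCast]
    exact_mod_cast hlm
  have hL1 : 1 ≤ logStar m := le_max_right _ _
  set L := logStar m with hL
  have hsL : (2:ℝ) ^ s ≤ L := le_trans (by exact_mod_cast hsl) hlL
  have hmQ : (m:ℝ) ≤ 2 ^ (a + 2) * 4 ^ ν * L ^ 3 := by
    calc (m:ℝ) ≤ 2 ^ (l + 1) := by exact_mod_cast hml.le
      _ ≤ 2 ^ (2 * ν + 3 * s + a + 1 + 1) := pow_le_pow_right₀ (by norm_num) (by omega)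
      _ = 2 ^ (a + 2) * 4 ^ ν * ((2:ℝ) ^ s) ^ 3 := by
        rw [h4νR, ← pow_mul, ← pow_add, ← pow_add]; congr 1; ring
      _ ≤ _ := by gcongr
  refine ⟨ν, n₀, b * l, by omega, ?_, ?_, ?_, ?_, ?_, ?_⟩
  · calc (cross d n₀).card * 32 ≤ (n₀ + 1) ^ (d - 1) * 2 ^ (n₀ + 1) * 32 :=
          Nat.mul_le_mul_right _ (card_cross_le d n₀ hd)
      _ ≤ (2 ^ (s + 1)) ^ (d - 1) * 2 ^ (n₀ + 1) * 32 := by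
          have : n₀ + 1 ≤ 2 ^ (s + 1) := by omega
          gcongr
      _ = 4 ^ ν := by
          rw [h4ν, hn₀, he, ← pow_mul, show 32 = 2 ^ 5 by norm_num, ← pow_add, ← pow_add]
          congr 1; ring
  · have hcard : 4 * (cross d (b * l)).card ≤ 2 ^ (b * l * d + 3) := by
      calc 4 * (cross d (b * l)).card ≤ 4 * ((b * l + 1) ^ (d - 1) * 2 ^ (b * l + 1)) :=
            Nat.mul_le_mul_left _ (card_cross_le d _ hd)
        _ ≤ 4 * ((2 ^ (b * l)) ^ (d - 1) * 2 ^ (b * l + 1)) := by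
            have : b * l + 1 ≤ 2 ^ (b * l) := Nat.lt_two_pow_self
            gcongr
        _ = 2 ^ (b * l * d + 3) := by
            obtain ⟨d', rfl⟩ := Nat.exists_eq_add_of_le' hd
            rw [show 4 = 2 ^ 2 by norm_num, Nat.add_sub_cancel, ← pow_mul, ← pow_add, ← pow_add]
            congr 1; ring
    have hcp : 0 < (cross d (b * l)).card := Finset.card_pos.2 ⟨0, zero_mem_cross d _⟩
    have hlog : Real.log (4 * (cross d (b * l)).card) ≤ ((b * d + 3 : ℕ) : ℝ) * l := by
      have h1 : Real.log (4 * (cross d (b * l)).card) ≤ Real.log ((2:ℝ) ^ (b * l * d + 3)) :=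
        Real.log_le_log (by positivity) (by exact_mod_cast hcard)
      rw [Real.log_pow] at h1
      have h2 : Real.log 2 ≤ 1 := by linarith [Real.log_two_lt_d9]
      calc Real.log (4 * (cross d (b * l)).card) ≤ ((b * l * d + 3 : ℕ) : ℝ) * 1 :=
            h1.trans (mul_le_mul_of_nonneg_left h2 (Nat.cast_nonneg _))
        _ ≤ _ := by
            rw [mul_one]
            have : b * l * d + 3 ≤ (b * d + 3) * l := by
              have : 1 ≤ l := by omega
              nlinarith
            exact_mod_cast this
    have hνl : (ν:ℝ) ≤ l := by
      have : ν ≤ l := by omega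
      exact_mod_cast this
    have hlog0 : 0 ≤ Real.log (4 * (cross d (b * l)).card) := by
      have : (1:ℝ) ≤ (cross d (b * l)).card := by exact_mod_cast hcp
      exact Real.log_nonneg (by linarith)
    calc 400000 * 4 ^ ν * (ν:ℝ) ^ 2 * Real.log (4 * (cross d (b * l)).card)
        ≤ 400000 * 4 ^ ν * (l:ℝ) ^ 2 * (((b * d + 3 : ℕ) : ℝ) * l) := by gcongr
      _ = ((400000 * (b * d + 3) * 4 ^ ν * l ^ 3 : ℕ) : ℝ) := by push_cast; ring
      _ ≤ ((2 ^ κ * 4 ^ ν * (2 ^ (s + 1)) ^ 3 : ℕ) : ℝ) := by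
          have : l ≤ 2 ^ (s + 1) := by omega
          exact_mod_cast (by gcongr)
      _ = ((2 ^ (κ + 2 * ν + (s + 1) * 3) : ℕ) : ℝ) := by
          rw [h4ν, ← pow_mul, ← pow_add, ← pow_add]
      _ ≤ ((2 ^ l : ℕ) : ℝ) := by
          have : κ + 2 * ν + (s + 1) * 3 ≤ l := by omega
          exact_mod_cast Nat.pow_le_pow_right (by norm_num) this
      _ ≤ m := by exact_mod_cast hlm
  · have h1 := (hl₀ l (by omega)).le
    rw [le_div_iff₀ (by positivity)] at h1
    have h2 : (((b * l : ℕ) : ℝ) + 1) ^ γ ≤ ((b:ℝ) + 1) ^ γ * ((l:ℝ) + 1) ^ γ := by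
      rw [← Real.mul_rpow (by positivity) (by positivity)]
      refine rpow_le_rpow (by positivity) ?_ hγ
      push_cast
      nlinarith [b.cast_nonneg (α := ℝ), l.cast_nonneg (α := ℝ)]
    have h3 : (4:ℝ) ^ ν ≤ 2 ^ (l:ℝ) := by
      rw [h4νR, Real.rpow_natCast]
      exact pow_le_pow_right₀ (by norm_num) (by omega)
    have h4 : (2:ℝ) ^ (-((b * l : ℕ):ℝ) * β) ≤ 2 ^ (-(l:ℝ) * β - l - l) := by
      refine rpow_le_rpow_of_exponent_le (by norm_num) ?_
      push_cast
      nlinarith [l.cast_nonneg (α := ℝ)]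
    have h5 : (1:ℝ) ≤ ((n₀:ℝ) + 1) ^ γ := Real.one_le_rpow (by linarith [n₀.cast_nonneg (α := ℝ)]) hγ
    calc 4 * (4:ℝ) ^ ν * ((2:ℝ) ^ (-((b * l : ℕ):ℝ) * β) * (((b * l : ℕ):ℝ) + 1) ^ γ)
        ≤ 4 * 2 ^ (l:ℝ) * (2 ^ (-(l:ℝ) * β - l - l) * (((b:ℝ) + 1) ^ γ * ((l:ℝ) + 1) ^ γ)) := by
          gcongr
      _ = (2 ^ (l:ℝ) * 2 ^ (-(l:ℝ) * β - l)) *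
          ((2:ℝ) ^ (-(l:ℝ) * 1) * ((l:ℝ) + 1) ^ γ * (4 * ((b:ℝ) + 1) ^ γ)) := by
          rw [show -(l:ℝ) * β - l - l = (-(l:ℝ) * β - l) + -(l:ℝ) * 1 by ring,
            Real.rpow_add (by norm_num) (-(l:ℝ) * β - l)]
          ring
      _ ≤ (2 ^ (l:ℝ) * 2 ^ (-(l:ℝ) * β - l)) * 1 := by gcongr
      _ = (2:ℝ) ^ (-(l:ℝ) * β) * 1 := by
          rw [← Real.rpow_add (by norm_num)]; congr 2; ring
      _ ≤ _ := by
          have : (n₀:ℝ) ≤ l := by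
            have : n₀ ≤ l := by omega
            exact_mod_cast this
          gcongr
          norm_num
  · calc ((4:ℝ) ^ ν)⁻¹ ≤ 2 ^ (a + 2) * ((m:ℝ)⁻¹ * L ^ 3) := by
          rw [inv_le_iff_one_le_mul₀ (by positivity)]
          calc (1:ℝ) = (m:ℝ)⁻¹ * m := (inv_mul_cancel₀ hmR.ne').symm
            _ ≤ (m:ℝ)⁻¹ * (2 ^ (a + 2) * 4 ^ ν * L ^ 3) := by gcongr
            _ = _ := by ring
      _ ≤ _ := by
          exact mul_le_mul_of_nonneg_right (pow_le_pow_right₀ (by norm_num) (by omega))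
            (by positivity)
  · have h2e : (2:ℝ) ^ e ≤ 2 ^ (d + 5) * L ^ (d - 1) := by
      calc (2:ℝ) ^ e = 2 ^ (d + 5) * (2 ^ s) ^ (d - 1) := by
            obtain ⟨d', rfl⟩ := Nat.exists_eq_add_of_le' hd
            rw [he, ← pow_mul, ← pow_add, Nat.add_sub_cancel]; congr 1; ring
        _ ≤ _ := by gcongr
    have h1 : (m:ℝ) ≤ 2 ^ (a + d + 7) * L ^ (d + 2) * 2 ^ n₀ := by
      calc (m:ℝ) ≤ 2 ^ (a + 2) * (2 ^ n₀ * (2 ^ (d + 5) * L ^ (d - 1))) * L ^ 3 := by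
            refine hmQ.trans ?_
            rw [h4νR, hn₀, pow_add 2 n₀ e]
            gcongr
        _ = _ := by
            obtain ⟨d', rfl⟩ := Nat.exists_eq_add_of_le' hd
            rw [Nat.add_sub_cancel]; ring
    rw [inv_le_iff_one_le_mul₀ (by positivity)]
    calc (1:ℝ) = (m:ℝ)⁻¹ * m := (inv_mul_cancel₀ hmR.ne').symm
      _ ≤ (m:ℝ)⁻¹ * (2 ^ (a + d + 7) * L ^ (d + 2) * 2 ^ n₀) := by gcongr
      _ = _ := by ring
  · have h1 : (n₀:ℝ) + 1 ≤ l := by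
      have : n₀ + 1 ≤ l := by omega
      exact_mod_cast this
    have h2 : (1:ℝ) ≤ 2 ^ (a + d + 7) := one_le_pow₀ (by norm_num)
    nlinarith

/-- Sampling widths of classes of functions with decaying layers. -/
theorem samplingWidth_isAsympLe {d : ℕ} (hd : 1 ≤ d) {β γ D : ℝ} (hβ : 0 < β) (hγ : 0 ≤ γ)
    (hD : 0 ≤ D) {q : ℝ≥0∞} (hq : 2 ≤ q) {N : ((Fin d → ℝ) → ℂ) → ℝ≥0∞}
    (hN : ∀ f, N f ≤ 1 → LayerDecay d β γ D f) :
    IsAsympLe (fun m => samplingWidth d m N q) (fun m => (m:ℝ) ^ (-(β + 1 / q.toReal)) *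
      logStar m ^ (((d:ℝ) - 1) * β + γ + 3 * (β + 1 / q.toReal))) := by
  obtain ⟨Q, hQ, m₀, hm₀, hlev⟩ := exists_levels hd hβ hγ
  have hK := tailConst_pos hβ γ
  have hq' : 0 ≤ 1 / q.toReal := by positivity
  set τ := 1 / q.toReal with hτ
  refine ⟨17 * (D * tailConst β γ) * (Q ^ β * Q ^ γ * Q ^ τ) + 1, by positivity, m₀,
    fun m hm => ?_⟩
  obtain ⟨ν, n₀, n₁, hν, hcard, hlog, hT, h4, h2, hn⟩ := hlev m hm
  have hT' : 4 * 4 ^ ν * tailBound β γ D n₁ ≤ tailBound β γ D n₀ := by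
    have := mul_le_mul_of_nonneg_left hT (by positivity : 0 ≤ D * tailConst β γ)
    unfold tailBound
    linarith
  obtain ⟨t, ht, hs⟩ := exists_sampling_points hβ hγ hD hν hcard hlog hT'
  have hB : 0 ≤ 17 * tailBound β γ D n₀ := by
    have := tailBound_nonneg (γ := γ) hβ hD n₀; positivity
  refine (samplingWidth_le_of_points t ht fun f f' hf hNf hf' hNf' he => ?_).trans
    (ENNReal.ofReal_le_ofReal (?_ :
      17 * tailBound β γ D n₀ * ((4:ℝ) ^ ν)⁻¹ ^ τ ≤ _))
  · obtain ⟨h1, h2⟩ := hs f f' hf hf' (hN f hNf) (hN f' hNf') he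
    exact LqNorm_le_of_bound hq (hf.sub hf') hB (by positivity) h1 h2
  · have hm0 : (0:ℝ) < m := by exact_mod_cast lt_of_lt_of_le hm₀ hm
    have hL : 0 < logStar m := lt_of_lt_of_le one_pos (le_max_right _ _)
    set L := logStar m
    have e1 : (2:ℝ) ^ (-(n₀:ℝ) * β) ≤ Q ^ β * ((m:ℝ) ^ (-β) * L ^ (((d:ℝ) + 2) * β)) := by
      have := rpow_le_rpow (by positivity) h2 hβ.le
      rw [Real.mul_rpow hQ.le (by positivity), Real.mul_rpow (by positivity) (by positivity),
        Real.inv_rpow (by positivity), Real.inv_rpow (by positivity), ← Real.rpow_neg (by positivity),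
        ← Real.rpow_neg (by positivity), ← Real.rpow_natCast, ← Real.rpow_mul (by norm_num),
        ← Real.rpow_natCast, ← Real.rpow_mul hL.le] at this
      push_cast at this
      rwa [neg_mul, ← mul_neg]
    have e2 : ((n₀:ℝ) + 1) ^ γ ≤ Q ^ γ * L ^ γ := by
      rw [← Real.mul_rpow hQ.le hL.le]
      exact rpow_le_rpow (by positivity) hn hγ
    have e3 : ((4:ℝ) ^ ν)⁻¹ ^ τ ≤ Q ^ τ * ((m:ℝ) ^ (-τ) * L ^ (3 * τ)) := by
      refine (rpow_le_rpow (by positivity) h4 hq').trans_eq ?_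
      rw [Real.mul_rpow hQ.le (by positivity), Real.mul_rpow (by positivity) (by positivity),
        Real.inv_rpow (by positivity), ← Real.rpow_neg (by positivity),
        ← Real.rpow_natCast, ← Real.rpow_mul hL.le]
      norm_num
    calc 17 * tailBound β γ D n₀ * ((4:ℝ) ^ ν)⁻¹ ^ τ
        ≤ 17 * (D * tailConst β γ * (Q ^ β * ((m:ℝ) ^ (-β) * L ^ (((d:ℝ) + 2) * β)) *
          (Q ^ γ * L ^ γ))) * (Q ^ τ * ((m:ℝ) ^ (-τ) * L ^ (3 * τ))) := by
          unfold tailBound; gcongr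
      _ = 17 * (D * tailConst β γ) * (Q ^ β * Q ^ γ * Q ^ τ) * ((m:ℝ) ^ (-(β + τ)) *
          L ^ (((d:ℝ) - 1) * β + γ + 3 * (β + τ))) := by
          rw [show ((d:ℝ) - 1) * β + γ + 3 * (β + τ) = ((d:ℝ) + 2) * β + γ + 3 * τ by ring,
            Real.rpow_add hL, Real.rpow_add hL, neg_add, Real.rpow_add hm0]
          ring
      _ ≤ _ := by gcongr; linarith

/-- upper bounds for the non-linear sampling widths
`ρ_m(S^r_{p,θ}B)_{L_q}` and `ρ_m(S^r_p W)_{L_q}`. -/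
theorem statement19 (d : ℕ) (hd : 1 ≤ d) (p q : ℝ≥0∞) (hp1 : 1 < p) (hp2 : p ≤ 2)
    (hq : 2 ≤ q) (r : ℝ) (hr : 1/p.toReal < r) :
    (∀ θ : ℝ≥0∞, 1 ≤ θ → θ ≤ 2 →
      IsAsympLe (fun m => samplingWidth d m (besovNorm d r p θ) q)
        (fun m => (m : ℝ) ^ (-(r - 1/p.toReal + 1/q.toReal)) *
          logStar m ^ (((d : ℝ) - 1) * (r + 1 - 1/p.toReal - 1/θ.toReal) +
            3 * (r - 1/p.toReal + 1/q.toReal)))) ∧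
    IsAsympLe (fun m => samplingWidth d m (sobolevNorm d r p) q)
      (fun m => (m : ℝ) ^ (-(r - 1/p.toReal + 1/q.toReal)) *
        logStar m ^ (((d : ℝ) - 1) * (r + 1 - 2/p.toReal) +
          3 * (r - 1/p.toReal + 1/q.toReal))) := by
  have hβ : 0 < r - 1 / p.toReal := sub_pos.2 hr
  have hd' : (0:ℝ) ≤ (d:ℝ) - 1 := sub_nonneg.2 (by exact_mod_cast hd)
  have hexp : ∀ θ : ℝ≥0∞, 1 ≤ θ → θ ≤ 2 → 0 ≤ ((d:ℝ) - 1) * (1 - 1 / θ.toReal) := by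
    intro θ h1 h2
    obtain ⟨h3, -⟩ := toReal_mem_Icc h1 h2
    exact mul_nonneg hd' (sub_nonneg.2 ((div_le_one (by linarith)).2 h3))
  constructor
  · intro θ hθ1 hθ2
    rw [show ((d:ℝ) - 1) * (r + 1 - 1 / p.toReal - 1 / θ.toReal) =
      ((d:ℝ) - 1) * (r - 1 / p.toReal) + ((d:ℝ) - 1) * (1 - 1 / θ.toReal) by ring]
    exact samplingWidth_isAsympLe hd hβ (hexp θ hθ1 hθ2) zero_le_one hq
      fun f hf => besov_layer hd hp1 hp2 hθ1 hθ2 hf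
  · obtain ⟨D, hD, hlay⟩ := sobolev_layer hd hp1 hp2 (r := r)
      (lt_of_le_of_lt (by positivity) hr)
    rw [show ((d:ℝ) - 1) * (r + 1 - 2 / p.toReal) =
      ((d:ℝ) - 1) * (r - 1 / p.toReal) + ((d:ℝ) - 1) * (1 - 1 / p.toReal) by ring]
    exact samplingWidth_isAsympLe hd hβ (hexp p hp1.le hp2) hD hq hlay

end Paper
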